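/- There exist a constant C and a real number x₀ such that for all real x ≥ x₀ and every multiplicative function f with -1 ≤ f(n) ≤ 1 for all positive integers n: if ∑_{n ≤ x} f(n)/n < −1/(log log x)^{3/5}, then ∑_{k=1}^{∞} (1 + f(2^k))/2^k ≤ C (log x)^{−1/20}. -/

import Mathlib

/-- A multiplicative function `f : ℕ → ℝ`: `f 1 = 1` and `f (m * n) = f m * f n`
whenever `m` and `n` are coprime. -/
def IsMult (f : ℕ → ℝ) : Prop :=
  f 1 = 1 ∧ ∀ m n : ℕ, Nat.Coprime m n → f (m * n) = f m * f n

open Real Finset in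
theorem sum_Ioc_div_sq_le {c : ℕ → ℝ} {B : ℝ} (hc : ∀ n, 0 ≤ c n)
    (hB : ∀ N : ℕ, ∑ n ∈ Icc 1 N, c n ≤ B * N) (k X : ℕ) (hkX : k ≤ X) :
    ∑ n ∈ Ioc k X, c n / ((n : ℝ) + 1) ^ 2 ≤
      (∑ n ∈ Icc 1 X, c n) / ((X : ℝ) + 1) ^ 2 + 2 * B * (1 / ((k : ℝ) + 1) - 1 / ((X : ℝ) + 1)) := by
  induction X, hkX using Nat.le_induction with
  | base => simp; exact div_nonneg (sum_nonneg fun i _ => hc i) (by positivity)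
  | succ X hX ih =>
    rw [← Finset.insert_Ioc_right_eq_Ioc_add_one hX, Finset.sum_insert (by simp),
      Finset.sum_Icc_succ_top (by omega), add_comm (∑ n ∈ Icc 1 X, c n)]
    set S := ∑ n ∈ Icc 1 X, c n with hS
    have h1 : S ≤ B * X := hB X
    push_cast
    have hx : (0 : ℝ) ≤ X := by positivity
    have hB0 : 0 ≤ B := by
      have := hB 1
      simp at this
      exact (hc 1).trans this
    have key : S * (1 / ((X : ℝ) + 1) ^ 2 - 1 / ((X : ℝ) + 1 + 1) ^ 2) ≤
        2 * B * (1 / ((X : ℝ) + 1) - 1 / ((X : ℝ) + 1 + 1)) := by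
      have e1 : (1 / ((X : ℝ) + 1) ^ 2 - 1 / ((X : ℝ) + 1 + 1) ^ 2) =
        (2 * X + 3) / (((X : ℝ) + 1) ^ 2 * ((X : ℝ) + 1 + 1) ^ 2) := by field_simp; ring
      have e2 : 2 * B * (1 / ((X : ℝ) + 1) - 1 / ((X : ℝ) + 1 + 1)) =
        2 * B * (((X : ℝ) + 1) * ((X : ℝ) + 1 + 1)) / (((X : ℝ) + 1) ^ 2 * ((X : ℝ) + 1 + 1) ^ 2) := by
        field_simp; ring
      rw [e1, e2, mul_div_assoc']
      refine div_le_div_of_nonneg_right ?_ (by positivity)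
      have := mul_le_mul_of_nonneg_right h1 (show (0 : ℝ) ≤ 2 * X + 3 by positivity)
      nlinarith [mul_nonneg hB0 hx]
    calc _ ≤ c (X + 1) / ((X : ℝ) + 1 + 1) ^ 2 + (S / ((X : ℝ) + 1) ^ 2 + 2 * B * (1 / ((k : ℝ) + 1) - 1 / ((X : ℝ) + 1))) := by
          gcongr
      _ ≤ _ := by
          rw [add_div]
          have : S / ((X : ℝ) + 1) ^ 2 = S * (1 / ((X : ℝ) + 1) ^ 2 - 1 / ((X : ℝ) + 1 + 1) ^ 2) + S / ((X : ℝ) + 1 + 1) ^ 2 := by ring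
          linarith

open Real Finset in
theorem sum_range_exp_kernel_le {c : ℕ → ℝ} {B : ℝ} (hc : ∀ n, 0 ≤ c n)
    (hB : ∀ N : ℕ, ∑ n ∈ Icc 1 N, c n ≤ B * N) (u : ℝ) (X : ℕ) :
    ∑ n ∈ range X, c n / n * exp (-|u - log n|) ≤ 9 * B := by
  have hB0 : 0 ≤ B := by
    have := hB 1
    simp at this
    exact (hc 1).trans this
  set k := ⌊exp u⌋₊ with hk
  have hkle : (k : ℝ) ≤ exp u := Nat.floor_le (exp_pos u).le
  have hklt : exp u < k + 1 := Nat.lt_floor_add_one _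
  have hsub : ∑ n ∈ range X, c n / n * exp (-|u - log n|) ≤
      ∑ n ∈ Icc 1 k ∪ Ioc k (k + X), c n / n * exp (-|u - log n|) := by
    have : ∑ n ∈ range X, c n / n * exp (-|u - log n|) = ∑ n ∈ (range X).filter (1 ≤ ·), c n / n * exp (-|u - log n|) := by
      rw [sum_filter]
      refine sum_congr rfl fun n _ => ?_
      split_ifs with h
      · rfl
      · have : n = 0 := by omega
        subst this; simp
    rw [this]
    refine sum_le_sum_of_subset_of_nonneg ?_ fun i _ _ => ?_
    · intro n hn
      simp at hn ⊢
      omega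
    · have := hc i; positivity
  refine hsub.trans ?_
  rw [sum_union (by
    rw [disjoint_left]; intro a ha hb; simp at ha hb; omega)]
  have h1 : ∑ n ∈ Icc 1 k, c n / n * exp (-|u - log n|) ≤ B := by
    calc _ ≤ ∑ n ∈ Icc 1 k, c n * exp (-u) := by
          refine sum_le_sum fun n hn => ?_
          simp at hn
          have hn0 : (0 : ℝ) < n := by exact_mod_cast (by omega : 0 < n)
          rw [div_mul_eq_mul_div, div_le_iff₀ hn0, mul_assoc]
          refine mul_le_mul_of_nonneg_left ?_ (hc n)
          calc exp (-|u - log n|) ≤ exp (-u + log n) := by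
                apply exp_le_exp.2; linarith [le_abs_self (u - log n)]
            _ = exp (-u) * n := by rw [exp_add, exp_log hn0]
      _ = (∑ n ∈ Icc 1 k, c n) * exp (-u) := by rw [sum_mul]
      _ ≤ (B * exp u) * exp (-u) := by
          gcongr
          exact (hB k).trans (by gcongr)
      _ = B := by rw [mul_assoc, ← exp_add]; simp
  have h2 : ∑ n ∈ Ioc k (k + X), c n / n * exp (-|u - log n|) ≤ 8 * B := by
    calc _ ≤ ∑ n ∈ Ioc k (k + X), 4 * exp u * (c n / ((n : ℝ) + 1) ^ 2) := by
          refine sum_le_sum fun n hn => ?_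
          simp at hn
          have hn0 : (1 : ℝ) ≤ n := by exact_mod_cast (by omega : 1 ≤ n)
          have : exp (-|u - log n|) ≤ exp u / n := by
            calc exp (-|u - log n|) ≤ exp (u - log n) := by
                  apply exp_le_exp.2; linarith [neg_abs_le (u - log n)]
              _ = exp u / n := by rw [exp_sub, exp_log (by linarith)]
          calc c n / n * exp (-|u - log n|) ≤ c n / n * (exp u / n) := by
                have := hc n; gcongr
            _ = c n * exp u * (1 / (n : ℝ) ^ 2) := by field_simp
            _ ≤ c n * exp u * (4 / ((n : ℝ) + 1) ^ 2) := by
                have := hc n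
                gcongr ?_ * ?_
                rw [div_le_div_iff₀ (by positivity) (by positivity)]
                nlinarith
            _ = _ := by ring
      _ = 4 * exp u * ∑ n ∈ Ioc k (k + X), (c n / ((n : ℝ) + 1) ^ 2) := by rw [mul_sum]
      _ ≤ 4 * exp u * (2 * B * (1 / ((k : ℝ) + 1))) := by
          gcongr
          refine (sum_Ioc_div_sq_le hc hB k (k + X) (by omega)).trans ?_
          have : (∑ n ∈ Icc 1 (k + X), c n) / (((k + X : ℕ) : ℝ) + 1) ^ 2 ≤ B * (1 / (((k + X : ℕ) : ℝ) + 1)) := by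
            calc _ ≤ B * ((k + X : ℕ) + 1) / (((k + X : ℕ) : ℝ) + 1) ^ 2 := by
                  gcongr
                  exact (hB _).trans (by gcongr; linarith)
              _ = _ := by field_simp
          have h3 : 0 ≤ B * (1 / (((k + X : ℕ) : ℝ) + 1)) := by positivity
          linarith
      _ ≤ 4 * (k + 1) * (2 * B * (1 / ((k : ℝ) + 1))) := by gcongr
      _ = 8 * B := by field_simp; ring
  linarith

/-- The weight `1 + Λ(n)`, dominating both `1` and the von Mangoldt function. -/
noncomputable def oneAddVonMangoldt (n : ℕ) : ℝ := 1 + ArithmeticFunction.vonMangoldt n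

theorem oneAddVonMangoldt_nonneg (n : ℕ) : 0 ≤ oneAddVonMangoldt n :=
  add_nonneg zero_le_one ArithmeticFunction.vonMangoldt_nonneg

open Real Finset in
theorem exists_sum_oneAddVonMangoldt_le :
    ∃ B : ℝ, ∀ N : ℕ, ∑ n ∈ Icc 1 N, oneAddVonMangoldt n ≤ B * N := by
  refine ⟨1 + (log 4 + 4), fun N => ?_⟩
  have := Chebyshev.psi_le_const_mul_self (x := (N : ℝ)) (by positivity)
  rw [Chebyshev.psi_eq_sum_Icc] at this
  simp only [oneAddVonMangoldt, sum_add_distrib]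
  simp at this ⊢
  have h0 : ∑ n ∈ Icc 0 N, ArithmeticFunction.vonMangoldt n = ∑ n ∈ Icc 1 N, ArithmeticFunction.vonMangoldt n := by
    symm
    refine sum_subset (fun n => by simp) fun n hn hn' => ?_
    have : n = 0 := by simp at hn hn'; omega
    simp [this]
  rw [h0] at this
  linarith

open Real Finset in
theorem exists_exp_kernel_sum_le :
    ∃ K : ℝ, 1 ≤ K ∧ ∀ (u : ℝ) (X : ℕ),
      ∑ n ∈ range X, oneAddVonMangoldt n / n * exp (-|u - log n|) ≤ K := by
  obtain ⟨B, hB⟩ := exists_sum_oneAddVonMangoldt_le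
  exact ⟨max 1 (9 * B), le_max_left _ _, fun u X =>
    (sum_range_exp_kernel_le oneAddVonMangoldt_nonneg hB u X).trans (le_max_right _ _)⟩

open Real Finset in
theorem exists_exp_kernel_tsum_le :
    ∃ K : ℝ, 1 ≤ K ∧ ∀ u : ℝ,
      Summable (fun n : ℕ => oneAddVonMangoldt n / n * exp (-|u - log n|)) ∧
      ∑' n : ℕ, oneAddVonMangoldt n / n * exp (-|u - log n|) ≤ K := by
  obtain ⟨K, hK1, hK⟩ := exists_exp_kernel_sum_le
  have h0 : ∀ u n, 0 ≤ oneAddVonMangoldt n / n * exp (-|u - log n|) := fun u n => by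
    have := oneAddVonMangoldt_nonneg n
    positivity
  exact ⟨K, hK1, fun u => ⟨summable_of_sum_range_le (h0 u) (hK u),
    Real.tsum_le_of_sum_range_le (h0 u) (hK u)⟩⟩

open Real Finset in
theorem exists_truncated_sum_le :
    ∃ K : ℝ, 1 ≤ K ∧ ∀ α β : ℝ, α ≤ β →
      Summable (fun n : ℕ => if α ≤ log n then
        oneAddVonMangoldt n / n * min 1 (exp (β - log n)) else 0) ∧
      ∑' n : ℕ, (if α ≤ log n then
        oneAddVonMangoldt n / n * min 1 (exp (β - log n)) else 0) ≤ K * (β - α + 1) := by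
  obtain ⟨K, hK1, hK⟩ := exists_exp_kernel_sum_le
  refine ⟨exp 1 * K * 2, by nlinarith [add_one_le_exp (1 : ℝ)], fun α β hαβ => ?_⟩
  set g : ℕ → ℝ := fun n : ℕ => if α ≤ log n then
        oneAddVonMangoldt n / n * min 1 (exp (β - log n)) else 0
  have h0 : ∀ n, 0 ≤ g n := fun n => by
    have := oneAddVonMangoldt_nonneg n
    simp only [g]
    split_ifs
    · have : 0 < min 1 (exp (β - log n)) := lt_min one_pos (exp_pos _)
      positivity
    · rfl
  set m := ⌊β - α⌋₊
  have hm1 : (m : ℝ) ≤ β - α := Nat.floor_le (by linarith)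
  have hm2 : β - α < m + 1 := Nat.lt_floor_add_one _
  have hg : ∀ n, g n ≤ exp 1 * ∑ k ∈ range (m + 1), oneAddVonMangoldt n / n * exp (-|(α + k) - log n|) := by
    intro n
    have hw : 0 ≤ oneAddVonMangoldt n / n := div_nonneg (oneAddVonMangoldt_nonneg n) (by positivity)
    simp only [g]
    split_ifs with h
    · rw [← mul_sum, mul_left_comm]
      refine mul_le_mul_of_nonneg_left ?_ hw
      rw [mul_sum]
      set j := min m ⌊log n - α⌋₊
      have hj : j ∈ range (m + 1) := by simp [j]
      refine le_trans ?_ (single_le_sum (f := fun k : ℕ => exp 1 * exp (-|(α + k) - log n|))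
        (fun i _ => by positivity) hj)
      simp only [← exp_add]
      have hf1 := Nat.floor_le (show 0 ≤ log n - α by linarith)
      have hf2 := Nat.lt_floor_add_one (log n - α)
      rcases le_total m ⌊log n - α⌋₊ with hle | hle
      · have : j = m := min_eq_left hle
        rw [this]
        refine (min_le_right _ _).trans (exp_le_exp.2 ?_)
        have : (m : ℝ) ≤ ⌊log n - α⌋₊ := by exact_mod_cast hle
        rw [abs_of_nonpos (by linarith)]
        linarith
      · have : j = ⌊log n - α⌋₊ := min_eq_right hle
        rw [this]
        refine (min_le_left _ _).trans (one_le_exp ?_)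
        rw [abs_of_nonpos (by linarith)]
        linarith
    · have : 0 ≤ ∑ k ∈ range (m + 1), oneAddVonMangoldt n / n * exp (-|(α + k) - log n|) :=
        sum_nonneg fun i _ => by positivity
      positivity
  have hb : ∀ X, ∑ n ∈ range X, g n ≤ exp 1 * K * 2 * (β - α + 1) := by
    intro X
    calc _ ≤ ∑ n ∈ range X, exp 1 * ∑ k ∈ range (m + 1), oneAddVonMangoldt n / n * exp (-|(α + k) - log n|) :=
          sum_le_sum fun n _ => hg n
      _ = exp 1 * ∑ k ∈ range (m + 1), ∑ n ∈ range X, oneAddVonMangoldt n / n * exp (-|(α + k) - log n|) := by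
          rw [← mul_sum, sum_comm]
      _ ≤ exp 1 * ∑ k ∈ range (m + 1), K := by
          gcongr with k _
          exact hK _ _
      _ = exp 1 * K * (m + 1) := by simp; ring
      _ ≤ exp 1 * K * (2 * (β - α + 1)) := by gcongr; linarith
      _ = _ := by ring
  exact ⟨summable_of_sum_range_le h0 hb, Real.tsum_le_of_sum_range_le h0 hb⟩

open Real Finset in
theorem exists_power_sum_le :
    ∃ K : ℝ, 1 ≤ K ∧ ∀ σ : ℝ, 0 < σ → σ ≤ 1 →
      Summable (fun n : ℕ => oneAddVonMangoldt n / n * exp (-(σ * log n))) ∧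
      ∑' n : ℕ, oneAddVonMangoldt n / n * exp (-(σ * log n)) ≤ K / σ := by
  obtain ⟨K, hK1, hK⟩ := exists_exp_kernel_sum_le
  refine ⟨exp 1 * K * 2, by nlinarith [add_one_le_exp (1 : ℝ)], fun σ hσ hσ1 => ?_⟩
  have hw : ∀ n : ℕ, 0 ≤ oneAddVonMangoldt n / n := fun n => div_nonneg (oneAddVonMangoldt_nonneg n) (by positivity)
  have h0 : ∀ n : ℕ, 0 ≤ oneAddVonMangoldt n / n * exp (-(σ * log n)) := fun n => mul_nonneg (hw n) (exp_pos _).le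
  have hb : ∀ X, ∑ n ∈ range X, oneAddVonMangoldt n / n * exp (-(σ * log n)) ≤ exp 1 * K * 2 / σ := by
    intro X
    have hr : exp (-σ) ≤ 1 - σ / 2 := by
      have h2 : exp (-σ) ≤ 1 / (1 + σ) := by
        rw [exp_neg, ← one_div]
        exact one_div_le_one_div_of_le (by linarith) (by linarith [add_one_le_exp σ])
      refine h2.trans ?_
      rw [div_le_iff₀ (by linarith)]
      nlinarith
    have hgeom : ∑ k ∈ range X, exp (-(σ * k)) ≤ 2 / σ := by
      have : ∀ k : ℕ, exp (-(σ * k)) = exp (-σ) ^ k := fun k => by rw [← exp_nat_mul]; ring_nf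
      simp only [this]
      have h1 := geom_sum_mul_neg (exp (-σ)) X
      have h3 : 0 ≤ exp (-σ) ^ X := by positivity
      have h4 : 0 ≤ ∑ k ∈ range X, exp (-σ) ^ k := sum_nonneg fun i _ => by positivity
      rw [le_div_iff₀ hσ]
      nlinarith
    calc _ ≤ ∑ n ∈ range X, exp 1 * ∑ k ∈ range X, exp (-(σ * k)) * (oneAddVonMangoldt n / n * exp (-|(k : ℝ) - log n|)) := by
          refine sum_le_sum fun n hn => ?_
          have hlog : 0 ≤ log n := log_natCast_nonneg n
          have hf1 := Nat.floor_le hlog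
          have hf2 := Nat.lt_floor_add_one (log n)
          have hj : ⌊log n⌋₊ ∈ range X := by
            simp at hn ⊢
            rcases Nat.eq_zero_or_pos n with h | h
            · simpa [h] using h ▸ hn
            · refine (Nat.floor_lt hlog).2 ?_
              have h1 : (0 : ℝ) < n := by exact_mod_cast h
              have h2 : (n : ℝ) < X := by exact_mod_cast hn
              linarith [log_le_sub_one_of_pos h1]
          rw [mul_sum]
          refine le_trans ?_ (single_le_sum (f := fun k : ℕ => exp 1 * (exp (-(σ * k)) * (oneAddVonMangoldt n / n * exp (-|(k : ℝ) - log n|))))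
            (fun i _ => by have := hw n; positivity) hj)
          have : exp (-(σ * log n)) ≤ exp 1 * exp (-(σ * ⌊log n⌋₊)) * exp (-|(⌊log n⌋₊ : ℝ) - log n|) := by
            rw [← exp_add, ← exp_add]
            apply exp_le_exp.2
            rw [abs_of_nonpos (by linarith)]
            nlinarith
          calc _ ≤ oneAddVonMangoldt n / n * (exp 1 * exp (-(σ * ⌊log n⌋₊)) * exp (-|(⌊log n⌋₊ : ℝ) - log n|)) :=
                mul_le_mul_of_nonneg_left this (hw n)
            _ = _ := by ring
      _ = exp 1 * ∑ k ∈ range X, exp (-(σ * k)) * ∑ n ∈ range X, oneAddVonMangoldt n / n * exp (-|(k : ℝ) - log n|) := by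
          rw [← mul_sum, sum_comm]
          simp only [mul_sum]
      _ ≤ exp 1 * ∑ k ∈ range X, exp (-(σ * k)) * K := by
          gcongr with k _
          exact hK _ _
      _ = exp 1 * K * ∑ k ∈ range X, exp (-(σ * k)) := by rw [← sum_mul]; ring
      _ ≤ exp 1 * K * (2 / σ) := by gcongr
      _ = _ := by ring
  exact ⟨summable_of_sum_range_le h0 hb, Real.tsum_le_of_sum_range_le h0 hb⟩

/-- The oscillating exponential `t ↦ exp(i t x)`. -/
noncomputable def osc (x t : ℝ) : ℂ := Complex.exp (((t * x : ℝ) : ℂ) * Complex.I)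

theorem norm_osc (x t : ℝ) : ‖osc x t‖ = 1 := Complex.norm_exp_ofReal_mul_I _

theorem continuous_osc (x : ℝ) : Continuous (osc x) := by
  unfold osc
  fun_prop

theorem osc_add (x y t : ℝ) : osc (x + y) t = osc x t * osc y t := by
  unfold osc
  rw [← Complex.exp_add]
  push_cast
  ring_nf

theorem conj_osc (x t : ℝ) : (starRingEnd ℂ) (osc x t) = osc (-x) t := by
  unfold osc
  rw [← Complex.exp_conj, map_mul, Complex.conj_ofReal, Complex.conj_I]
  push_cast
  ring_nf

section OscSeries

variable {c : ℕ → ℂ} (τ : ℕ → ℝ)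

theorem summable_norm_mul_osc (hc : Summable (fun n => ‖c n‖)) (t : ℝ) :
    Summable (fun n => ‖c n * osc (τ n) t‖) := by
  simpa [norm_osc] using hc

theorem norm_tsum_mul_osc_le (hc : Summable (fun n => ‖c n‖)) (t : ℝ) :
    ‖∑' n, c n * osc (τ n) t‖ ≤ ∑' n, ‖c n‖ := by
  refine (norm_tsum_le_tsum_norm (summable_norm_mul_osc τ hc t)).trans (le_of_eq ?_)
  simp [norm_osc]

theorem continuous_tsum_mul_osc (hc : Summable (fun n => ‖c n‖)) :
    Continuous (fun t => ∑' n, c n * osc (τ n) t) := by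
  refine continuous_tsum (fun n => continuous_const.mul (continuous_osc _)) hc fun n t => ?_
  simp [norm_osc]

open MeasureTheory in
theorem integrable_mul_tsum_osc (hc : Summable (fun n => ‖c n‖)) {ψ : ℝ → ℂ} (hψ : Integrable ψ) :
    Integrable (fun t => ψ t * ∑' n, c n * osc (τ n) t) :=
  hψ.mul_bdd (continuous_tsum_mul_osc τ hc).aestronglyMeasurable
    (Filter.Eventually.of_forall fun t => norm_tsum_mul_osc_le τ hc t)

open MeasureTheory in
theorem integrable_mul_osc {ψ : ℝ → ℂ} (hψ : Integrable ψ) (x : ℝ) :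
    Integrable (fun t => ψ t * osc x t) :=
  hψ.mul_bdd (c := 1) (continuous_osc x).aestronglyMeasurable
    (Filter.Eventually.of_forall fun t => (norm_osc x t).le)

open MeasureTheory in
theorem hasSum_integral_mul_osc (hc : Summable (fun n => ‖c n‖)) {ψ : ℝ → ℂ} (hψ : Integrable ψ) :
    HasSum (fun n => c n * ∫ t, ψ t * osc (τ n) t) (∫ t, ψ t * ∑' n, c n * osc (τ n) t) := by
  have key := MeasureTheory.hasSum_integral_of_summable_integral_norm (μ := volume)
    (F := fun n t => c n * (ψ t * osc (τ n) t))
    (fun n => (integrable_mul_osc hψ _).const_mul _) (by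
      simp only [norm_mul, norm_osc, mul_one, integral_const_mul]
      exact hc.mul_right _)
  simp only [integral_const_mul] at key
  have e : ∀ t, ψ t * ∑' n, c n * osc (τ n) t = ∑' n, c n * (ψ t * osc (τ n) t) := fun t => by
    rw [← tsum_mul_left]
    exact tsum_congr fun n => by ring
  simpa only [e] using key

end OscSeries

open Real in
theorem integral_gaussian_mul_osc {b : ℝ} (hb : 0 < b) (x : ℝ) :
    ∫ t : ℝ, ((exp (-b * t ^ 2) : ℝ) : ℂ) * osc x t =
      ((√(π / b) * exp (-x ^ 2 / (4 * b)) : ℝ) : ℂ) := by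
  have := fourierIntegral_gaussian (b := (b : ℂ)) (by simpa using hb) (x : ℂ)
  have h2 : ((√(π / b) : ℝ) : ℂ) = ((π : ℂ) / b) ^ (1 / 2 : ℂ) := by
    rw [Real.sqrt_eq_rpow, Complex.ofReal_cpow (by positivity)]
    push_cast
    rfl
  push_cast
  rw [h2, ← this]
  congr 1
  ext t
  unfold osc
  push_cast
  ring_nf

open Real MeasureTheory in
theorem integrable_ofReal_gaussian {b : ℝ} (hb : 0 < b) :
    Integrable (fun t : ℝ => ((exp (-b * t ^ 2) : ℝ) : ℂ)) :=
  (integrable_exp_neg_mul_sq hb).ofReal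

open Real MeasureTheory in
theorem integrable_gaussian_mul_normSq {b : ℝ} (hb : 0 < b) {c : ℕ → ℂ} (τ : ℕ → ℝ)
    (hc : Summable (fun n => ‖c n‖)) :
    Integrable (fun t : ℝ => exp (-b * t ^ 2) * ‖∑' n, c n * osc (τ n) t‖ ^ 2) := by
  refine (integrable_exp_neg_mul_sq hb).mul_bdd (c := (∑' n, ‖c n‖) ^ 2)
    ((continuous_tsum_mul_osc τ hc).norm.pow 2).aestronglyMeasurable
    (Filter.Eventually.of_forall fun t => ?_)
  rw [norm_pow, norm_norm]
  gcongr
  exact norm_tsum_mul_osc_le τ hc t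

open Real MeasureTheory in
theorem exists_meanSquare_le :
    ∃ C : ℝ, 1 ≤ C ∧ ∀ (N σ κ : ℝ) (c : ℕ → ℝ), 1 ≤ N → 0 < σ → σ ≤ 1 → 0 ≤ κ →
      (∀ n : ℕ, |c n| ≤ κ * (oneAddVonMangoldt n / n * exp (-(σ * log n)))) →
      ∫ t : ℝ, exp (-(1 / (8 * N ^ 2)) * t ^ 2) * ‖∑' n : ℕ, (c n : ℂ) * osc (-log n) t‖ ^ 2
        ≤ C * N * κ ^ 2 / σ := by
  obtain ⟨K, hK1, hK⟩ := exists_exp_kernel_tsum_le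
  obtain ⟨K2, hK21, hK2⟩ := exists_power_sum_le
  refine ⟨√(8 * π) * 2 * K * K2, ?_, fun N σ κ c hN hσ hσ1 hκ hc => ?_⟩
  · have : 1 ≤ √(8 * π) := by
      rw [Real.one_le_sqrt]
      nlinarith [pi_gt_three]
    nlinarith [mul_nonneg (by linarith : 0 ≤ K - 1) (by linarith : 0 ≤ K2 - 1)]
  have hN0 : 0 < N := by linarith
  have hcs : Summable (fun n => ‖(c n : ℂ)‖) := by
    simp only [Complex.norm_real]
    exact Summable.of_nonneg_of_le (fun n => norm_nonneg _) hc ((hK2 σ hσ hσ1).1.mul_left κ)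
  have hb : 0 < 1 / (8 * N ^ 2) := by positivity
  set τ : ℕ → ℝ := fun n => -log n
  set D : ℝ → ℂ := fun t => ∑' n : ℕ, (c n : ℂ) * osc (τ n) t with hD
  set g : ℝ → ℂ := fun t => ((exp (-(1 / (8 * N ^ 2)) * t ^ 2) : ℝ) : ℂ) with hg
  have hgi : Integrable g := integrable_ofReal_gaussian hb
  have hψ : Integrable (fun t => g t * (starRingEnd ℂ) (D t)) := by
    refine hgi.mul_bdd (c := ∑' n, ‖(c n : ℂ)‖) (Complex.continuous_conj.comp (continuous_tsum_mul_osc τ hcs)).aestronglyMeasurable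
      (Filter.Eventually.of_forall fun t => ?_)
    rw [RCLike.norm_conj]
    exact norm_tsum_mul_osc_le τ hcs t
  have hsum := hasSum_integral_mul_osc τ hcs hψ
  have hsq : √(π / (1 / (8 * N ^ 2))) = √(8 * π) * N := by
    rw [show π / (1 / (8 * N ^ 2)) = 8 * π * N ^ 2 by field_simp]
    rw [Real.sqrt_mul (by positivity), Real.sqrt_sq hN0.le]
  have hinner : ∀ n, ‖∫ t, g t * (starRingEnd ℂ) (D t) * osc (τ n) t‖ ≤ √(8 * π) * N * 2 * κ * K := by
    intro n
    have e1 : ∫ t, g t * (starRingEnd ℂ) (D t) * osc (τ n) t =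
        (starRingEnd ℂ) (∫ t, (g t * osc (-τ n) t) * D t) := by
      rw [← integral_conj]
      congr 1
      ext t
      rw [map_mul, map_mul, conj_osc, neg_neg, hg]
      simp only [Complex.conj_ofReal]
      ring
    rw [e1, RCLike.norm_conj]
    have hs2 := hasSum_integral_mul_osc τ hcs (integrable_mul_osc hgi (-τ n))
    rw [← hs2.tsum_eq]
    refine tsum_of_norm_bounded (((hK (log n)).1.mul_left (√(8 * π) * N * 2 * κ)).hasSum) (fun m => ?_) |>.trans ?_
    · have e2 : ∫ t, g t * osc (-τ n) t * osc (τ m) t = ∫ t, g t * osc (log n - log m) t := by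
        congr 1
        ext t
        rw [mul_assoc, ← osc_add]
        simp [τ, sub_eq_add_neg]
      rw [e2, integral_gaussian_mul_osc hb, norm_mul, Complex.norm_real, Complex.norm_real, hsq,
        norm_mul, norm_eq_abs, norm_of_nonneg (by positivity : 0 ≤ √(8 * π) * N),
        norm_of_nonneg (exp_pos _).le]
      have hw : 0 ≤ oneAddVonMangoldt m / m := div_nonneg (oneAddVonMangoldt_nonneg m) (by positivity)
      have h1 : |c m| ≤ κ * (oneAddVonMangoldt m / m) := by
        refine (hc m).trans ?_
        gcongr
        refine mul_le_of_le_one_right hw (exp_le_one_iff.2 ?_)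
        have := log_natCast_nonneg m
        nlinarith
      have h2 : exp (-(log n - log m) ^ 2 / (4 * (1 / (8 * N ^ 2)))) ≤ 2 * exp (-|log n - log m|) := by
        set v := log n - log m
        have : (2 : ℝ) * exp (-|v|) = exp (log 2 + -|v|) := by rw [exp_add, exp_log two_pos]
        rw [this]
        apply exp_le_exp.2
        have h3 : -v ^ 2 / (4 * (1 / (8 * N ^ 2))) = -(2 * N ^ 2 * v ^ 2) := by field_simp; ring
        rw [h3, ← sq_abs v]
        have := log_two_gt_d9
        have hN2 : 1 ≤ N ^ 2 := one_le_pow₀ hN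
        nlinarith [sq_nonneg (|v| - 1 / 4), mul_nonneg (sub_nonneg.2 hN2) (sq_nonneg |v|)]
      calc |c m| * (√(8 * π) * N * exp (-(log n - log m) ^ 2 / (4 * (1 / (8 * N ^ 2)))))
          ≤ κ * (oneAddVonMangoldt m / m) * (√(8 * π) * N * (2 * exp (-|log n - log m|))) := by gcongr
        _ = _ := by ring
    · rw [tsum_mul_left]
      gcongr
      exact (hK _).2
  have hfin : ‖∫ t, g t * (starRingEnd ℂ) (D t) * D t‖ ≤ √(8 * π) * N * 2 * κ * K * (κ * (K2 / σ)) := by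
    rw [← hsum.tsum_eq]
    refine tsum_of_norm_bounded (((hK2 σ hσ hσ1).1.mul_left (√(8 * π) * N * 2 * κ * K * κ)).hasSum) (fun m => ?_) |>.trans ?_
    · rw [norm_mul, Complex.norm_real, norm_eq_abs]
      calc _ ≤ κ * (oneAddVonMangoldt m / m * exp (-(σ * log m))) * (√(8 * π) * N * 2 * κ * K) := by
            gcongr
            · exact (abs_nonneg _).trans (hc m)
            · exact hc m
            · exact hinner m
        _ = _ := by ring
    · rw [tsum_mul_left]
      have := (hK2 σ hσ hσ1).2
      calc _ ≤ √(8 * π) * N * 2 * κ * K * κ * (K2 / σ) := by gcongr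
        _ = _ := by ring
  have e3 : ∫ t, g t * (starRingEnd ℂ) (D t) * D t =
      ((∫ t : ℝ, exp (-(1 / (8 * N ^ 2)) * t ^ 2) * ‖D t‖ ^ 2 : ℝ) : ℂ) := by
    rw [← integral_complex_ofReal]
    congr 1
    ext t
    rw [mul_assoc, mul_comm ((starRingEnd ℂ) (D t)), Complex.mul_conj, Complex.normSq_eq_norm_sq]
    simp [hg]
  rw [e3, Complex.norm_real] at hfin
  refine (le_norm_self _).trans (hfin.trans (le_of_eq ?_))
  ring

/-- The coefficients `f(n) / n ^ (1 + σ)`. -/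
noncomputable def shiftedCoeff (f : ℕ → ℝ) (σ : ℝ) (n : ℕ) : ℝ :=
  f n / n * Real.exp (-(σ * Real.log n))

/-- The values `f(n) / n ^ (1 + σ + it)` of a completely multiplicative function, bundled. -/
noncomputable def eulerTerm (f : ℕ →*₀ ℝ) (σ t : ℝ) : ℕ →*₀ ℂ where
  toFun n := (shiftedCoeff f σ n : ℂ) * osc (-Real.log n) t
  map_zero' := by simp [shiftedCoeff]
  map_one' := by simp [shiftedCoeff, osc]
  map_mul' m n := by
    rcases eq_or_ne m 0 with rfl | hm
    · simp [shiftedCoeff]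
    rcases eq_or_ne n 0 with rfl | hn
    · simp [shiftedCoeff]
    have hm' : (m : ℝ) ≠ 0 := by exact_mod_cast hm
    have hn' : (n : ℝ) ≠ 0 := by exact_mod_cast hn
    have h1 : shiftedCoeff f σ (m * n) = shiftedCoeff f σ m * shiftedCoeff f σ n := by
      unfold shiftedCoeff
      push_cast
      rw [Real.log_mul hm' hn', map_mul, mul_add, neg_add, Real.exp_add]
      field_simp
    have h2 : osc (-Real.log (m * n : ℕ)) t = osc (-Real.log m) t * osc (-Real.log n) t := by
      push_cast
      rw [Real.log_mul hm' hn', neg_add, osc_add]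
    simp only [h1, h2]
    push_cast
    ring

theorem eulerTerm_apply (f : ℕ →*₀ ℝ) (σ t : ℝ) (n : ℕ) :
    eulerTerm f σ t n = (shiftedCoeff f σ n : ℂ) * osc (-Real.log n) t := rfl

/-- The completely multiplicative function equal to `1` away from `0`. -/
noncomputable def oneAwayFromZero : ℕ →*₀ ℝ where
  toFun n := if n = 0 then 0 else 1
  map_zero' := by simp
  map_one' := by simp
  map_mul' m n := by
    rcases eq_or_ne m 0 with rfl | hm <;> rcases eq_or_ne n 0 with rfl | hn <;> simp [*]

theorem oneAwayFromZero_apply {n : ℕ} (hn : n ≠ 0) : oneAwayFromZero n = 1 := if_neg hn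

theorem abs_oneAwayFromZero_le (n : ℕ) : |oneAwayFromZero n| ≤ 1 := by
  rcases eq_or_ne n 0 with rfl | hn
  · simp
  · simp [oneAwayFromZero_apply hn]

section

variable {f : ℕ → ℝ} (hf : ∀ n, |f n| ≤ 1) {σ : ℝ}
include hf

theorem abs_shiftedCoeff_le (n : ℕ) :
    |shiftedCoeff f σ n| ≤ oneAddVonMangoldt n / n * Real.exp (-(σ * Real.log n)) := by
  unfold shiftedCoeff oneAddVonMangoldt
  rw [abs_mul, abs_div, Nat.abs_cast, abs_of_pos (Real.exp_pos _)]
  gcongr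
  exact (hf n).trans (le_add_of_nonneg_right ArithmeticFunction.vonMangoldt_nonneg)

theorem summable_norm_shiftedCoeff (hσ : 0 < σ) (hσ1 : σ ≤ 1) :
    Summable (fun n => ‖(shiftedCoeff f σ n : ℂ)‖) := by
  obtain ⟨K, -, hK⟩ := exists_power_sum_le
  simp only [Complex.norm_real]
  exact Summable.of_nonneg_of_le (fun n => norm_nonneg _) (abs_shiftedCoeff_le hf) (hK σ hσ hσ1).1

end

theorem exists_norm_tsum_shiftedCoeff_le_div :
    ∃ K : ℝ, 1 ≤ K ∧ ∀ (f : ℕ → ℝ) (σ t : ℝ), (∀ n, |f n| ≤ 1) → 0 < σ → σ ≤ 1 →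
      ‖∑' n : ℕ, (shiftedCoeff f σ n : ℂ) * osc (-Real.log n) t‖ ≤ K / σ := by
  obtain ⟨K, hK1, hK⟩ := exists_power_sum_le
  refine ⟨K, hK1, fun f σ t hf hσ hσ1 => ?_⟩
  refine (tsum_of_norm_bounded (hK σ hσ hσ1).1.hasSum fun n => ?_).trans (hK σ hσ hσ1).2
  rw [norm_mul, norm_osc, mul_one, Complex.norm_real]
  exact abs_shiftedCoeff_le hf n

theorem re_osc (x t : ℝ) : (osc x t).re = Real.cos (t * x) := by
  unfold osc
  rw [Complex.exp_ofReal_mul_I_re]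

theorem norm_tsum_eulerTerm_eq {f : ℕ →*₀ ℝ} (hf : ∀ n, |f n| ≤ 1) {σ : ℝ} (hσ : 0 < σ)
    (hσ1 : σ ≤ 1) (t : ℝ) :
    Summable (fun p : Nat.Primes => (-Complex.log (1 - eulerTerm f σ t p)).re) ∧
    ‖∑' n : ℕ, eulerTerm f σ t n‖ =
      Real.exp (∑' p : Nat.Primes, (-Complex.log (1 - eulerTerm f σ t p)).re) := by
  have hs : Summable (fun n => ‖eulerTerm f σ t n‖) := by
    simpa [eulerTerm_apply, norm_osc] using summable_norm_shiftedCoeff hf hσ hσ1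
  have hs2 : Summable (fun p : Nat.Primes => -Complex.log (1 - eulerTerm f σ t p)) :=
    hs.of_norm.clog_one_sub.neg.subtype Nat.Prime
  refine ⟨(Complex.hasSum_re hs2.hasSum).summable, ?_⟩
  rw [← EulerProduct.exp_tsum_primes_log_eq_tsum hs, Complex.norm_exp, Complex.re_tsum hs2]

theorem abs_re_neg_log_sub_re_le {z : ℂ} (hz : ‖z‖ ≤ 1 / 2) :
    |(-Complex.log (1 - z)).re - z.re| ≤ ‖z‖ ^ 2 := by
  have h1 := Complex.norm_log_one_sub_inv_sub_self_le (z := z) (by linarith)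
  have h2 : Complex.log (1 - z)⁻¹ = -Complex.log (1 - z) := by
    apply Complex.log_inv
    have : (1 - z) ∈ Complex.slitPlane := by
      left
      have := Complex.re_le_norm z
      simp
      linarith
    exact Complex.slitPlane_arg_ne_pi this
  rw [h2] at h1
  rw [← Complex.sub_re]
  refine (Complex.abs_re_le_norm _).trans (h1.trans ?_)
  have h3 : (1 - ‖z‖)⁻¹ ≤ 2 := by
    rw [inv_le_comm₀ (by linarith) two_pos]
    linarith
  have := sq_nonneg ‖z‖
  nlinarith

open Real in
theorem norm_tsum_eulerTerm_le {f : ℕ →*₀ ℝ} (hf : ∀ n, |f n| ≤ 1) {σ : ℝ} (hσ : 0 < σ)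
    (hσ1 : σ ≤ 1) (t : ℝ) :
    ‖∑' n : ℕ, eulerTerm f σ t n‖ ≤ exp (2 * ∑' p : Nat.Primes, 1 / (p : ℝ) ^ 2) *
      (‖∑' n : ℕ, eulerTerm oneAwayFromZero σ 0 n‖ ^ (3 / 4 : ℝ) *
       ‖∑' n : ℕ, eulerTerm oneAwayFromZero σ (2 * t) n‖ ^ (1 / 4 : ℝ)) := by
  obtain ⟨s1, e1⟩ := norm_tsum_eulerTerm_eq hf hσ hσ1 t
  obtain ⟨s2, e2⟩ := norm_tsum_eulerTerm_eq abs_oneAwayFromZero_le hσ hσ1 0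
  obtain ⟨s3, e3⟩ := norm_tsum_eulerTerm_eq abs_oneAwayFromZero_le hσ hσ1 (2 * t)
  have s4 : Summable (fun p : Nat.Primes => 1 / (p : ℝ) ^ 2) :=
    (Real.summable_one_div_nat_pow.2 (by norm_num : 1 < 2)).subtype Nat.Prime
  rw [e1, e2, e3, ← exp_mul, ← exp_mul, ← exp_add, ← exp_add, ← tsum_mul_left, ← tsum_mul_right,
    ← tsum_mul_right, ← (s2.mul_right _).tsum_add (s3.mul_right _),
    ← (s4.mul_left _).tsum_add ((s2.mul_right _).add (s3.mul_right _))]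
  apply exp_le_exp.2
  refine s1.tsum_le_tsum (fun p => ?_) ((s4.mul_left _).add ((s2.mul_right _).add (s3.mul_right _)))
  have hp2 : (2 : ℝ) ≤ p := by exact_mod_cast p.2.two_le
  set r : ℝ := 1 / (p : ℝ) * exp (-(σ * log p)) with hr
  have hr0 : 0 ≤ r := by positivity
  have hrp : r ≤ 1 / (p : ℝ) := by
    refine mul_le_of_le_one_right (by positivity) (exp_le_one_iff.2 ?_)
    have := log_natCast_nonneg p
    nlinarith
  have hrh : r ≤ 1 / 2 := hrp.trans (by gcongr)
  have hr2 : r ^ 2 ≤ 1 / (p : ℝ) ^ 2 := by rw [← one_div_pow]; gcongr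
  have ez : ∀ (g : ℕ →*₀ ℝ) (u : ℝ), eulerTerm g σ u p = ((g p * r : ℝ) : ℂ) * osc (-log p) u := by
    intro g u
    rw [eulerTerm_apply, shiftedCoeff, hr]
    congr 2
    ring
  have hb : ∀ (g : ℕ →*₀ ℝ) (u : ℝ), (∀ n, |g n| ≤ 1) →
      |(-Complex.log (1 - eulerTerm g σ u p)).re - g p * r * cos (u * log p)| ≤ 1 / (p : ℝ) ^ 2 := by
    intro g u hg
    have hn : ‖eulerTerm g σ u p‖ ≤ r := by
      rw [ez, norm_mul, norm_osc, mul_one, Complex.norm_real, norm_mul, norm_of_nonneg hr0]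
      exact mul_le_of_le_one_left hr0 (hg _)
    have hre : (eulerTerm g σ u p).re = g p * r * cos (u * log p) := by
      rw [ez, Complex.re_ofReal_mul, re_osc]
      rw [mul_neg, cos_neg]
    rw [← hre]
    refine (abs_re_neg_log_sub_re_le (hn.trans hrh)).trans (le_trans ?_ hr2)
    gcongr
  have b1 := (abs_le.1 (hb f t hf)).2
  have b2 := (abs_le.1 (hb _ 0 abs_oneAwayFromZero_le)).1
  have b3 := (abs_le.1 (hb _ (2 * t) abs_oneAwayFromZero_le)).1
  rw [oneAwayFromZero_apply p.2.ne_zero] at b2 b3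
  rw [zero_mul, cos_zero] at b2
  rw [show 2 * t * log (p : ℕ) = 2 * (t * log (p : ℕ)) by ring, cos_two_mul] at b3
  have b4 : f p * r * cos (t * log p) ≤ r * (1 / 2 + cos (t * log p) ^ 2 / 2) := by
    set y := cos (t * log p)
    have h1 : f p * y ≤ |y| := by
      refine (le_abs_self _).trans ?_
      rw [abs_mul]
      exact mul_le_of_le_one_left (abs_nonneg _) (hf _)
    have h2 : |y| ≤ 1 / 2 + y ^ 2 / 2 := by
      rw [← sq_abs y]
      nlinarith [sq_nonneg (|y| - 1)]
    calc f p * r * y = r * (f p * y) := by ring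
      _ ≤ _ := mul_le_mul_of_nonneg_left (h1.trans h2) hr0
  linarith

theorem cpow_neg_eq {n : ℕ} (hn : n ≠ 0) (σ t : ℝ) :
    (n : ℂ) ^ (-(1 + σ + t * Complex.I) : ℂ) =
      ((1 / n * Real.exp (-(σ * Real.log n)) : ℝ) : ℂ) * osc (-Real.log n) t := by
  have hn' : (n : ℂ) ≠ 0 := by exact_mod_cast hn
  have hn0 : (0 : ℝ) < n := by exact_mod_cast Nat.pos_of_ne_zero hn
  rw [Complex.cpow_def_of_ne_zero hn', ← Complex.natCast_log, osc]
  rw [show (1 / n * Real.exp (-(σ * Real.log n)) : ℝ) = Real.exp (-Real.log n + -(σ * Real.log n)) by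
    rw [Real.exp_add, Real.exp_neg (Real.log n), Real.exp_log hn0, one_div]]
  push_cast
  rw [← Complex.exp_add]
  ring_nf

open Real Finset in
theorem norm_tsum_oneAwayFromZero_le {σ t : ℝ} (hσ : 0 < σ) (hσ1 : σ ≤ 1) (ht : t ≠ 0) :
    ‖∑' n : ℕ, eulerTerm oneAwayFromZero σ t n‖ ≤ 2 / |t| + 4 * (2 + |t|) := by
  set s : ℂ := 1 + σ + t * Complex.I with hs
  have hsre : s.re = 1 + σ := by simp [hs]
  have hsim : s.im = t := by simp [hs]
  have hs0 : s ≠ 0 := fun h => ht (by rw [← hsim, h]; rfl)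
  have hs1 : -s ≠ -1 := fun h => ht (by
    have : s = 1 := neg_injective h
    rw [← hsim, this]; rfl)
  have hsn : ‖s‖ ≤ 2 + |t| := by
    calc ‖s‖ ≤ |s.re| + |s.im| := Complex.norm_le_abs_re_add_abs_im s
      _ ≤ 2 + |t| := by
        rw [hsre, hsim, abs_of_pos (by linarith)]
        linarith
  set H : ℝ → ℂ := fun y => (y : ℂ) ^ (-s + 1) / (-s + 1) with hH
  have hHn : ∀ y : ℝ, 1 ≤ y → ‖H y‖ ≤ 1 / |t| := by
    intro y hy
    simp only [hH]
    rw [norm_div, Complex.norm_cpow_eq_rpow_re_of_pos (by linarith)]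
    have h1 : |t| ≤ ‖-s + 1‖ := by
      have := Complex.abs_im_le_norm (-s + 1)
      simpa [hsim] using this
    have h2 : y ^ (-s + 1).re ≤ 1 := by
      apply rpow_le_one_of_one_le_of_nonpos hy
      simp [hsre, hσ.le]
    have := abs_pos.2 ht
    gcongr
  have hdiff : ∀ n : ℕ, 1 ≤ n → ‖(n : ℂ) ^ (-s) - (H (n + 1) - H n)‖ ≤ ‖s‖ * (1 / (n : ℝ) ^ 2) := by
    intro n hn
    have hn0 : (1 : ℝ) ≤ n := by exact_mod_cast hn
    have hpow : ∀ x ∈ Set.Icc (n : ℝ) (n + 1), ‖(x : ℂ) ^ (-s) - (n : ℂ) ^ (-s)‖ ≤ ‖s‖ * (1 / (n : ℝ) ^ 2) := by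
      intro x hx
      have := norm_image_sub_le_of_norm_deriv_le_segment' (f := fun y : ℝ => (y : ℂ) ^ (-s)) (a := n) (b := n + 1)
        (f' := fun y : ℝ => -s * (y : ℂ) ^ (-s - 1)) (C := ‖s‖ * (1 / (n : ℝ) ^ 2))
        (fun y hy => (hasDerivAt_ofReal_cpow_const (by have := hy.1; linarith) (neg_ne_zero.2 hs0)).hasDerivWithinAt)
        (fun y hy => by
          have hy0 : (0 : ℝ) < y := by have := hy.1; linarith
          rw [norm_mul, norm_neg, Complex.norm_cpow_eq_rpow_re_of_pos hy0]
          gcongr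
          simp only [Complex.sub_re, Complex.neg_re, hsre, Complex.one_re]
          calc y ^ (-(1 + σ) - 1) ≤ y ^ (-2 : ℝ) := by
                apply rpow_le_rpow_of_exponent_le <;> linarith [hy.1]
            _ = 1 / y ^ 2 := by
                rw [rpow_neg hy0.le, one_div]; norm_cast
            _ ≤ 1 / (n : ℝ) ^ 2 := by have := hy.1; gcongr) x hx
      simp only [Complex.ofReal_natCast] at this
      refine this.trans ?_
      have h3 : x - n ≤ 1 := by linarith [hx.2]
      have : 0 ≤ ‖s‖ * (1 / (n : ℝ) ^ 2) := by positivity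
      nlinarith
    have := norm_image_sub_le_of_norm_deriv_le_segment' (f := fun y : ℝ => H y - y * (n : ℂ) ^ (-s)) (a := n) (b := n + 1)
        (f' := fun y : ℝ => (y : ℂ) ^ (-s) - 1 * (n : ℂ) ^ (-s)) (C := ‖s‖ * (1 / (n : ℝ) ^ 2))
        (fun y hy => ((hasDerivAt_ofReal_cpow_const' (by have := hy.1; linarith) hs1).sub
          ((Complex.ofRealCLM.hasDerivAt (x := y)).mul_const _)).hasDerivWithinAt)
        (fun y hy => by rw [one_mul]; exact hpow y ⟨hy.1, hy.2.le⟩) (n + 1) ⟨by linarith, le_rfl⟩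
    rw [← norm_neg]
    convert this using 1
    · congr 1
      push_cast
      ring
    · ring
  have hsumm : Summable (fun n => eulerTerm oneAwayFromZero σ t n) := by
    refine Summable.of_norm ?_
    simpa [eulerTerm_apply, norm_osc] using summable_norm_shiftedCoeff abs_oneAwayFromZero_le hσ hσ1
  have hterm : ∀ n : ℕ, 1 ≤ n → eulerTerm oneAwayFromZero σ t n = (n : ℂ) ^ (-s) := by
    intro n hn
    rw [hs, cpow_neg_eq (by omega), eulerTerm_apply, shiftedCoeff, oneAwayFromZero_apply (by omega)]
  have hpart : ∀ N : ℕ, ‖∑ n ∈ range (N + 1), eulerTerm oneAwayFromZero σ t n‖ ≤ 2 / |t| + 4 * (2 + |t|) := by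
    intro N
    rw [Finset.sum_range_succ', map_zero, add_zero]
    have e : ∑ n ∈ range N, eulerTerm oneAwayFromZero σ t (n + 1) =
        ∑ n ∈ range N, (((n + 1 : ℕ) : ℂ) ^ (-s) - (H ((n + 1 : ℕ) + 1) - H (n + 1 : ℕ))) + (H (N + 1 : ℕ) - H (0 + 1 : ℕ)) := by
      have := Finset.sum_range_sub (fun n : ℕ => H ((n + 1 : ℕ) : ℝ)) N
      rw [← this, ← Finset.sum_add_distrib]
      refine Finset.sum_congr rfl fun n _ => ?_
      rw [hterm _ (by omega)]
      push_cast
      ring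
    have h4 : ∑ n ∈ range N, 1 / ((n + 1 : ℕ) : ℝ) ^ 2 ≤ 4 := by
      have := sum_Ioo_inv_sq_le (α := ℝ) 0 (N + 1)
      norm_num at this
      have e2 : ∑ n ∈ range N, 1 / ((n + 1 : ℕ) : ℝ) ^ 2 = ∑ i ∈ Ioo 0 (N + 1), ((i : ℝ) ^ 2)⁻¹ := by
        refine Finset.sum_nbij (· + 1) (fun n hn => by simp at hn ⊢; omega) (by simp)
          (fun n hn => ?_) (fun n _ => by simp)
        simp at hn
        exact ⟨n - 1, by simp; omega, by simp; omega⟩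
      rw [e2]; linarith
    rw [e]
    calc _ ≤ (∑ n ∈ range N, ‖s‖ * (1 / ((n + 1 : ℕ) : ℝ) ^ 2)) + (1 / |t| + 1 / |t|) := by
          refine (norm_add_le _ _).trans (add_le_add (norm_sum_le_of_le _ fun n _ => hdiff _ (by omega)) ?_)
          refine (norm_sub_le _ _).trans (add_le_add (hHn _ ?_) (hHn _ ?_))
          · push_cast; linarith [(Nat.cast_nonneg N : (0 : ℝ) ≤ N)]
          · simp
      _ ≤ (2 + |t|) * 4 + (1 / |t| + 1 / |t|) := by
          rw [← mul_sum]
          gcongr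
      _ = _ := by ring
  have hlim := (hsumm.hasSum.tendsto_sum_nat.comp (Filter.tendsto_add_atTop_nat 1)).norm
  exact le_of_tendsto hlim (Filter.Eventually.of_forall hpart)

open Real in
theorem exists_norm_tsum_shiftedCoeff_le :
    ∃ C : ℝ, 1 ≤ C ∧ ∀ (f : ℕ →*₀ ℝ) (σ t : ℝ), (∀ n, |f n| ≤ 1) → 0 < σ → σ ≤ 1 → t ≠ 0 →
      ‖∑' n : ℕ, (shiftedCoeff f σ n : ℂ) * osc (-Real.log n) t‖ ≤
        C * (1 / σ) ^ (3 / 4 : ℝ) * (1 / |t| + 1 + |t|) ^ (1 / 4 : ℝ) := by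
  obtain ⟨K, hK1, hK⟩ := exists_norm_tsum_shiftedCoeff_le_div
  set E := exp (2 * ∑' p : Nat.Primes, 1 / (p : ℝ) ^ 2)
  have hE : 1 ≤ E := one_le_exp (mul_nonneg zero_le_two (tsum_nonneg fun p => by positivity))
  refine ⟨E * K * 8, by
    nlinarith [mul_nonneg (sub_nonneg.2 hE) (sub_nonneg.2 hK1)], fun f σ t hf hσ hσ1 ht => ?_⟩
  have ht0 := abs_pos.2 ht
  refine (norm_tsum_eulerTerm_le hf hσ hσ1 t).trans ?_
  have h1 : ‖∑' n : ℕ, eulerTerm oneAwayFromZero σ 0 n‖ ^ (3 / 4 : ℝ) ≤ K * (1 / σ) ^ (3 / 4 : ℝ) := by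
    calc _ ≤ (K / σ) ^ (3 / 4 : ℝ) := by
          gcongr
          exact hK _ σ 0 abs_oneAwayFromZero_le hσ hσ1
      _ = K ^ (3 / 4 : ℝ) * (1 / σ) ^ (3 / 4 : ℝ) := by
          rw [div_eq_mul_one_div, mul_rpow (by linarith) (by positivity)]
      _ ≤ K ^ (1 : ℝ) * (1 / σ) ^ (3 / 4 : ℝ) := by
          gcongr ?_ * _
          exact rpow_le_rpow_of_exponent_le hK1 (by norm_num)
      _ = _ := by rw [rpow_one]
  have h2 : ‖∑' n : ℕ, eulerTerm oneAwayFromZero σ (2 * t) n‖ ^ (1 / 4 : ℝ) ≤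
      8 * (1 / |t| + 1 + |t|) ^ (1 / 4 : ℝ) := by
    calc _ ≤ (8 * (1 / |t| + 1 + |t|)) ^ (1 / 4 : ℝ) := by
          gcongr
          refine (norm_tsum_oneAwayFromZero_le hσ hσ1 (by simpa using ht)).trans ?_
          rw [abs_mul, abs_two, div_mul_eq_div_div, div_self two_ne_zero]
          have : 0 < 1 / |t| := by positivity
          linarith
      _ = 8 ^ (1 / 4 : ℝ) * (1 / |t| + 1 + |t|) ^ (1 / 4 : ℝ) := by
          rw [mul_rpow (by norm_num) (by positivity)]
      _ ≤ 8 ^ (1 : ℝ) * (1 / |t| + 1 + |t|) ^ (1 / 4 : ℝ) := by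
          gcongr <;> norm_num
      _ = _ := by rw [rpow_one]
  calc _ ≤ E * (K * (1 / σ) ^ (3 / 4 : ℝ) * (8 * (1 / |t| + 1 + |t|) ^ (1 / 4 : ℝ))) := by gcongr
    _ = _ := by ring

/-- The Dirichlet series `∑ c(n) n ^ (-it)`. -/
noncomputable def oscSeries (c : ℕ → ℝ) (t : ℝ) : ℂ :=
  ∑' n : ℕ, (c n : ℂ) * osc (-Real.log n) t

section Product

open Complex

theorem term_eq_shiftedCoeff (g : ℕ → ℝ) (σ t : ℝ) (n : ℕ) :
    LSeries.term (fun n => (g n : ℂ)) (1 + σ + t * I) n =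
      (shiftedCoeff g σ n : ℂ) * osc (-Real.log n) t := by
  rcases eq_or_ne n 0 with rfl | hn
  · simp [shiftedCoeff]
  · rw [LSeries.term_of_ne_zero hn, div_eq_mul_inv, ← cpow_neg, cpow_neg_eq hn, shiftedCoeff]
    push_cast
    ring

theorem lseriesSummable_ofReal_iff (g : ℕ → ℝ) (σ t : ℝ) :
    LSeriesSummable (fun n => (g n : ℂ)) (1 + σ + t * I) ↔
      Summable (fun n => ‖(shiftedCoeff g σ n : ℂ)‖) := by
  unfold LSeriesSummable
  rw [← summable_norm_iff]
  simp only [term_eq_shiftedCoeff, norm_mul, norm_osc, mul_one]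

theorem lseries_eq_oscSeries (g : ℕ → ℝ) (σ t : ℝ) :
    LSeries (fun n => (g n : ℂ)) (1 + σ + t * I) = oscSeries (shiftedCoeff g σ) t :=
  tsum_congr fun n => term_eq_shiftedCoeff g σ t n

theorem convolution_mul_vonMangoldt (f : ℕ →*₀ ℝ) :
    LSeries.convolution (fun n => ((f n * ArithmeticFunction.vonMangoldt n : ℝ) : ℂ))
      (fun n => (f n : ℂ)) =
      fun n : ℕ => ((f n * Real.log n : ℝ) : ℂ) := by
  rw [LSeries.convolution_def]
  ext n
  rw [← ArithmeticFunction.vonMangoldt_sum,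
    ← Nat.sum_divisorsAntidiagonal (f := fun d _ => ArithmeticFunction.vonMangoldt d), Finset.mul_sum]
  push_cast
  refine Finset.sum_congr rfl fun p hp => ?_
  rw [← (Nat.mem_divisorsAntidiagonal.1 hp).1, map_mul]
  push_cast
  ring

variable {f : ℕ →*₀ ℝ} (hf : ∀ n, |f n| ≤ 1) {σ : ℝ} (hσ : 0 < σ) (hσ1 : σ ≤ 1)
include hf

theorem abs_shiftedCoeff_vonMangoldt_le (n : ℕ) :
    |shiftedCoeff (fun n => f n * ArithmeticFunction.vonMangoldt n) σ n| ≤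
      oneAddVonMangoldt n / n * Real.exp (-(σ * Real.log n)) := by
  unfold shiftedCoeff oneAddVonMangoldt
  rw [abs_mul, abs_div, Nat.abs_cast, abs_of_pos (Real.exp_pos _), abs_mul,
    abs_of_nonneg ArithmeticFunction.vonMangoldt_nonneg]
  gcongr
  have h0 := ArithmeticFunction.vonMangoldt_nonneg (n := n)
  have := mul_le_of_le_one_left h0 (hf n)
  linarith

include hσ hσ1

theorem summable_norm_shiftedCoeff_vonMangoldt :
    Summable (fun n => ‖(shiftedCoeff (fun n => f n * ArithmeticFunction.vonMangoldt n) σ n : ℂ)‖) := by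
  obtain ⟨K, -, hK⟩ := exists_power_sum_le
  simp only [Complex.norm_real]
  exact Summable.of_nonneg_of_le (fun n => norm_nonneg _) (abs_shiftedCoeff_vonMangoldt_le hf)
    (hK σ hσ hσ1).1

theorem summable_norm_shiftedCoeff_log :
    Summable (fun n => ‖(shiftedCoeff (fun n => f n * Real.log n) σ n : ℂ)‖) := by
  rw [← lseriesSummable_ofReal_iff _ σ 0, ← convolution_mul_vonMangoldt]
  exact ((lseriesSummable_ofReal_iff _ σ 0).2 (summable_norm_shiftedCoeff_vonMangoldt hf hσ hσ1)).convolution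
    ((lseriesSummable_ofReal_iff _ σ 0).2 (summable_norm_shiftedCoeff hf hσ hσ1))

theorem oscSeries_log_eq_mul (t : ℝ) :
    oscSeries (shiftedCoeff (fun n => f n * Real.log n) σ) t =
      oscSeries (shiftedCoeff (fun n => f n * ArithmeticFunction.vonMangoldt n) σ) t *
        oscSeries (shiftedCoeff f σ) t := by
  rw [← lseries_eq_oscSeries, ← lseries_eq_oscSeries, ← lseries_eq_oscSeries,
    ← LSeries_convolution' ((lseriesSummable_ofReal_iff _ σ t).2 (summable_norm_shiftedCoeff_vonMangoldt hf hσ hσ1))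
      ((lseriesSummable_ofReal_iff _ σ t).2 (summable_norm_shiftedCoeff hf hσ hσ1)),
    convolution_mul_vonMangoldt]

end Product

section Smoothing

open Real MeasureTheory

/-- The difference of a Gaussian and its translate by `h`. -/
noncomputable def gaussDiff (N h v : ℝ) : ℝ :=
  exp (-(N ^ 2 * v ^ 2)) - exp (-(N ^ 2 * (v - h) ^ 2))

/-- The increment over `[w - h, w]` of the Gaussian-smoothed summatory function of `c`. -/
noncomputable def smoothDiff (c : ℕ → ℝ) (N h w : ℝ) : ℝ :=
  ∑' n : ℕ, c n * gaussDiff N h (w - log n)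

/-- The Fourier transform of `gaussDiff`, up to a constant. -/
noncomputable def gaussDiffFourier (N h t : ℝ) : ℂ :=
  ((exp (-(1 / (4 * N ^ 2)) * t ^ 2) : ℝ) : ℂ) * (1 - osc (-h) t)

variable {N : ℝ} (hN : 0 < N) (h : ℝ)
include hN

theorem integrable_gaussDiffFourier : Integrable (gaussDiffFourier N h) := by
  have hb : 0 < 1 / (4 * N ^ 2) := by positivity
  have h1 := integrable_ofReal_gaussian hb
  have e : gaussDiffFourier N h = fun t => ((exp (-(1 / (4 * N ^ 2)) * t ^ 2) : ℝ) : ℂ) -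
      ((exp (-(1 / (4 * N ^ 2)) * t ^ 2) : ℝ) : ℂ) * osc (-h) t := by
    ext t
    rw [gaussDiffFourier, mul_sub, mul_one]
  rw [e]
  exact h1.sub (integrable_mul_osc h1 _)

theorem integral_gaussDiffFourier_mul_osc (v : ℝ) :
    ∫ t, gaussDiffFourier N h t * osc v t = ((2 * N * √π * gaussDiff N h v : ℝ) : ℂ) := by
  have hb : 0 < 1 / (4 * N ^ 2) := by positivity
  have h1 := integrable_ofReal_gaussian hb
  have e : ∀ t, gaussDiffFourier N h t * osc v t =
      ((exp (-(1 / (4 * N ^ 2)) * t ^ 2) : ℝ) : ℂ) * osc v t -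
      ((exp (-(1 / (4 * N ^ 2)) * t ^ 2) : ℝ) : ℂ) * osc (v - h) t := by
    intro t
    rw [sub_eq_add_neg v h, osc_add, gaussDiffFourier]
    ring
  simp only [e]
  rw [integral_sub (integrable_mul_osc h1 _) (integrable_mul_osc h1 _),
    integral_gaussian_mul_osc hb, integral_gaussian_mul_osc hb, ← Complex.ofReal_sub]
  congr 1
  have h2 : √(π / (1 / (4 * N ^ 2))) = 2 * N * √π := by
    rw [show π / (1 / (4 * N ^ 2)) = (2 * N) ^ 2 * π by field_simp; ring]
    rw [Real.sqrt_mul (by positivity), Real.sqrt_sq (by positivity)]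
  have h3 : ∀ v : ℝ, -v ^ 2 / (4 * (1 / (4 * N ^ 2))) = -(N ^ 2 * v ^ 2) := fun v => by field_simp
  rw [h2, h3, h3, gaussDiff]
  ring

omit hN in
theorem gaussDiff_bound : ∀ v, |gaussDiff N h v| ≤ 1 := by
  intro v
  unfold gaussDiff
  have h1 := exp_pos (-(N ^ 2 * v ^ 2))
  have h2 := exp_pos (-(N ^ 2 * (v - h) ^ 2))
  have h3 : exp (-(N ^ 2 * v ^ 2)) ≤ 1 := exp_le_one_iff.2 (by nlinarith [mul_nonneg (sq_nonneg N) (sq_nonneg v)])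
  have h4 : exp (-(N ^ 2 * (v - h) ^ 2)) ≤ 1 := exp_le_one_iff.2 (by nlinarith [mul_nonneg (sq_nonneg N) (sq_nonneg (v - h))])
  rw [abs_le]
  constructor <;> linarith

omit hN in
theorem summable_mul_gaussDiff {c : ℕ → ℝ} (hc : Summable (fun n => ‖(c n : ℂ)‖)) (w : ℝ) :
    Summable (fun n : ℕ => c n * gaussDiff N h (w - log n)) := by
  refine Summable.of_norm_bounded hc fun n => ?_
  rw [norm_mul, Complex.norm_real]
  exact mul_le_of_le_one_right (norm_nonneg _) (gaussDiff_bound h _)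

/-- Fourier representation of the smoothed increment. -/
theorem integral_gaussDiffFourier_mul_oscSeries {c : ℕ → ℝ} (hc : Summable (fun n => ‖(c n : ℂ)‖))
    (w : ℝ) :
    ∫ t, gaussDiffFourier N h t * osc w t * oscSeries c t =
      ((2 * N * √π * smoothDiff c N h w : ℝ) : ℂ) := by
  have key := hasSum_integral_mul_osc (fun n : ℕ => -log n) hc
    (integrable_mul_osc (integrable_gaussDiffFourier hN h) w)
  unfold oscSeries
  rw [← key.tsum_eq, smoothDiff, ← tsum_mul_left, Complex.ofReal_tsum]
  refine tsum_congr fun n => ?_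
  simp only [mul_assoc, ← osc_add]
  rw [integral_gaussDiffFourier_mul_osc hN, ← sub_eq_add_neg]
  push_cast
  ring

omit hN in
theorem integrable_osc_mul_oscSeries {ψ : ℝ → ℂ} (hψ : Integrable ψ) {c : ℕ → ℝ}
    (hc : Summable (fun n => ‖(c n : ℂ)‖)) (w : ℝ) :
    Integrable (fun t => ψ t * osc w t * oscSeries c t) :=
  integrable_mul_tsum_osc _ hc (integrable_mul_osc hψ w)

/-- Multiplying the Fourier side by a further Dirichlet series is a convolution. -/
theorem hasSum_mul_smoothDiff {c p : ℕ → ℝ} (hc : Summable (fun n => ‖(c n : ℂ)‖))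
    (hp : Summable (fun n => ‖(p n : ℂ)‖)) (w : ℝ) :
    HasSum (fun n : ℕ => ((p n * (2 * N * √π * smoothDiff c N h (w - log n)) : ℝ) : ℂ))
      (∫ t, gaussDiffFourier N h t * osc w t * oscSeries c t * oscSeries p t) := by
  have key := hasSum_integral_mul_osc (fun n : ℕ => -log n) hp
    (integrable_osc_mul_oscSeries (integrable_gaussDiffFourier hN h) hc w)
  have e : (fun n : ℕ => ((p n * (2 * N * √π * smoothDiff c N h (w - log n)) : ℝ) : ℂ)) =
      fun n : ℕ => (p n : ℂ) * ∫ t, gaussDiffFourier N h t * osc w t * oscSeries c t * osc (-log n) t := by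
    ext n
    rw [Complex.ofReal_mul, ← integral_gaussDiffFourier_mul_oscSeries hN h hc]
    congr 2
    ext t
    rw [sub_eq_add_neg, osc_add]
    ring
  rw [e]
  exact key

end Smoothing

section SmoothingBounds

open Real MeasureTheory

theorem gauss_le_exp_abs {N : ℝ} (hN : 1 ≤ N) (v : ℝ) :
    exp (-(N ^ 2 * v ^ 2)) ≤ 2 * exp (-|v|) := by
  have : (2 : ℝ) * exp (-|v|) = exp (log 2 + -|v|) := by rw [exp_add, exp_log two_pos]
  rw [this]
  apply exp_le_exp.2
  rw [← sq_abs v]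
  have := log_two_gt_d9
  have hN2 : 1 ≤ N ^ 2 := one_le_pow₀ hN
  nlinarith [sq_nonneg (|v| - 1 / 2), mul_nonneg (sub_nonneg.2 hN2) (sq_nonneg |v|)]

theorem abs_mul_gauss_le {N : ℝ} (hN : 1 ≤ N) (v : ℝ) :
    |v| * exp (-(N ^ 2 * v ^ 2)) ≤ exp (-|v|) := by
  have h1 : |v| ≤ exp (|v| - 1) := by linarith [add_one_le_exp (|v| - 1)]
  calc |v| * exp (-(N ^ 2 * v ^ 2)) ≤ exp (|v| - 1) * exp (-(N ^ 2 * v ^ 2)) := by gcongr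
    _ = exp (|v| - 1 + -(N ^ 2 * v ^ 2)) := by rw [exp_add]
    _ ≤ _ := by
      apply exp_le_exp.2
      rw [← sq_abs v]
      have hN2 : 1 ≤ N ^ 2 := one_le_pow₀ hN
      nlinarith [sq_nonneg (|v| - 1), mul_nonneg (sub_nonneg.2 hN2) (sq_nonneg |v|)]

theorem abs_gaussDiff_le {N : ℝ} (hN : 1 ≤ N) (h v : ℝ) :
    |gaussDiff N h v| ≤ 2 * exp (-|v|) + 2 * exp (-|v - h|) := by
  unfold gaussDiff
  refine (abs_sub _ _).trans ?_
  rw [abs_of_pos (exp_pos _), abs_of_pos (exp_pos _)]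
  exact add_le_add (gauss_le_exp_abs hN v) (gauss_le_exp_abs hN _)

theorem abs_mul_gaussDiff_le {N : ℝ} (hN : 1 ≤ N) {h : ℝ} (hh : 0 ≤ h) (v : ℝ) :
    |v * gaussDiff N h v| ≤ (2 + 2 * h) * (exp (-|v|) + exp (-|v - h|)) := by
  have h1 := abs_mul_gauss_le hN v
  have h2 := abs_mul_gauss_le hN (v - h)
  have h3 := gauss_le_exp_abs hN (v - h)
  have e : v * gaussDiff N h v = v * exp (-(N ^ 2 * v ^ 2)) - (v - h) * exp (-(N ^ 2 * (v - h) ^ 2))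
      - h * exp (-(N ^ 2 * (v - h) ^ 2)) := by
    unfold gaussDiff
    ring
  rw [e]
  refine (abs_sub _ _).trans ((add_le_add_left (abs_sub _ _) _).trans ?_)
  rw [abs_mul, abs_mul, abs_mul, abs_of_pos (exp_pos _), abs_of_pos (exp_pos _), abs_of_nonneg hh]
  have p1 := exp_pos (-|v|)
  have p2 := exp_pos (-|v - h|)
  have := mul_le_mul_of_nonneg_left h3 hh
  nlinarith [mul_nonneg hh p1.le]

theorem abs_coeff_le_of_le_rankin {c : ℕ → ℝ} {σ : ℝ} (hσ : 0 ≤ σ)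
    (hc : ∀ n : ℕ, |c n| ≤ oneAddVonMangoldt n / n * exp (-(σ * log n))) (n : ℕ) :
    |c n| ≤ oneAddVonMangoldt n / n := by
  refine (hc n).trans (mul_le_of_le_one_right (div_nonneg (oneAddVonMangoldt_nonneg n) (by positivity))
    (exp_le_one_iff.2 ?_))
  have := log_natCast_nonneg n
  nlinarith

theorem exists_abs_smoothDiff_le :
    ∃ K : ℝ, 1 ≤ K ∧ ∀ (c : ℕ → ℝ) (N h w : ℝ), 1 ≤ N → 0 ≤ h →
      (∀ n : ℕ, |c n| ≤ oneAddVonMangoldt n / n) →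
      |smoothDiff c N h w| ≤ K * min 1 (exp w) := by
  obtain ⟨K, hK1, hK⟩ := exists_exp_kernel_tsum_le
  refine ⟨4 * K, by linarith, fun c N h w hN hh hc => ?_⟩
  have hw : ∀ n : ℕ, 0 ≤ oneAddVonMangoldt n / n := fun n => (abs_nonneg _).trans (hc n)
  have gen : ∀ u v A : ℝ, 0 ≤ A → (∀ n : ℕ, exp (-|w - log n|) ≤ A * exp (-|u - log n|)) →
      (∀ n : ℕ, exp (-|w - h - log n|) ≤ A * exp (-|v - log n|)) → |smoothDiff c N h w| ≤ 4 * K * A := by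
    intro u v A hA h1 h2
    unfold smoothDiff
    rw [← norm_eq_abs]
    refine (tsum_of_norm_bounded (((hK u).1.mul_left (2 * A)).add ((hK v).1.mul_left (2 * A))).hasSum
      fun n => ?_).trans ?_
    · rw [norm_mul, norm_eq_abs, norm_eq_abs]
      calc _ ≤ oneAddVonMangoldt n / n * (2 * (A * exp (-|u - log n|)) + 2 * (A * exp (-|v - log n|))) := by
            have := hw n
            gcongr
            · exact hc n
            · refine (abs_gaussDiff_le hN h _).trans ?_
              gcongr
              · exact h1 n
              · rw [sub_right_comm]; exact h2 n
        _ = _ := by ring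
    · rw [((hK u).1.mul_left (2 * A)).tsum_add ((hK v).1.mul_left (2 * A)), tsum_mul_left, tsum_mul_left]
      have a1 := mul_le_mul_of_nonneg_left (hK u).2 hA
      have a2 := mul_le_mul_of_nonneg_left (hK v).2 hA
      linarith
  rcases le_total 0 w with hw0 | hw0
  · rw [min_eq_left (one_le_exp hw0)]
    exact gen w (w - h) 1 zero_le_one (fun n => by simp) (fun n => by simp)
  · rw [min_eq_right (exp_le_one_iff.2 hw0)]
    refine gen 0 0 (exp w) (exp_pos _).le (fun n => ?_) (fun n => ?_)
    · rw [← exp_add]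
      have := log_natCast_nonneg n
      apply exp_le_exp.2
      rw [abs_of_nonpos (by linarith), abs_of_nonpos (by linarith)]
      linarith
    · rw [← exp_add]
      have := log_natCast_nonneg n
      apply exp_le_exp.2
      rw [abs_of_nonpos (by linarith), abs_of_nonpos (by linarith)]
      linarith

theorem exists_abs_mul_smoothDiff_sub_le :
    ∃ K : ℝ, 1 ≤ K ∧ ∀ (f : ℕ →*₀ ℝ) (σ N h w : ℝ), (∀ n, |f n| ≤ 1) → 0 < σ → σ ≤ 1 → 1 ≤ N → 0 ≤ h →
      |w * smoothDiff (shiftedCoeff f σ) N h w -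
        smoothDiff (shiftedCoeff (fun n => f n * log n) σ) N h w| ≤ K * (1 + h) := by
  obtain ⟨K, hK1, hK⟩ := exists_exp_kernel_tsum_le
  refine ⟨4 * K, by linarith, fun f σ N h w hf hσ hσ1 hN hh => ?_⟩
  have s1 := summable_mul_gaussDiff h (N := N) (summable_norm_shiftedCoeff hf hσ hσ1) w
  have s2 := summable_mul_gaussDiff h (N := N) (summable_norm_shiftedCoeff_log hf hσ hσ1) w
  unfold smoothDiff
  rw [← tsum_mul_left, ← (s1.mul_left w).tsum_sub s2, ← norm_eq_abs]
  refine (tsum_of_norm_bounded (((hK w).1.mul_left (2 + 2 * h)).add ((hK (w - h)).1.mul_left (2 + 2 * h))).hasSum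
      fun n => ?_).trans ?_
  · have hc : |shiftedCoeff f σ n| ≤ oneAddVonMangoldt n / n :=
      abs_coeff_le_of_le_rankin hσ.le (abs_shiftedCoeff_le hf) n
    have e : w * (shiftedCoeff f σ n * gaussDiff N h (w - log n)) -
        shiftedCoeff (fun n => f n * log n) σ n * gaussDiff N h (w - log n) =
        shiftedCoeff f σ n * ((w - log n) * gaussDiff N h (w - log n)) := by
      unfold shiftedCoeff
      ring
    rw [e, norm_mul, norm_eq_abs, norm_eq_abs]
    calc _ ≤ oneAddVonMangoldt n / n * ((2 + 2 * h) * (exp (-|w - log n|) + exp (-|w - log n - h|))) := by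
          gcongr
          · exact (abs_nonneg _).trans hc
          · exact abs_mul_gaussDiff_le hN hh _
      _ = _ := by rw [sub_right_comm]; ring
  · rw [((hK w).1.mul_left _).tsum_add ((hK (w - h)).1.mul_left _), tsum_mul_left, tsum_mul_left]
    have a1 := mul_le_mul_of_nonneg_left (hK w).2 (by positivity : 0 ≤ 2 + 2 * h)
    have a2 := mul_le_mul_of_nonneg_left (hK (w - h)).2 (by positivity : 0 ≤ 2 + 2 * h)
    linarith

theorem norm_one_sub_osc_le (h t : ℝ) : ‖1 - osc (-h) t‖ ≤ |t| * |h| := by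
  rw [norm_sub_rev]
  have := norm_exp_I_mul_ofReal_sub_one_le (x := t * -h)
  unfold osc
  rw [mul_comm] at this
  simpa using this

theorem norm_one_sub_osc_le_two (h t : ℝ) : ‖1 - osc (-h) t‖ ≤ 2 := by
  refine (norm_sub_le _ _).trans ?_
  rw [norm_osc, norm_one]
  norm_num

theorem exists_sup_le :
    ∃ K : ℝ, 1 ≤ K ∧ ∀ (f : ℕ →*₀ ℝ) (X N h t : ℝ), (∀ n, |f n| ≤ 1) → 1 ≤ X → 1 ≤ N → 0 ≤ h →
      h ≤ X ^ 4 →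
      exp (-(1 / (8 * N ^ 2)) * t ^ 2) * ‖1 - osc (-h) t‖ * ‖oscSeries (shiftedCoeff f (1 / X ^ 16)) t‖
        ≤ K * N * X ^ 14 := by
  obtain ⟨K, hK1, hK⟩ := exists_norm_tsum_shiftedCoeff_le_div
  obtain ⟨C, hC1, hC⟩ := exists_norm_tsum_shiftedCoeff_le
  refine ⟨K + 8 * C, by linarith, fun f X N h t hf hX hN hh hhX => ?_⟩
  have hX0 : 0 < X := by linarith
  have hσ : 0 < 1 / X ^ 16 := by positivity
  have hσ1 : 1 / X ^ 16 ≤ 1 := by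
    rw [div_le_one (by positivity)]
    exact one_le_pow₀ hX
  set g := exp (-(1 / (8 * N ^ 2)) * t ^ 2) with hg
  have hN2 : 0 < 1 / (8 * N ^ 2) := by positivity
  have hg0 : 0 < g := exp_pos _
  have hg1 : g ≤ 1 := exp_le_one_iff.2 (by nlinarith [sq_nonneg t])
  have e1 : 0 < X ^ 14 := by positivity
  rcases le_total |t| (1 / X ^ 8) with ht | ht
  · have h1 : ‖oscSeries (shiftedCoeff f (1 / X ^ 16)) t‖ ≤ K * X ^ 16 := by
      refine (hK f _ t hf hσ hσ1).trans (le_of_eq ?_)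
      field_simp
    have h2 : ‖1 - osc (-h) t‖ ≤ 1 / X ^ 8 * X ^ 4 := by
      refine (norm_one_sub_osc_le h t).trans ?_
      rw [abs_of_nonneg hh]
      gcongr
    calc _ ≤ 1 * (1 / X ^ 8 * X ^ 4) * (K * X ^ 16) := by gcongr
      _ = K * X ^ 12 := by field_simp
      _ ≤ K * X ^ 14 := by gcongr; norm_num
      _ ≤ (K + 8 * C) * N * X ^ 14 := by
          gcongr
          nlinarith
  · have ht0 : 0 < |t| := lt_of_lt_of_le (by positivity) ht
    have h1 : ‖oscSeries (shiftedCoeff f (1 / X ^ 16)) t‖ ≤ C * X ^ 12 * (X ^ 2 * (2 + |t|)) := by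
      refine (hC f _ t hf hσ hσ1 (abs_pos.1 ht0)).trans ?_
      have a1 : (1 / (1 / X ^ 16)) ^ (3 / 4 : ℝ) = X ^ 12 := by
        rw [one_div_one_div, ← rpow_natCast, ← rpow_natCast, ← rpow_mul hX0.le]
        norm_num
      rw [a1]
      gcongr
      have a2 : 1 / |t| + 1 + |t| ≤ (X ^ 2 * (2 + |t|)) ^ (4 : ℝ) := by
        have b1 : 1 / |t| ≤ X ^ 8 := by
          rw [div_le_comm₀ ht0 (by positivity)]
          exact ht
        have b2 : 1 ≤ X ^ 8 := one_le_pow₀ hX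
        have b3 : (X ^ 2 * (2 + |t|)) ^ (4 : ℝ) = X ^ 8 * (2 + |t|) ^ 4 := by
          rw [show (4 : ℝ) = ((4 : ℕ) : ℝ) by norm_num, rpow_natCast]
          ring
        rw [b3]
        have b4 : (2 + |t|) ≤ (2 + |t|) ^ 4 := le_self_pow₀ (by linarith) (by norm_num)
        calc 1 / |t| + 1 + |t| ≤ X ^ 8 + X ^ 8 + X ^ 8 * |t| := by nlinarith
          _ = X ^ 8 * (2 + |t|) := by ring
          _ ≤ _ := by gcongr
      calc _ ≤ ((X ^ 2 * (2 + |t|)) ^ (4 : ℝ)) ^ (1 / 4 : ℝ) := by gcongr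
        _ = _ := by
          rw [← rpow_mul (by positivity)]
          norm_num
    have h2 : g * (2 + |t|) ≤ 4 * N := by
      have h3 : |t| / N ≤ 2 * exp (1 / (8 * N ^ 2) * t ^ 2) := by
        have h4 : 1 / (8 * N ^ 2) * t ^ 2 = (|t| / N) ^ 2 / 8 := by
          rw [div_pow, sq_abs]; field_simp
        rw [h4]
        nlinarith [add_one_le_exp ((|t| / N) ^ 2 / 8), sq_nonneg (|t| / N - 2)]
      have h5 : g * exp (1 / (8 * N ^ 2) * t ^ 2) = 1 := by
        rw [hg, ← exp_add]
        simp
      have h6 : g * |t| ≤ 2 * N := by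
        rw [div_le_iff₀ (by linarith)] at h3
        calc g * |t| ≤ g * (2 * exp (1 / (8 * N ^ 2) * t ^ 2) * N) := by gcongr
          _ = 2 * N * (g * exp (1 / (8 * N ^ 2) * t ^ 2)) := by ring
          _ = _ := by rw [h5, mul_one]
      nlinarith
    calc _ ≤ g * 2 * (C * X ^ 12 * (X ^ 2 * (2 + |t|))) := by
          gcongr
          exact norm_one_sub_osc_le_two h t
      _ = 2 * C * X ^ 14 * (g * (2 + |t|)) := by ring
      _ ≤ 2 * C * X ^ 14 * (4 * N) := by gcongr
      _ = 8 * C * N * X ^ 14 := by ring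
      _ ≤ (K + 8 * C) * N * X ^ 14 := by
          gcongr
          linarith

end SmoothingBounds

section SmoothingRecursion

open Real MeasureTheory

theorem exists_abs_tsum_mul_smoothDiff_le :
    ∃ K : ℝ, 1 ≤ K ∧ ∀ (f : ℕ →*₀ ℝ) (X N h w κ : ℝ) (p : ℕ → ℝ), (∀ n, |f n| ≤ 1) → 1 ≤ X →
      1 ≤ N → 0 ≤ h → h ≤ X ^ 4 → 0 < κ →
      (∀ n : ℕ, |p n| ≤ κ * (oneAddVonMangoldt n / n * exp (-(1 / X ^ 16 * log n)))) →
      Summable (fun n : ℕ => p n *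
        smoothDiff (shiftedCoeff (fun n => f n * log n) (1 / X ^ 16)) N h (w - log n)) ∧
      |∑' n : ℕ, p n *
        smoothDiff (shiftedCoeff (fun n => f n * log n) (1 / X ^ 16)) N h (w - log n)|
        ≤ K * N * X ^ 30 * κ := by
  obtain ⟨C, hC1, hC⟩ := exists_meanSquare_le
  obtain ⟨B, hB1, hB⟩ := exists_sup_le
  obtain ⟨K0, -, hK0⟩ := exists_power_sum_le
  refine ⟨B * C, by nlinarith, fun f X N h w κ p hf hX hN hh hhX hκ hp => ?_⟩
  have hX0 : 0 < X := by linarith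
  have hN0 : 0 < N := by linarith
  set σ := 1 / X ^ 16 with hσdef
  have hσ : 0 < σ := by positivity
  have hσ1 : σ ≤ 1 := by
    rw [hσdef, div_le_one (by positivity)]
    exact one_le_pow₀ hX
  set b := shiftedCoeff (fun n => f n * ArithmeticFunction.vonMangoldt n) σ with hb
  have sp : Summable (fun n => ‖(p n : ℂ)‖) := by
    simp only [Complex.norm_real]
    exact Summable.of_nonneg_of_le (fun n => norm_nonneg _) hp ((hK0 σ hσ hσ1).1.mul_left κ)
  have sb := summable_norm_shiftedCoeff_vonMangoldt hf hσ hσ1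
  have sl := summable_norm_shiftedCoeff_log hf hσ hσ1
  have key := hasSum_mul_smoothDiff hN0 h sl sp w
  set S : ℝ → ℝ := smoothDiff (shiftedCoeff (fun n => f n * log n) σ) N h with hS
  set J := ∫ t, gaussDiffFourier N h t * osc w t *
    oscSeries (shiftedCoeff (fun n => f n * log n) σ) t * oscSeries p t with hJ
  have hc0 : 0 < 2 * N * √π := by positivity
  have keyr := Complex.hasSum_re key
  simp only [Complex.ofReal_re] at keyr
  have keyr2 : HasSum (fun n : ℕ => p n * S (w - log n)) (J.re / (2 * N * √π)) := by
    have := keyr.div_const (2 * N * √π)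
    have e3 : ∀ x y : ℝ, x * (2 * N * √π * y) / (2 * N * √π) = x * y := fun x y => by field_simp
    simpa only [e3] using this
  have hJn : ‖J‖ ≤ B * C * N ^ 2 * X ^ 30 * κ := by
    set b8 := 1 / (8 * N ^ 2) with hb8
    have hb80 : 0 < b8 := by positivity
    set g : ℝ → ℝ := fun t => B * N * X ^ 14 / 2 *
      (κ⁻¹ * (exp (-b8 * t ^ 2) * ‖oscSeries p t‖ ^ 2) + κ * (exp (-b8 * t ^ 2) * ‖oscSeries b t‖ ^ 2)) with hg
    have i1 : Integrable (fun t => exp (-b8 * t ^ 2) * ‖oscSeries p t‖ ^ 2) :=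
      integrable_gaussian_mul_normSq hb80 (fun n : ℕ => -log n) sp
    have i2 : Integrable (fun t => exp (-b8 * t ^ 2) * ‖oscSeries b t‖ ^ 2) :=
      integrable_gaussian_mul_normSq hb80 (fun n : ℕ => -log n) sb
    have hgi : Integrable g := ((i1.const_mul _).add (i2.const_mul _)).const_mul _
    refine (norm_integral_le_of_norm_le hgi (Filter.Eventually.of_forall fun t => ?_)).trans ?_
    · rw [oscSeries_log_eq_mul hf hσ hσ1, norm_mul, norm_mul, norm_mul, norm_mul, norm_osc, mul_one,
        gaussDiffFourier, norm_mul, Complex.norm_real, norm_of_nonneg (exp_pos _).le]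
      have e1 : exp (-(1 / (4 * N ^ 2)) * t ^ 2) = exp (-b8 * t ^ 2) * exp (-b8 * t ^ 2) := by
        rw [← exp_add, hb8]
        congr 1
        field_simp
        ring
      have e2 := hB f X N h t hf hX hN hh hhX
      rw [← hb8, ← hσdef] at e2
      set P := ‖oscSeries p t‖
      set Q := ‖oscSeries b t‖
      set R := ‖oscSeries (shiftedCoeff f σ) t‖
      set E := exp (-b8 * t ^ 2)
      have hE : 0 < E := exp_pos _
      have hPQ : P * Q ≤ (κ⁻¹ * P ^ 2 + κ * Q ^ 2) / 2 := by
        have h1 : 0 ≤ κ⁻¹ * (P - κ * Q) ^ 2 := by positivity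
        have h2 : κ⁻¹ * (P - κ * Q) ^ 2 = κ⁻¹ * P ^ 2 + κ * Q ^ 2 - 2 * (P * Q) := by
          field_simp
          ring
        linarith
      have hP : 0 ≤ P := norm_nonneg _
      have hQ : 0 ≤ Q := norm_nonneg _
      rw [e1]
      calc _ = E * ‖1 - osc (-h) t‖ * R * (E * (P * Q)) := by ring
        _ ≤ (B * N * X ^ 14) * (E * ((κ⁻¹ * P ^ 2 + κ * Q ^ 2) / 2)) := by gcongr
        _ = _ := by simp only [hg]; ring
    · simp only [hg]
      rw [integral_const_mul, integral_add (i1.const_mul _) (i2.const_mul _), integral_const_mul,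
        integral_const_mul]
      have m1 := hC N σ κ p hN hσ hσ1 hκ.le hp
      have m2 := hC N σ 1 b hN hσ hσ1 zero_le_one (fun n => by
        rw [one_mul]
        exact abs_shiftedCoeff_vonMangoldt_le hf n)
      rw [← hb8] at m1 m2
      calc _ ≤ B * N * X ^ 14 / 2 * (κ⁻¹ * (C * N * κ ^ 2 / σ) + κ * (C * N * 1 ^ 2 / σ)) := by
            gcongr
            · exact m1
            · exact m2
        _ = _ := by
            rw [hσdef]
            field_simp
            ring
  refine ⟨keyr2.summable, ?_⟩
  rw [keyr2.tsum_eq, abs_div, abs_of_pos hc0, div_le_iff₀ hc0]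
  refine (Complex.abs_re_le_norm J).trans (hJn.trans ?_)
  have hpi : 1 ≤ 2 * √π := by
    have : 1 ≤ √π := by
      rw [Real.one_le_sqrt]
      linarith [pi_gt_three]
    linarith
  calc B * C * N ^ 2 * X ^ 30 * κ = B * C * N ^ 2 * X ^ 30 * κ * 1 := by ring
    _ ≤ B * C * N ^ 2 * X ^ 30 * κ * (2 * √π) := by gcongr
    _ = _ := by ring

theorem exists_abs_smoothDiff_le_div :
    ∃ K : ℝ, 1 ≤ K ∧ ∀ (f : ℕ →*₀ ℝ) (X N h w : ℝ), (∀ n, |f n| ≤ 1) → 1 < X →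
      1 ≤ N → 0 ≤ h → h ≤ X ^ 4 → X ^ 16 / 2 ≤ w →
      |smoothDiff (shiftedCoeff f (1 / X ^ 16)) N h w| ≤ K * N / X := by
  obtain ⟨A, hA1, hA⟩ := exists_abs_tsum_mul_smoothDiff_le
  obtain ⟨K1, hK11, hK1⟩ := exists_abs_mul_smoothDiff_sub_le
  obtain ⟨K2, hK21, hK2⟩ := exists_abs_smoothDiff_le
  obtain ⟨K3, hK31, hK3⟩ := exists_truncated_sum_le
  refine ⟨4 * K1 + 12 * K1 * K3 + 3 * K2 * K3 + 4 * A, by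
    have := mul_nonneg (by linarith : 0 ≤ K1) (by linarith : 0 ≤ K3)
    have := mul_nonneg (by linarith : 0 ≤ K2) (by linarith : 0 ≤ K3)
    linarith, fun f X N h w hf hX hN hh hhX hw => ?_⟩
  have hX0 : 0 < X := by linarith
  have hN0 : 0 < N := by linarith
  set σ := 1 / X ^ 16 with hσdef
  have hσ : 0 < σ := by positivity
  have hσ1 : σ ≤ 1 := by
    rw [hσdef, div_le_one (by positivity)]
    exact one_le_pow₀ hX.le
  have hw0 : 0 < w := lt_of_lt_of_le (by positivity) hw
  set θ := 1 / X with hθ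
  have hθ0 : 0 < θ := by positivity
  have hθ1 : θ < 1 := by rw [hθ, div_lt_one hX0]; exact hX
  set b := shiftedCoeff (fun n => f n * ArithmeticFunction.vonMangoldt n) σ with hb
  have hbb := abs_shiftedCoeff_vonMangoldt_le hf (σ := σ)
  rw [← hb] at hbb
  have hbw := abs_coeff_le_of_le_rankin hσ.le hbb
  have sb := summable_norm_shiftedCoeff_vonMangoldt hf hσ hσ1
  have sf := summable_norm_shiftedCoeff hf hσ hσ1
  set D : ℝ → ℝ := smoothDiff (shiftedCoeff f σ) N h with hD
  set S : ℝ → ℝ := smoothDiff (shiftedCoeff (fun n => f n * log n) σ) N h with hS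
  have hDS : ∀ u, |u * D u - S u| ≤ K1 * (1 + h) := fun u => hK1 f σ N h u hf hσ hσ1 hN hh
  have hDb : ∀ u, |D u| ≤ K2 * min 1 (exp u) := fun u => hK2 _ N h u hN hh
    (abs_coeff_le_of_le_rankin hσ.le (abs_shiftedCoeff_le hf))
  set p : ℕ → ℝ := fun n => if log n ≤ (1 - θ) * w then b n / (w - log n) else 0 with hpdef
  have hθw : 0 < θ * w := by positivity
  have hp : ∀ n : ℕ, |p n| ≤ 1 / (θ * w) * (oneAddVonMangoldt n / n * exp (-(σ * log n))) := by
    intro n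
    have h0 : 0 ≤ oneAddVonMangoldt n / n * exp (-(σ * log n)) := (abs_nonneg _).trans (hbb n)
    simp only [hpdef]
    split_ifs with hl
    · rw [abs_div, div_eq_mul_one_div, mul_comm]
      have hu : θ * w ≤ w - log n := by linarith
      rw [abs_of_pos (lt_of_lt_of_le hθw hu)]
      gcongr
      exact hbb n
    · rw [abs_zero]; positivity
  obtain ⟨sp, bp⟩ := hA f X N h w (1 / (θ * w)) p hf hX.le hN hh hhX (by positivity) hp
  rw [← hσdef, ← hS] at sp bp
  -- the expansion of the smoothed sum of `f log`
  have hexp : HasSum (fun n : ℕ => b n * D (w - log n)) (S w) := by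
    have key := hasSum_mul_smoothDiff hN0 h sf sb w
    have e : ∀ t, gaussDiffFourier N h t * osc w t * oscSeries (shiftedCoeff f σ) t * oscSeries b t =
        gaussDiffFourier N h t * osc w t * oscSeries (shiftedCoeff (fun n => f n * log n) σ) t := by
      intro t
      rw [oscSeries_log_eq_mul hf hσ hσ1]
      ring
    rw [← hb] at key
    simp only [e] at key
    rw [integral_gaussDiffFourier_mul_oscSeries hN0 h (summable_norm_shiftedCoeff_log hf hσ hσ1)] at key
    have keyr := (Complex.hasSum_re key).div_const (2 * N * √π)
    simp only [Complex.ofReal_re] at keyr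
    have hc0 : 0 < 2 * N * √π := by positivity
    have e3 : ∀ x y : ℝ, x * (2 * N * √π * y) / (2 * N * √π) = x * y := fun x y => by field_simp
    have e4 : ∀ y : ℝ, (2 * N * √π * y) / (2 * N * √π) = y := fun y => by field_simp
    simp only [e3, e4] at keyr
    exact keyr
  set T : ℝ → ℝ → ℕ → ℝ := fun α β n => if α ≤ log n then
        oneAddVonMangoldt n / n * min 1 (exp (β - log n)) else 0 with hT
  have hT0 : ∀ α β n, 0 ≤ T α β n := fun α β n => by
    simp only [hT]
    have := (abs_nonneg _).trans (hbw n)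
    split_ifs
    · have : 0 < min 1 (exp (β - log n)) := lt_min one_pos (exp_pos _)
      positivity
    · rfl
  have hr : ∀ n : ℕ, ‖b n * D (w - log n) - p n * S (w - log n)‖ ≤
      K1 * (1 + h) / (θ * w) * T 0 w n + K2 * T ((1 - θ) * w) w n := by
    intro n
    have hw1 := (abs_nonneg _).trans (hbw n)
    have t1 := hT0 0 w n
    have t2 := hT0 ((1 - θ) * w) w n
    rw [norm_eq_abs]
    by_cases hl : log n ≤ (1 - θ) * w
    · have hu : θ * w ≤ w - log n := by linarith
      have hu0 : 0 < w - log n := lt_of_lt_of_le hθw hu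
      have e1 : b n * D (w - log n) - p n * S (w - log n) =
          b n * (((w - log n) * D (w - log n) - S (w - log n)) / (w - log n)) := by
        simp only [hpdef, if_pos hl]
        field_simp
      have e2 : T 0 w n = oneAddVonMangoldt n / n := by
        simp only [hT, if_pos (log_natCast_nonneg n)]
        rw [min_eq_left (one_le_exp hu0.le), mul_one]
      rw [e1, e2, abs_mul, abs_div, abs_of_pos hu0]
      calc _ ≤ oneAddVonMangoldt n / n * (K1 * (1 + h) / (θ * w)) := by
            gcongr
            · exact hbw n
            · exact hDS _
        _ ≤ _ := by
            have : 0 ≤ K2 * T ((1 - θ) * w) w n := by positivity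
            linarith
    · have e1 : p n = 0 := by simp only [hpdef, if_neg hl]
      have e2 : T ((1 - θ) * w) w n = oneAddVonMangoldt n / n * min 1 (exp (w - log n)) := by
        simp only [hT, if_pos (not_le.1 hl).le]
      rw [e1, e2, zero_mul, sub_zero, abs_mul]
      calc _ ≤ oneAddVonMangoldt n / n * (K2 * min 1 (exp (w - log n))) := by
            gcongr
            · exact hbw n
            · exact hDb _
        _ ≤ _ := by
            have : 0 ≤ K1 * (1 + h) / (θ * w) * T 0 w n := by positivity
            linarith
  obtain ⟨st1, bt1⟩ := hK3 0 w hw0.le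
  obtain ⟨st2, bt2⟩ := hK3 ((1 - θ) * w) w (by nlinarith)
  have hrem : |S w - ∑' n : ℕ, p n * S (w - log n)| ≤
      K1 * (1 + h) / (θ * w) * (K3 * (w + 1)) + K2 * (K3 * (θ * w + 1)) := by
    rw [← hexp.tsum_eq, ← hexp.summable.tsum_sub sp, ← norm_eq_abs]
    refine (tsum_of_norm_bounded ((st1.mul_left _).add (st2.mul_left _)).hasSum hr).trans ?_
    rw [(st1.mul_left _).tsum_add (st2.mul_left _), tsum_mul_left, tsum_mul_left]
    gcongr
    · simpa using bt1
    · refine bt2.trans (le_of_eq ?_); ring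
  have hwD : |w * D w| ≤ K1 * (1 + h) + (K1 * (1 + h) / (θ * w) * (K3 * (w + 1)) +
      K2 * (K3 * (θ * w + 1))) + A * N * X ^ 30 * (1 / (θ * w)) := by
    have a1 := abs_le.1 (hDS w)
    have a2 := abs_le.1 hrem
    have a3 := abs_le.1 bp
    rw [abs_le]
    constructor <;> linarith [a1.1, a1.2, a2.1, a2.2, a3.1, a3.2]
  rw [abs_mul, abs_of_pos hw0] at hwD
  have hX16 : X ^ 16 ≤ 2 * w := by linarith
  have hX1 : ∀ k : ℕ, k ≤ 16 → X ^ k ≤ 2 * w := fun k hk => (pow_le_pow_right₀ hX.le hk).trans hX16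
  have hhX' : 1 + h ≤ 2 * X ^ 4 := by linarith [one_le_pow₀ hX.le (n := 4)]
  have hw1 : w + 1 ≤ 3 * w := by
    have := hX1 0 (by norm_num)
    rw [pow_zero] at this
    linarith
  have b1 : K1 * (1 + h) ≤ 4 * K1 * (N / X) * w := by
    have : X * X ^ 4 ≤ 2 * w := by rw [← pow_succ']; exact hX1 5 (by norm_num)
    have e : X ^ 4 ≤ 2 * w / X := by rw [le_div_iff₀ hX0]; linarith
    calc K1 * (1 + h) ≤ K1 * (2 * (2 * w / X)) := by gcongr; linarith
      _ = 4 * K1 * (1 / X) * w := by ring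
      _ ≤ _ := by gcongr
  have b2 : K1 * (1 + h) / (θ * w) * (K3 * (w + 1)) ≤ 12 * K1 * K3 * (N / X) * w := by
    have e : X ^ 5 ≤ 2 * w / X := by
      rw [le_div_iff₀ hX0, ← pow_succ]; exact hX1 6 (by norm_num)
    calc _ ≤ K1 * (2 * X ^ 4) / (θ * w) * (K3 * (3 * w)) := by gcongr
      _ = 6 * K1 * K3 * X ^ 5 := by rw [hθ]; field_simp; ring
      _ ≤ 6 * K1 * K3 * (2 * w / X) := by gcongr
      _ = 12 * K1 * K3 * (1 / X) * w := by ring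
      _ ≤ _ := by gcongr
  have b3 : K2 * (K3 * (θ * w + 1)) ≤ 3 * K2 * K3 * (N / X) * w := by
    have e : 1 ≤ 2 * θ * w := by
      rw [hθ]
      have := hX1 1 (by norm_num)
      rw [pow_one] at this
      have : 1 ≤ 2 * w / X := by rw [le_div_iff₀ hX0]; linarith
      calc 1 ≤ 2 * w / X := this
        _ = _ := by ring
    calc K2 * (K3 * (θ * w + 1)) ≤ K2 * (K3 * (3 * θ * w)) := by gcongr; linarith
      _ = 3 * K2 * K3 * (1 / X) * w := by rw [hθ]; ring
      _ ≤ _ := by gcongr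
  have b4 : A * N * X ^ 30 * (1 / (θ * w)) ≤ 4 * A * (N / X) * w := by
    have e : X ^ 32 ≤ 4 * w * w := by
      calc X ^ 32 = X ^ 16 * X ^ 16 := by ring
        _ ≤ (2 * w) * (2 * w) := by gcongr
        _ = _ := by ring
    rw [hθ, show A * N * X ^ 30 * (1 / (1 / X * w)) = A * N / X * (X ^ 32 / w) by field_simp]
    have e2 : X ^ 32 / w ≤ 4 * w := by rw [div_le_iff₀ hw0]; exact e
    calc _ ≤ A * N / X * (4 * w) := by gcongr
      _ = _ := by ring
  have hfin : w * |D w| ≤ w * ((4 * K1 + 12 * K1 * K3 + 3 * K2 * K3 + 4 * A) * N / X) := by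
    calc _ ≤ _ := hwD
      _ ≤ 4 * K1 * (N / X) * w + (12 * K1 * K3 * (N / X) * w + 3 * K2 * K3 * (N / X) * w) + 4 * A * (N / X) * w := by
        gcongr
      _ = _ := by ring
  exact le_of_mul_le_mul_left hfin hw0

end SmoothingRecursion

section MeanValue

open Real MeasureTheory Finset

/-- The kernel `exp (-v)` on the half-line `v ≥ 0`. -/
noncomputable def decay (v : ℝ) : ℝ := if 0 ≤ v then exp (-v) else 0

/-- The mean value of `c` over the positive integers up to `exp w`. -/
noncomputable def meanValue (c : ℕ → ℝ) (w : ℝ) : ℝ := exp (-w) * ∑ n ∈ Icc 1 ⌊exp w⌋₊, c n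

theorem decay_nonneg (v : ℝ) : 0 ≤ decay v := by
  unfold decay
  split_ifs
  · exact (exp_pos _).le
  · rfl

theorem decay_le_one (v : ℝ) : decay v ≤ 1 := by
  unfold decay
  split_ifs with h
  · exact exp_le_one_iff.2 (by linarith)
  · exact zero_le_one

theorem norm_decay_le_one (v : ℝ) : ‖decay v‖ ≤ 1 := by
  rw [norm_of_nonneg (decay_nonneg v)]
  exact decay_le_one v

theorem measurable_decay : Measurable decay :=
  Measurable.ite measurableSet_Ici (by fun_prop) measurable_const

theorem hasSum_mul_decay {a : ℕ → ℝ} (ha : a 0 = 0) (w : ℝ) :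
    HasSum (fun n : ℕ => a n * decay (w - log n)) (meanValue (fun n => n * a n) w) := by
  have key : meanValue (fun n => n * a n) w =
      ∑ n ∈ Icc 1 ⌊exp w⌋₊, a n * decay (w - log n) := by
    rw [meanValue, mul_sum]
    refine sum_congr rfl fun n hn => ?_
    obtain ⟨h1, h2⟩ := mem_Icc.1 hn
    have hn0 : (0 : ℝ) < n := by exact_mod_cast h1
    have h3 : log n ≤ w := by
      rw [log_le_iff_le_exp hn0]
      exact (Nat.le_floor_iff (exp_pos w).le).1 h2
    rw [decay, if_pos (by linarith), neg_sub, exp_sub, exp_log hn0, exp_neg]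
    field_simp
  rw [key]
  refine hasSum_sum_of_ne_finset_zero fun n hn => ?_
  rcases Nat.eq_zero_or_pos n with rfl | hn0
  · rw [ha, zero_mul]
  · have h2 : ¬ n ≤ ⌊exp w⌋₊ := fun h => hn (mem_Icc.2 ⟨hn0, h⟩)
    rw [Nat.le_floor_iff (exp_pos w).le, not_le, ← lt_log_iff_exp_lt (by exact_mod_cast hn0)] at h2
    rw [decay, if_neg (by linarith), mul_zero]

theorem abs_sum_Icc_le {c : ℕ → ℝ} (hc : ∀ n, |c n| ≤ 1) (m : ℕ) : |∑ n ∈ Icc 1 m, c n| ≤ m := by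
  refine (abs_sum_le_sum_abs _ _).trans ((sum_le_sum fun n _ => hc n).trans ?_)
  simp

theorem abs_meanValue_le_one {c : ℕ → ℝ} (hc : ∀ n, |c n| ≤ 1) (w : ℝ) : |meanValue c w| ≤ 1 := by
  rw [meanValue, abs_mul, abs_of_pos (exp_pos _)]
  calc _ ≤ exp (-w) * exp w := by
        gcongr
        exact (abs_sum_Icc_le hc _).trans (Nat.floor_le (exp_pos w).le)
    _ = 1 := by rw [← exp_add]; simp

theorem abs_meanValue_sub_le_of_le {c : ℕ → ℝ} (hc : ∀ n, |c n| ≤ 1) {v w : ℝ} (hvw : v ≤ w) :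
    |meanValue c w - meanValue c v| ≤ 2 * (w - v) + exp (-w) := by
  have hf : ⌊exp v⌋₊ ≤ ⌊exp w⌋₊ := Nat.floor_le_floor (exp_le_exp.2 hvw)
  have hd : ∑ n ∈ Icc 1 ⌊exp w⌋₊, c n = ∑ n ∈ Icc 1 ⌊exp v⌋₊, c n + ∑ n ∈ Ioc ⌊exp v⌋₊ ⌊exp w⌋₊, c n := by
    have := sum_Ioc_consecutive c (Nat.zero_le _) hf
    exact this.symm
  have h2 : |∑ n ∈ Ioc ⌊exp v⌋₊ ⌊exp w⌋₊, c n| ≤ exp w - exp v + 1 := by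
    refine (abs_sum_le_sum_abs _ _).trans ((sum_le_sum fun n _ => hc n).trans ?_)
    have h3 := Nat.floor_le (exp_pos w).le
    have h4 := Nat.lt_floor_add_one (exp v)
    rw [sum_const, Nat.card_Ioc, nsmul_eq_mul, mul_one, Nat.cast_sub hf]
    linarith
  have h1 : |∑ n ∈ Icc 1 ⌊exp v⌋₊, c n| ≤ exp v :=
    (abs_sum_Icc_le hc _).trans (Nat.floor_le (exp_pos v).le)
  have hev : exp (-w) ≤ exp (-v) := exp_le_exp.2 (by linarith)
  have e : meanValue c w - meanValue c v = exp (-w) * ∑ n ∈ Ioc ⌊exp v⌋₊ ⌊exp w⌋₊, c n -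
      (exp (-v) - exp (-w)) * ∑ n ∈ Icc 1 ⌊exp v⌋₊, c n := by
    rw [meanValue, meanValue, hd]
    ring
  have e1 : exp (-w) * exp w = 1 := by rw [← exp_add]; simp
  have e2 : exp (-v) * exp v = 1 := by rw [← exp_add]; simp
  have e3 : exp (-w) * exp v = exp (-(w - v)) := by rw [← exp_add]; congr 1; ring
  have e4 := add_one_le_exp (-(w - v))
  rw [e]
  refine (abs_sub _ _).trans ?_
  rw [abs_mul, abs_mul, abs_of_pos (exp_pos _), abs_of_nonneg (sub_nonneg.2 hev)]
  calc _ ≤ exp (-w) * (exp w - exp v + 1) + (exp (-v) - exp (-w)) * exp v := by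
        have := sub_nonneg.2 hev
        gcongr
    _ = 2 - 2 * exp (-(w - v)) + exp (-w) := by
        have : exp (-w) * (exp w - exp v + 1) + (exp (-v) - exp (-w)) * exp v =
          exp (-w) * exp w + exp (-v) * exp v - 2 * (exp (-w) * exp v) + exp (-w) := by ring
        rw [this, e1, e2, e3]
        ring
    _ ≤ _ := by linarith

theorem abs_meanValue_sub_le {c : ℕ → ℝ} (hc : ∀ n, |c n| ≤ 1) (v w : ℝ) :
    |meanValue c v - meanValue c w| ≤ 2 * |v - w| + exp (-w) := by
  rcases le_total v w with h | h
  · rw [abs_sub_comm v, abs_of_nonneg (sub_nonneg.2 h), abs_sub_comm]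
    exact abs_meanValue_sub_le_of_le hc h
  · rw [abs_of_nonneg (sub_nonneg.2 h)]
    have : exp (-v) ≤ exp (-w) := exp_le_exp.2 (by linarith)
    linarith [abs_meanValue_sub_le_of_le hc h]

theorem integral_exp_mul_gauss_eq (N y : ℝ) :
    ∫ u in Set.Ici 0, exp (-u) * exp (-(N ^ 2 * (y - u) ^ 2)) =
      ∫ v, exp (-(N ^ 2 * v ^ 2)) * decay (y - v) := by
  rw [← integral_sub_left_eq_self (fun v => exp (-(N ^ 2 * v ^ 2)) * decay (y - v)) volume y,
    ← integral_indicator measurableSet_Ici]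
  congr 1
  ext u
  by_cases h : 0 ≤ u
  · rw [Set.indicator_of_mem (Set.mem_Ici.2 h), sub_sub_cancel, decay, if_pos h, mul_comm]
  · rw [Set.indicator_of_notMem (by simpa using h), sub_sub_cancel, decay, if_neg h, mul_zero]

theorem integrable_gauss {N : ℝ} (hN : 0 < N) : Integrable (fun v : ℝ => exp (-(N ^ 2 * v ^ 2))) := by
  have := integrable_exp_neg_mul_sq (b := N ^ 2) (by positivity)
  simpa only [neg_mul] using this

theorem integrable_gauss_mul_decay {N : ℝ} (hN : 0 < N) (y : ℝ) :
    Integrable (fun v : ℝ => exp (-(N ^ 2 * v ^ 2)) * decay (y - v)) :=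
  (integrable_gauss hN).mul_bdd (c := 1)
    (measurable_decay.comp (measurable_const.sub measurable_id)).aestronglyMeasurable
    (Filter.Eventually.of_forall fun _ => norm_decay_le_one _)

theorem integral_gauss {N : ℝ} (hN : 0 < N) : ∫ v : ℝ, exp (-(N ^ 2 * v ^ 2)) = √π / N := by
  have := integral_gaussian (N ^ 2)
  simp only [neg_mul] at this
  rw [this, sqrt_div pi_nonneg, sqrt_sq hN.le]

theorem integrable_exp_neg_Ici : IntegrableOn (fun u : ℝ => exp (-u)) (Set.Ici 0) := by
  rw [integrableOn_Ici_iff_integrableOn_Ioi]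
  exact integrableOn_exp_neg_Ioi 0

theorem hasSum_integral_exp_mul_gaussDiff (N h : ℝ) {a : ℕ → ℝ}
    (hs : Summable (fun n => ‖(a n : ℂ)‖)) (w : ℝ) :
    HasSum (fun n : ℕ => a n * ∫ u in Set.Ici 0, exp (-u) * gaussDiff N h (w - log n - u))
      (∫ u in Set.Ici 0, exp (-u) * smoothDiff a N h (w - u)) := by
  have hm : Measurable (gaussDiff N h) := by
    unfold gaussDiff
    fun_prop
  have hi : ∀ n : ℕ, Integrable (fun u => a n * (exp (-u) * gaussDiff N h (w - log n - u)))
      (volume.restrict (Set.Ici 0)) := fun n => by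
    refine Integrable.const_mul ?_ _
    refine Integrable.mul_bdd (c := 1) integrable_exp_neg_Ici
      (hm.comp (measurable_const.sub measurable_id)).aestronglyMeasurable ?_
    exact Filter.Eventually.of_forall fun u => gaussDiff_bound h _
  have hn : Summable fun n : ℕ => ∫ u in Set.Ici 0, ‖a n * (exp (-u) * gaussDiff N h (w - log n - u))‖ := by
    refine Summable.of_nonneg_of_le (fun n => integral_nonneg fun u => norm_nonneg _) (fun n => ?_)
      (hs.mul_right (∫ u in Set.Ici 0, exp (-u)))
    rw [← integral_const_mul]
    refine integral_mono_of_nonneg (Filter.Eventually.of_forall fun u => norm_nonneg _)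
      (integrable_exp_neg_Ici.integrable.const_mul _) (Filter.Eventually.of_forall fun u => ?_)
    simp only
    rw [norm_mul, norm_mul, Complex.norm_real, norm_of_nonneg (exp_pos (-u)).le]
    gcongr
    exact mul_le_of_le_one_right (exp_pos _).le (gaussDiff_bound h _)
  have := hasSum_integral_of_summable_integral_norm hi hn
  simp only [integral_const_mul] at this
  have e : ∀ u, exp (-u) * smoothDiff a N h (w - u) =
      ∑' n : ℕ, a n * (exp (-u) * gaussDiff N h (w - log n - u)) := fun u => by
    rw [smoothDiff, ← tsum_mul_left]
    refine tsum_congr fun n => ?_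
    rw [show w - u - log n = w - log n - u by ring]
    ring
  simp only [e]
  exact this

theorem abs_integral_gauss_mul_le {N : ℝ} (hN : 0 < N) {F : ℝ → ℝ} {A B : ℝ} (hA : 0 ≤ A)
    (hF : ∀ v, |F v| ≤ A * |v| + B) :
    |∫ v, exp (-(N ^ 2 * v ^ 2)) * F v| ≤ A * (2 / N) * (√π / N) + B * (√π / N) := by
  have hb : 0 < N ^ 2 / 2 := by positivity
  have i1 := (integrable_exp_neg_mul_sq hb).const_mul (A / N)
  have i2 := (integrable_gauss hN).const_mul B
  have hv : ∀ v : ℝ, |v| * exp (-(N ^ 2 * v ^ 2)) ≤ 1 / N * exp (-(N ^ 2 / 2) * v ^ 2) := fun v => by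
    have h1 : N * |v| ≤ exp (N ^ 2 / 2 * v ^ 2) := by
      refine le_trans ?_ (add_one_le_exp _)
      rw [← sq_abs v]
      nlinarith [sq_nonneg (N * |v| - 1)]
    have h2 : exp (-(N ^ 2 / 2) * v ^ 2) = exp (N ^ 2 / 2 * v ^ 2) * exp (-(N ^ 2 * v ^ 2)) := by
      rw [← exp_add]
      congr 1
      ring
    rw [h2, div_mul_eq_mul_div, one_mul, le_div_iff₀ hN]
    calc _ = N * |v| * exp (-(N ^ 2 * v ^ 2)) := by ring
      _ ≤ _ := by gcongr
  rw [← norm_eq_abs]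
  refine (norm_integral_le_of_norm_le (i1.add i2) (Filter.Eventually.of_forall fun v => ?_)).trans ?_
  · rw [norm_mul, norm_of_nonneg (exp_pos _).le, norm_eq_abs]
    calc _ ≤ exp (-(N ^ 2 * v ^ 2)) * (A * |v| + B) := by gcongr; exact hF v
      _ = A * (|v| * exp (-(N ^ 2 * v ^ 2))) + B * exp (-(N ^ 2 * v ^ 2)) := by ring
      _ ≤ A * (1 / N * exp (-(N ^ 2 / 2) * v ^ 2)) + B * exp (-(N ^ 2 * v ^ 2)) := by
          have := mul_le_mul_of_nonneg_left (hv v) hA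
          linarith
      _ = _ := by simp only [Pi.add_apply]; ring
  · simp only [Pi.add_apply]
    rw [integral_add i1 i2, integral_const_mul, integral_const_mul, integral_gauss hN, integral_gaussian]
    have h1 : √(π / (N ^ 2 / 2)) ≤ 2 * √π / N := by
      rw [show π / (N ^ 2 / 2) = 2 * π / N ^ 2 by field_simp, sqrt_div (by positivity), sqrt_sq hN.le,
        sqrt_mul (by norm_num)]
      gcongr
      exact (sqrt_le_left (by norm_num)).2 (by norm_num)
    calc _ ≤ A / N * (2 * √π / N) + B * (√π / N) := by gcongr
      _ = _ := by ring

theorem abs_meanValue_sub_sub_integral_le {N : ℝ} (hN : 0 < N) (h : ℝ) {a : ℕ → ℝ}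
    (ha : a 0 = 0) (hc : ∀ n : ℕ, |n * a n| ≤ 1) (hs : Summable (fun n => ‖(a n : ℂ)‖)) (w : ℝ) :
    |√π / N * (meanValue (fun n => n * a n) w - meanValue (fun n => n * a n) (w - h)) -
      ∫ u in Set.Ici 0, exp (-u) * smoothDiff a N h (w - u)| ≤
    √π / N * (8 / N + exp (-w) + exp (-(w - h))) := by
  set M := meanValue (fun n => n * a n) with hM
  set G : ℝ → ℝ := fun v => exp (-(N ^ 2 * v ^ 2)) with hG
  set Q : ℕ → ℝ → ℝ := fun n v => a n * (G v * ((decay (w - log n) - decay (w - h - log n)) -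
    (decay (w - log n - v) - decay (w - h - log n - v)))) with hQ
  have iG : Integrable G := integrable_gauss hN
  have hQe : ∀ n v, Q n v = a n * ((G v * decay (w - log n) - G v * decay (w - h - log n)) -
    (G v * decay (w - log n - v) - G v * decay (w - h - log n - v))) := fun n v => by
    simp only [hQ]; ring
  have j1 : ∀ y, Integrable (fun v => G v * decay y) := fun y => iG.mul_const _
  have j2 : ∀ y, Integrable (fun v => G v * decay (y - v)) := fun y => integrable_gauss_mul_decay hN y
  have iQ : ∀ n, Integrable (Q n) := fun n => by
    have := (((j1 (w - log n)).sub (j1 (w - h - log n))).sub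
      ((j2 (w - log n)).sub (j2 (w - h - log n)))).const_mul (a n)
    refine this.congr (Filter.Eventually.of_forall fun v => ?_)
    simp only [hQe, Pi.sub_apply]
  have hQn : ∀ n v, ‖Q n v‖ ≤ ‖(a n : ℂ)‖ * (4 * G v) := fun n v => by
    have d1 := decay_nonneg (w - log n)
    have d2 := decay_le_one (w - log n)
    have d3 := decay_nonneg (w - h - log n)
    have d4 := decay_le_one (w - h - log n)
    have d5 := decay_nonneg (w - log n - v)
    have d6 := decay_le_one (w - log n - v)
    have d7 := decay_nonneg (w - h - log n - v)
    have d8 := decay_le_one (w - h - log n - v)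
    have hG0 : 0 < G v := exp_pos _
    simp only [hQ]
    rw [norm_mul, norm_mul, Complex.norm_real, norm_of_nonneg hG0.le, mul_comm 4]
    gcongr
    rw [norm_eq_abs, abs_le]
    constructor <;> linarith
  have sQ : Summable fun n => ∫ v, ‖Q n v‖ := by
    refine Summable.of_nonneg_of_le (fun n => integral_nonneg fun v => norm_nonneg _) (fun n => ?_)
      (hs.mul_right (∫ v, 4 * G v))
    rw [← integral_const_mul]
    exact integral_mono (iQ n).norm ((iG.const_mul 4).const_mul _) (hQn n)
  have key := hasSum_integral_of_summable_integral_norm iQ sQ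
  have e1 : ∀ n, ∫ v, Q n v = √π / N * (a n * decay (w - log n) - a n * decay (w - h - log n)) -
      a n * ∫ u in Set.Ici 0, exp (-u) * gaussDiff N h (w - log n - u) := fun n => by
    have e2 : ∫ u in Set.Ici 0, exp (-u) * gaussDiff N h (w - log n - u) =
        ∫ v, (G v * decay (w - log n - v) - G v * decay (w - h - log n - v)) := by
      rw [integral_sub (j2 _) (j2 _)]
      simp only [hG]
      rw [← integral_exp_mul_gauss_eq, ← integral_exp_mul_gauss_eq, ← integral_sub]
      · congr 1
        ext u
        rw [gaussDiff, mul_sub, show w - log n - u - h = w - h - log n - u by ring]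
      all_goals
        refine Integrable.mul_bdd (c := 1) integrable_exp_neg_Ici
          (Measurable.aestronglyMeasurable (by fun_prop)) (Filter.Eventually.of_forall fun u => ?_)
        rw [norm_of_nonneg (exp_pos _).le]
        exact exp_le_one_iff.2 (neg_nonpos.2 (by positivity))
    simp only [hQe]
    have j3 : Integrable (fun v => G v * decay (w - log n) - G v * decay (w - h - log n)) :=
      (j1 _).sub (j1 _)
    have j4 : Integrable (fun v => G v * decay (w - log n - v) - G v * decay (w - h - log n - v)) :=
      (j2 _).sub (j2 _)
    rw [e2, integral_const_mul, integral_sub j3 j4,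
      integral_sub (j1 _) (j1 _), integral_mul_const, integral_mul_const]
    simp only [hG]
    rw [integral_gauss hN]
    ring
  have e3 : ∀ v, ∑' n, Q n v = G v * ((M w - M (w - h)) - (M (w - v) - M (w - h - v))) := fun v => by
    have k1 := ((hasSum_mul_decay ha w).sub (hasSum_mul_decay ha (w - h))).sub
      ((hasSum_mul_decay ha (w - v)).sub (hasSum_mul_decay ha (w - h - v)))
    rw [← (k1.mul_left (G v)).tsum_eq]
    refine tsum_congr fun n => ?_
    simp only [hQ]
    rw [show w - v - log n = w - log n - v by ring, show w - h - v - log n = w - h - log n - v by ring]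
    ring
  simp only [e1, e3] at key
  have key2 := (((hasSum_mul_decay ha w).sub (hasSum_mul_decay ha (w - h))).mul_left (√π / N)).sub
    (hasSum_integral_exp_mul_gaussDiff N h hs w)
  rw [key2.unique key]
  refine (abs_integral_gauss_mul_le hN (A := 4) (B := exp (-w) + exp (-(w - h))) (by norm_num)
    fun v => ?_).trans (le_of_eq (by ring))
  have m1 := abs_meanValue_sub_le hc (w - v) w
  have m2 := abs_meanValue_sub_le hc (w - h - v) (w - h)
  rw [← hM, sub_sub_cancel_left, abs_neg] at m1 m2
  rw [abs_le] at m1 m2 ⊢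
  constructor <;> linarith [m1.1, m1.2, m2.1, m2.2]

theorem abs_integral_smoothDiff_le {D : ℝ → ℝ} {K δ w : ℝ} (hδ : 0 < δ)
    (hwδ : 4 ≤ δ * w) (hK : ∀ u, |D u| ≤ K) (hD : ∀ u, w / 2 ≤ u → |D u| ≤ K * δ) :
    |∫ u in Set.Ici 0, exp (-u) * D (w - u)| ≤ 2 * K * δ := by
  have hK0 : 0 ≤ K := (abs_nonneg _).trans (hK 0)
  have hintegrable : IntegrableOn (fun u : ℝ => exp (-(1 / 2) * u)) (Set.Ici 0) := by
    rw [integrableOn_Ici_iff_integrableOn_Ioi]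
    exact exp_neg_integrableOn_Ioi 0 (by norm_num)
  have hval : ∫ u in Set.Ici (0 : ℝ), exp (-(1 / 2) * u) = 2 := by
    rw [integral_Ici_eq_integral_Ioi]
    have := integral_exp_mul_Ioi (a := -(1 / 2)) (by norm_num) 0
    rw [this]
    norm_num
  rw [← norm_eq_abs]
  refine (norm_integral_le_of_norm_le (hintegrable.integrable.const_mul (K * δ)) ?_).trans ?_
  · refine (ae_restrict_iff' measurableSet_Ici).2 (Filter.Eventually.of_forall fun u hu => ?_)
    rw [norm_mul, norm_of_nonneg (exp_pos _).le, norm_eq_abs]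
    have hu0 : 0 ≤ u := hu
    by_cases h : u ≤ w / 2
    · calc _ ≤ exp (-(1 / 2) * u) * (K * δ) := by
            gcongr
            · linarith
            · exact hD _ (by linarith)
        _ = _ := by ring
    · have e1 : exp (-u) = exp (-(1 / 2) * u) * exp (-(1 / 2) * u) := by
        rw [← exp_add]
        congr 1
        ring
      have e2 : exp (-(1 / 2) * u) ≤ δ := by
        have h4 : 1 / δ ≤ w / 4 := by
          rw [div_le_iff₀ hδ]
          linarith
        have h5 : 1 / δ ≤ exp (w / 4) := by linarith [add_one_le_exp (w / 4)]
        calc exp (-(1 / 2) * u) ≤ exp (-(w / 4)) := exp_le_exp.2 (by linarith)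
          _ = (exp (w / 4))⁻¹ := exp_neg _
          _ ≤ (1 / δ)⁻¹ := by gcongr
          _ = δ := by simp
      rw [e1]
      calc _ ≤ exp (-(1 / 2) * u) * δ * K := by
            gcongr
            exact hK _
        _ = _ := by ring
  · rw [integral_const_mul, hval]
    linarith

theorem sum_log_ge (m : ℕ) : m * log m - m ≤ ∑ n ∈ Icc 1 m, log (n : ℝ) := by
  induction m with
  | zero => simp
  | succ m ih =>
    rw [sum_Icc_succ_top (by omega)]
    rcases Nat.eq_zero_or_pos m with rfl | hm
    · simp
    · have hm0 : (0 : ℝ) < m := by exact_mod_cast hm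
      have h1 : log ((m + 1 : ℝ) / m) ≤ 1 / m := by
        refine (log_le_sub_one_of_pos (by positivity)).trans (le_of_eq ?_)
        field_simp
        ring
      rw [log_div (by positivity) hm0.ne'] at h1
      have h2 : m * (log (m + 1 : ℝ) - log m) ≤ 1 := by
        calc _ ≤ m * (1 / m : ℝ) := by gcongr
          _ = 1 := by field_simp
      push_cast
      linarith

theorem sum_sub_log_le (w : ℝ) : ∑ n ∈ Icc 1 ⌊exp w⌋₊, (w - log (n : ℝ)) ≤ exp w := by
  rw [sum_sub_distrib, sum_const, Nat.card_Icc, Nat.add_sub_cancel, nsmul_eq_mul]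
  have h1 := sum_log_ge ⌊exp w⌋₊
  set m := ⌊exp w⌋₊
  have h3 : (m : ℝ) * (w - log m) ≤ exp w - m := by
    rcases Nat.eq_zero_or_pos m with h0 | hm
    · rw [h0]
      simp [(exp_pos w).le]
    · have hm0 : (0 : ℝ) < m := by exact_mod_cast hm
      have e : exp (w - log m) = exp w / m := by rw [exp_sub, exp_log hm0]
      have h2 := add_one_le_exp (w - log m)
      rw [e, le_div_iff₀ hm0] at h2
      linarith
  linarith

theorem abs_meanValue_sub_rankin_le {c : ℕ → ℝ} (hc : ∀ n, |c n| ≤ 1) {v w : ℝ} (hw : 0 < w)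
    (hvw : v ≤ w) :
    |meanValue c v - exp 1 * meanValue (fun n => c n * exp (-(1 / w * log n))) v| ≤
      2 / w * (1 + (w - v)) := by
  have e : meanValue c v - exp 1 * meanValue (fun n => c n * exp (-(1 / w * log n))) v =
      exp (-v) * ∑ n ∈ Icc 1 ⌊exp v⌋₊, c n * (1 - exp (1 - 1 / w * log n)) := by
    rw [meanValue, meanValue, mul_left_comm, ← mul_sub, mul_sum, ← sum_sub_distrib]
    congr 1
    refine sum_congr rfl fun n _ => ?_
    rw [sub_eq_add_neg 1 (1 / w * log n), exp_add]
    ring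
  have hw' : 0 ≤ w - v := by linarith
  have hb : |∑ n ∈ Icc 1 ⌊exp v⌋₊, c n * (1 - exp (1 - 1 / w * log n))| ≤
      ∑ n ∈ Icc 1 ⌊exp v⌋₊, 2 / w * ((v - log n) + (w - v)) := by
    refine (abs_sum_le_sum_abs _ _).trans (sum_le_sum fun n hn => ?_)
    obtain ⟨h1, h2⟩ := mem_Icc.1 hn
    have hn0 : (0 : ℝ) < n := by exact_mod_cast h1
    have h3 : log n ≤ v := by
      rw [log_le_iff_le_exp hn0]
      exact (Nat.le_floor_iff (exp_pos v).le).1 h2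
    have h4 := log_natCast_nonneg n
    have t0 : 0 ≤ 1 - 1 / w * log n := by
      rw [sub_nonneg, one_div_mul_eq_div, div_le_one hw]
      linarith
    have t1 : 1 - 1 / w * log n ≤ 1 := by
      have : 0 ≤ 1 / w * log n := by positivity
      linarith
    have t2 := abs_exp_sub_one_le (x := 1 - 1 / w * log n) (by rw [abs_of_nonneg t0]; exact t1)
    rw [abs_of_nonneg t0] at t2
    rw [abs_mul, abs_sub_comm]
    calc _ ≤ 1 * (2 * (1 - 1 / w * log n)) := by
          gcongr
          exact hc n
      _ = _ := by field_simp; ring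
  rw [e, abs_mul, abs_of_pos (exp_pos _)]
  have e1 : exp (-v) * exp v = 1 := by rw [← exp_add]; simp
  calc _ ≤ exp (-v) * ∑ n ∈ Icc 1 ⌊exp v⌋₊, 2 / w * ((v - log n) + (w - v)) := by gcongr
    _ = exp (-v) * (2 / w * (∑ n ∈ Icc 1 ⌊exp v⌋₊, (v - log (n : ℝ)) + ⌊exp v⌋₊ * (w - v))) := by
        rw [← mul_sum, sum_add_distrib, sum_const, Nat.card_Icc, Nat.add_sub_cancel, nsmul_eq_mul]
    _ ≤ exp (-v) * (2 / w * (exp v + exp v * (w - v))) := by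
        have h1 := sum_sub_log_le v
        have h2 := Nat.floor_le (exp_pos v).le
        gcongr
    _ = 2 / w * (1 + (w - v)) * (exp (-v) * exp v) := by ring
    _ = _ := by rw [e1, mul_one]

/-- Slow variation of the mean value of a completely multiplicative function. -/
theorem exists_abs_meanValue_sub_le :
    ∃ K : ℝ, 1 ≤ K ∧ ∀ (f : ℕ →*₀ ℝ) (Z h : ℝ), (∀ n, |f n| ≤ 1) → 2 ≤ Z → 0 ≤ h → h ≤ Z ^ 12 →
      |meanValue f (Z ^ 48) - meanValue f (Z ^ 48 - h)| ≤ K / Z := by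
  obtain ⟨K1, hK11, hK1⟩ := exists_abs_smoothDiff_le
  obtain ⟨K2, hK21, hK2⟩ := exists_abs_smoothDiff_le_div
  refine ⟨3 * (2 * (K1 + K2) + 12) + 8, by linarith, fun f Z h hf hZ hh hhZ => ?_⟩
  have hZ0 : 0 < Z := by linarith
  set w := Z ^ 48 with hw
  have hw0 : 0 < w := by positivity
  have hX1 : 1 < Z ^ 3 := one_lt_pow₀ (by linarith) (by norm_num)
  have hXw : (Z ^ 3) ^ 16 = w := by rw [hw]; ring
  have hXh : h ≤ (Z ^ 3) ^ 4 := by rw [← pow_mul]; exact hhZ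
  have hσ : 0 < 1 / w := by positivity
  have hσ1 : 1 / w ≤ 1 := by
    rw [div_le_one hw0]
    exact one_le_pow₀ (by linarith)
  set a := shiftedCoeff f (1 / w) with ha
  have ha0 : a 0 = 0 := by simp [ha, shiftedCoeff]
  have hna : ∀ n : ℕ, n * a n = f n * exp (-(1 / w * log n)) := fun n => by
    rcases eq_or_ne n 0 with rfl | hn
    · simp
    · simp only [ha, shiftedCoeff]
      field_simp
  have hc : ∀ n : ℕ, |n * a n| ≤ 1 := fun n => by
    rw [hna, abs_mul, abs_of_pos (exp_pos _)]
    refine mul_le_one₀ (hf n) (exp_pos _).le (exp_le_one_iff.2 (neg_nonpos.2 ?_))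
    have := log_natCast_nonneg n
    positivity
  have hs := summable_norm_shiftedCoeff hf hσ hσ1
  have hD1 : ∀ u, |smoothDiff a Z h u| ≤ K1 + K2 := fun u => by
    refine (hK1 a Z h u (by linarith) hh
      (abs_coeff_le_of_le_rankin hσ.le (abs_shiftedCoeff_le hf))).trans ?_
    have := min_le_left 1 (exp u)
    nlinarith
  have hw4 : 4 ≤ 1 / Z ^ 2 * w := by
    have : 1 / Z ^ 2 * w = Z ^ 46 := by rw [hw]; field_simp
    rw [this]
    calc (4 : ℝ) ≤ 2 ^ 46 := by norm_num
      _ ≤ Z ^ 46 := by gcongr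
  have hD2 : ∀ u, w / 2 ≤ u → |smoothDiff a Z h u| ≤ (K1 + K2) * (1 / Z ^ 2) := fun u hu => by
    have := hK2 f (Z ^ 3) Z h u hf hX1 (by linarith) hh hXh (by rwa [hXw])
    rw [hXw] at this
    refine this.trans ?_
    rw [show K2 * Z / Z ^ 3 = K2 * (1 / Z ^ 2) by field_simp]
    gcongr
    linarith
  have I1 := abs_integral_smoothDiff_le (by positivity) hw4 hD1 hD2
  have I2 := abs_meanValue_sub_sub_integral_le hZ0 h ha0 hc hs w
  simp only [hna] at I2
  set Mσ := meanValue (fun n => f n * exp (-(1 / w * log n))) with hMσ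
  have hhw : h ≤ w / 2 := by
    refine hhZ.trans ?_
    rw [hw, le_div_iff₀ two_pos]
    calc Z ^ 12 * 2 ≤ Z ^ 12 * Z ^ 36 := by
          gcongr
          calc (2 : ℝ) ≤ 2 ^ 36 := by norm_num
            _ ≤ _ := by gcongr
      _ = _ := by ring
  have hwZ : Z ^ 2 ≤ w := by
    rw [hw]
    exact pow_le_pow_right₀ (by linarith) (by norm_num)
  have ex : ∀ y, w / 2 ≤ y → exp (-y) ≤ 2 / Z := fun y hy => by
    rw [exp_neg]
    have : Z / 2 ≤ exp y := by nlinarith [add_one_le_exp y]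
    calc _ ≤ (Z / 2)⁻¹ := by gcongr
      _ = _ := by simp
  have hpi : 1 ≤ √π := by
    rw [Real.one_le_sqrt]
    linarith [pi_gt_three]
  have hpi0 : 0 < √π := by linarith
  have hinc : |Mσ w - Mσ (w - h)| ≤ (2 * (K1 + K2) + 12) / Z := by
    have s1 : |√π / Z * (Mσ w - Mσ (w - h))| ≤ √π / Z * ((2 * (K1 + K2) + 12) / Z) := by
      have h1 : √π / Z * (8 / Z + exp (-w) + exp (-(w - h))) ≤ √π / Z * (12 / Z) := by
        gcongr
        have := ex w (by linarith)
        have := ex (w - h) (by linarith)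
        have e : 12 / Z = 8 / Z + 2 / Z + 2 / Z := by ring
        linarith
      have h2 : 2 * (K1 + K2) * (1 / Z ^ 2) ≤ √π / Z * (2 * (K1 + K2) / Z) := by
        calc _ = 1 * (2 * (K1 + K2) * (1 / Z ^ 2)) := by ring
          _ ≤ √π * (2 * (K1 + K2) * (1 / Z ^ 2)) := by gcongr
          _ = _ := by ring
      have h3 : √π / Z * ((2 * (K1 + K2) + 12) / Z) =
        √π / Z * (2 * (K1 + K2) / Z) + √π / Z * (12 / Z) := by ring
      rw [abs_le] at I1 I2 ⊢
      constructor <;> linarith [I1.1, I1.2, I2.1, I2.2]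
    rw [abs_mul, abs_of_pos (by positivity)] at s1
    exact le_of_mul_le_mul_left s1 (by positivity)
  have r1 := abs_meanValue_sub_rankin_le hf hw0 (le_refl w)
  have r2 := abs_meanValue_sub_rankin_le hf hw0 (show w - h ≤ w by linarith)
  rw [← hMσ] at r1 r2
  have he : exp 1 ≤ 3 := by linarith [exp_one_lt_d9]
  have t1 : |exp 1 * (Mσ w - Mσ (w - h))| ≤ 3 * ((2 * (K1 + K2) + 12) / Z) := by
    rw [abs_mul, abs_of_pos (exp_pos _)]
    gcongr
  have t2 : 2 / w * (1 + (w - w)) + 2 / w * (1 + (w - (w - h))) ≤ 8 / Z := by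
    have hp : 2 ≤ Z ^ 12 := by
      calc (2 : ℝ) ≤ 2 ^ 12 := by norm_num
        _ ≤ _ := by gcongr
    calc _ = 2 / w * (2 + h) := by ring
      _ ≤ 2 / w * (2 * Z ^ 12) := by gcongr; linarith
      _ = 4 / Z ^ 36 := by rw [hw]; field_simp; ring
      _ ≤ 4 / Z ^ 1 := by
          gcongr 4 / ?_
          exact pow_le_pow_right₀ (by linarith) (by norm_num)
      _ ≤ _ := by rw [pow_one]; gcongr; norm_num
  have t3 : (3 * (2 * (K1 + K2) + 12) + 8) / Z = 3 * ((2 * (K1 + K2) + 12) / Z) + 8 / Z := by ring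
  have t4 : exp 1 * (Mσ w - Mσ (w - h)) = exp 1 * Mσ w - exp 1 * Mσ (w - h) := by ring
  rw [t4] at t1
  rw [abs_le] at r1 r2 t1 ⊢
  constructor <;> linarith [r1.1, r1.2, r2.1, r2.2, t1.1, t1.2]

end MeanValue

section LogarithmicSums

open Real MeasureTheory Finset

/-- The logarithmic sum of `c` over the positive integers up to `exp w`. -/
noncomputable def logSum (c : ℕ → ℝ) (w : ℝ) : ℝ := ∑ n ∈ Icc 1 ⌊exp w⌋₊, c n / n

theorem sum_eq_exp_mul_meanValue (c : ℕ → ℝ) (w : ℝ) :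
    ∑ n ∈ Icc 1 ⌊exp w⌋₊, c n = exp w * meanValue c w := by
  rw [meanValue, ← mul_assoc, ← exp_add, add_neg_cancel, exp_zero, one_mul]

theorem logSum_sub_ge {c : ℕ → ℝ} {v w κ : ℝ} (hvw : v ≤ w)
    (hκ : ∀ u ∈ Set.Icc v w, κ ≤ meanValue c u) (hc : c 0 = 0) :
    meanValue c w - meanValue c v + κ * (w - v) ≤ logSum c w - logSum c v := by
  set a := exp v with ha
  set b := exp w with hb
  have ha0 : 0 < a := exp_pos v
  have hab : a ≤ b := exp_le_exp.2 hvw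
  have hS : ∀ m : ℕ, ∑ k ∈ Icc 0 m, c k = ∑ k ∈ Icc 1 m, c k := fun m => by
    rw [← add_sum_Ioc_eq_sum_Icc (Nat.zero_le m), hc, zero_add]
    rfl
  have hd : ∀ t ∈ Set.Icc a b, DifferentiableAt ℝ (fun t : ℝ => t⁻¹) t := fun t ht =>
    differentiableAt_inv (ha0.trans_le ht.1).ne'
  have hcd : ContinuousOn (deriv fun t : ℝ => t⁻¹) (Set.Icc a b) := by
    rw [deriv_inv']
    exact ((continuousOn_id.pow 2).inv₀ fun t ht => by
      have := ha0.trans_le ht.1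
      exact (pow_pos this 2).ne').neg
  have hdi : IntegrableOn (deriv fun t : ℝ => t⁻¹) (Set.Icc a b) := hcd.integrableOn_Icc
  have key := sum_mul_eq_sub_sub_integral_mul c ha0.le hab hd hdi
  have hL : logSum c w - logSum c v = ∑ k ∈ Ioc ⌊a⌋₊ ⌊b⌋₊, (k : ℝ)⁻¹ * c k := by
    have := sum_Ioc_consecutive (fun k : ℕ => c k / k) (Nat.zero_le _) (Nat.floor_le_floor hab)
    have h2 : logSum c w = ∑ k ∈ Ioc 0 ⌊b⌋₊, c k / k := rfl
    have h3 : logSum c v = ∑ k ∈ Ioc 0 ⌊a⌋₊, c k / k := rfl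
    rw [h2, h3, ← this, add_sub_cancel_left]
    exact sum_congr rfl fun k _ => by rw [div_eq_inv_mul]
  rw [hL, key, hS, hS, ha, hb, sum_eq_exp_mul_meanValue, sum_eq_exp_mul_meanValue, ← ha, ← hb,
    inv_mul_cancel_left₀ (ha0.trans_le hab).ne', inv_mul_cancel_left₀ ha0.ne']
  have hintegral : ∫ t in Set.Ioc a b, -(κ * t⁻¹) = -(κ * (w - v)) := by
    rw [integral_neg, integral_const_mul, ← intervalIntegral.integral_of_le hab,
      integral_inv_of_pos ha0 (ha0.trans_le hab), ha, hb, ← exp_sub, log_exp]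
  have hmono : ∫ t in Set.Ioc a b, deriv (fun t : ℝ => t⁻¹) t * ∑ k ∈ Icc 0 ⌊t⌋₊, c k ≤
      ∫ t in Set.Ioc a b, -(κ * t⁻¹) := by
    refine setIntegral_mono_on ((integrableOn_mul_sum_Icc c ha0.le hdi).mono_set Set.Ioc_subset_Icc_self)
      ?_ measurableSet_Ioc fun t ht => ?_
    · refine (ContinuousOn.integrableOn_Icc ?_).mono_set Set.Ioc_subset_Icc_self
      exact (continuousOn_const.mul (continuousOn_id.inv₀ fun t ht => (ha0.trans_le ht.1).ne')).neg
    · have ht0 : 0 < t := ha0.trans ht.1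
      have h1 := sum_eq_exp_mul_meanValue c (log t)
      rw [exp_log ht0] at h1
      have h2 := hκ (log t) ⟨(le_log_iff_exp_le ht0).2 ht.1.le, (log_le_iff_le_exp ht0).2 ht.2⟩
      rw [hS, h1, deriv_inv']
      simp only
      have e : -(t ^ 2)⁻¹ * (t * meanValue c (log t)) = -(meanValue c (log t) * t⁻¹) := by
        field_simp
      rw [e]
      gcongr
  linarith

theorem meanValue_neg (c : ℕ → ℝ) (w : ℝ) : meanValue (fun n => -c n) w = -meanValue c w := by
  simp [meanValue]

theorem logSum_neg (c : ℕ → ℝ) (w : ℝ) : logSum (fun n => -c n) w = -logSum c w := by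
  simp [logSum, neg_div]

theorem logSum_sub_le {c : ℕ → ℝ} {v w κ : ℝ} (hvw : v ≤ w)
    (hκ : ∀ u ∈ Set.Icc v w, meanValue c u ≤ κ) (hc : c 0 = 0) :
    logSum c w - logSum c v ≤ meanValue c w - meanValue c v + κ * (w - v) := by
  have := logSum_sub_ge (c := fun n => -c n) (κ := -κ) hvw
    (fun u hu => by rw [meanValue_neg]; exact neg_le_neg (hκ u hu)) (by simp [hc])
  simp only [meanValue_neg, logSum_neg] at this
  linarith

theorem abs_logSum_sub_le {c : ℕ → ℝ} {v w μ : ℝ} (hvw : v ≤ w)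
    (hμ : ∀ u ∈ Set.Icc v w, |meanValue c u| ≤ μ) (hc : c 0 = 0) :
    |logSum c w - logSum c v| ≤ μ * (2 + (w - v)) := by
  have h1 := logSum_sub_ge hvw (fun u hu => (abs_le.1 (hμ u hu)).1) hc
  have h2 := logSum_sub_le hvw (fun u hu => (abs_le.1 (hμ u hu)).2) hc
  have h3 := abs_le.1 (hμ w ⟨hvw, le_rfl⟩)
  have h4 := abs_le.1 (hμ v ⟨le_rfl, hvw⟩)
  rw [abs_le]
  constructor <;> linarith [h3.1, h3.2, h4.1, h4.2]

theorem abs_logSum_sub_le_of_abs_le_one {c : ℕ → ℝ} (hc : ∀ n, |c n| ≤ 1) (hc0 : c 0 = 0) {v w : ℝ}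
    (hvw : v ≤ w) : |logSum c w - logSum c v| ≤ 2 + (w - v) := by
  have := abs_logSum_sub_le hvw (fun u _ => abs_meanValue_le_one hc u) hc0
  rwa [one_mul] at this

theorem geom_sum_nonneg_of_abs_le_one {r : ℝ} (hr : |r| ≤ 1) (k : ℕ) :
    0 ≤ ∑ i ∈ range k, r ^ i := by
  rcases (abs_le.1 hr).2.eq_or_lt with h | h
  · rw [h]
    positivity
  · have h1 := geom_sum_mul_neg r k
    have h2 : r ^ k ≤ 1 := (le_abs_self _).trans (by
      rw [abs_pow]
      exact pow_le_one₀ (abs_nonneg _) hr)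
    have h3 : 0 < 1 - r := by linarith
    by_contra hneg
    push Not at hneg
    nlinarith

/-- A completely multiplicative function as an arithmetic function. -/
def toArithmetic (f : ℕ →*₀ ℝ) : ArithmeticFunction ℝ := ⟨f, map_zero f⟩

theorem toArithmetic_apply (f : ℕ →*₀ ℝ) (n : ℕ) : toArithmetic f n = f n := rfl

theorem isMultiplicative_toArithmetic (f : ℕ →*₀ ℝ) : (toArithmetic f).IsMultiplicative :=
  ⟨map_one f, fun _ => map_mul f _ _⟩

theorem toArithmetic_mul_zeta_nonneg {f : ℕ →*₀ ℝ} (hf : ∀ n, |f n| ≤ 1) (n : ℕ) :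
    0 ≤ (toArithmetic f * (ArithmeticFunction.zeta : ArithmeticFunction ℝ)) n := by
  rcases eq_or_ne n 0 with rfl | hn
  · simp
  have hm : (toArithmetic f * (ArithmeticFunction.zeta : ArithmeticFunction ℝ)).IsMultiplicative :=
    (isMultiplicative_toArithmetic f).mul ArithmeticFunction.isMultiplicative_zeta.natCast
  rw [ArithmeticFunction.IsMultiplicative.multiplicative_factorization _ hm hn]
  refine Finset.prod_nonneg fun p hp => ?_
  have hp' : p.Prime := Nat.prime_of_mem_primeFactors hp
  beta_reduce
  rw [ArithmeticFunction.coe_mul_zeta_apply, Nat.sum_divisors_prime_pow hp']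
  simp only [toArithmetic_apply, map_pow]
  exact geom_sum_nonneg_of_abs_le_one (hf p) _

theorem sum_mul_div_nonneg {f : ℕ →*₀ ℝ} (hf : ∀ n, |f n| ≤ 1) (m : ℕ) :
    0 ≤ ∑ d ∈ Icc 1 m, f d * ((m / d : ℕ) : ℝ) := by
  have h := ArithmeticFunction.sum_Ioc_mul_zeta_eq_sum (toArithmetic f) m
  have h2 : 0 ≤ ∑ n ∈ Ioc 0 m, (toArithmetic f * (ArithmeticFunction.zeta : ArithmeticFunction ℝ)) n :=
    sum_nonneg fun n _ => toArithmetic_mul_zeta_nonneg hf n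
  rw [h] at h2
  exact h2

theorem sum_mul_floor_div_le {c : ℕ → ℝ} (hc : ∀ n, |c n| ≤ 1) {x : ℝ} (hx : 0 ≤ x) (k : ℕ) :
    ∑ d ∈ Icc 1 k, c d * ((⌊x⌋₊ / d : ℕ) : ℝ) ≤ x * ∑ d ∈ Icc 1 k, c d / d + k := by
  have e : (k : ℝ) = ∑ d ∈ Icc 1 k, (1 : ℝ) := by simp
  rw [e, mul_sum, ← sum_add_distrib]
  refine sum_le_sum fun d hd => ?_
  have hd0 : (0 : ℝ) < d := by exact_mod_cast (mem_Icc.1 hd).1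
  rw [← Nat.floor_div_natCast]
  have h1 := Nat.floor_le (show 0 ≤ x / d by positivity)
  have h2 := Nat.lt_floor_add_one (x / d)
  have h3 : x * (c d / d) = c d * (x / d) := by ring
  rw [h3]
  have := abs_le.1 (hc d)
  nlinarith [this.1, this.2]

theorem neg_one_le_logSum {f : ℕ →*₀ ℝ} (hf : ∀ n, |f n| ≤ 1) (w : ℝ) : -1 ≤ logSum f w := by
  have h1 := sum_mul_div_nonneg hf ⌊exp w⌋₊
  have h2 := sum_mul_floor_div_le hf (exp_pos w).le ⌊exp w⌋₊
  have h3 := Nat.floor_le (exp_pos w).le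
  have h4 : ∑ d ∈ Icc 1 ⌊exp w⌋₊, f d / d = logSum f w := rfl
  rw [h4] at h2
  nlinarith [exp_pos w]

theorem sum_sum_Icc_div (c : ℕ → ℝ) (m J : ℕ) :
    ∑ j ∈ Icc 1 J, ∑ d ∈ Icc 1 (m / j), c d = ∑ d ∈ Icc 1 m, c d * ((min J (m / d) : ℕ) : ℝ) := by
  have h1 : ∀ j ∈ Icc 1 J, ∑ d ∈ Icc 1 (m / j), c d = ∑ d ∈ Icc 1 m, if j ≤ m / d then c d else 0 := by
    intro j hj
    rw [← sum_filter]
    refine sum_congr ?_ fun _ _ => rfl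
    ext d
    have hj0 : 0 < j := (mem_Icc.1 hj).1
    simp only [mem_Icc, mem_filter]
    constructor
    · rintro ⟨h1, h2⟩
      refine ⟨⟨h1, h2.trans (Nat.div_le_self _ _)⟩, ?_⟩
      rw [Nat.le_div_iff_mul_le h1]
      rw [Nat.le_div_iff_mul_le hj0] at h2
      linarith
    · rintro ⟨⟨h1, -⟩, h2⟩
      refine ⟨h1, ?_⟩
      rw [Nat.le_div_iff_mul_le h1] at h2
      rw [Nat.le_div_iff_mul_le hj0]
      linarith
  rw [sum_congr rfl h1, sum_comm]
  refine sum_congr rfl fun d _ => ?_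
  rw [← sum_filter, sum_const, nsmul_eq_mul, mul_comm]
  congr 2
  have : (Icc 1 J).filter (fun j => j ≤ m / d) = Icc 1 (min J (m / d)) := by
    ext j
    simp only [mem_filter, mem_Icc, le_min_iff]
    tauto
  rw [this, Nat.card_Icc, Nat.add_sub_cancel]

theorem floor_exp_sub_log {w : ℝ} {j : ℕ} (hj : 0 < j) : ⌊exp (w - log j)⌋₊ = ⌊exp w⌋₊ / j := by
  rw [exp_sub, exp_log (by exact_mod_cast hj), Nat.floor_div_natCast]

theorem neg_le_logSum {f : ℕ →*₀ ℝ} (hf : ∀ n, |f n| ≤ 1) {w μ : ℝ} {J : ℕ} (hJ : 0 < J)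
    (hμ : ∀ u ∈ Set.Icc (w - log J) w, |meanValue f u| ≤ μ) :
    -(1 / J + μ * (4 + 2 * log J)) ≤ logSum f w := by
  have hJ0 : (0 : ℝ) < J := by exact_mod_cast hJ
  have hlJ : 0 ≤ log J := log_natCast_nonneg J
  set m := ⌊exp w⌋₊ with hm
  have hμ0 : 0 ≤ μ := (abs_nonneg _).trans (hμ w ⟨by linarith, le_rfl⟩)
  have hS : ∀ j ∈ Icc 1 J, |∑ d ∈ Icc 1 (m / j), f d| ≤ exp w * (μ * (1 / j)) := fun j hj => by
    obtain ⟨h1, h2⟩ := mem_Icc.1 hj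
    have hj0 : (0 : ℝ) < j := by exact_mod_cast h1
    have hlog : log j ≤ log J := log_le_log hj0 (by exact_mod_cast h2)
    rw [hm, ← floor_exp_sub_log h1, sum_eq_exp_mul_meanValue, abs_mul, abs_of_pos (exp_pos _), exp_sub,
      exp_log hj0]
    calc _ ≤ exp w / j * μ := by
          gcongr
          exact hμ _ ⟨by linarith, by linarith [log_natCast_nonneg j]⟩
      _ = _ := by ring
  have hH : ∑ j ∈ Icc 1 J, (1 / (j : ℝ)) ≤ 1 + log J := by
    have := harmonic_le_one_add_log J
    rw [harmonic_eq_sum_Icc] at this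
    push_cast at this
    simpa [one_div] using this
  have h1 := sum_mul_div_nonneg hf m
  have h2 : |∑ d ∈ Icc 1 m, f d * ((min J (m / d) : ℕ) : ℝ)| ≤ exp w * (μ * (1 + log J)) := by
    rw [← sum_sum_Icc_div]
    refine (abs_sum_le_sum_abs _ _).trans ((sum_le_sum hS).trans ?_)
    rw [← mul_sum, ← mul_sum]
    gcongr
  have h3 : ∑ d ∈ Icc 1 m, f d * ((m / d : ℕ) : ℝ) - ∑ d ∈ Icc 1 m, f d * ((min J (m / d) : ℕ) : ℝ) =
      ∑ d ∈ Icc 1 (m / J), f d * ((m / d : ℕ) : ℝ) - J * ∑ d ∈ Icc 1 (m / J), f d := by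
    rw [mul_sum, ← sum_sub_distrib, ← sum_sub_distrib]
    symm
    rw [← sum_subset (Icc_subset_Icc_right (Nat.div_le_self m J))]
    · refine sum_congr rfl fun d hd => ?_
      obtain ⟨a1, a2⟩ := mem_Icc.1 hd
      have : J ≤ m / d := by
        rw [Nat.le_div_iff_mul_le a1]
        rw [Nat.le_div_iff_mul_le hJ] at a2
        linarith
      rw [min_eq_left this]
      ring
    · intro d hd hd2
      obtain ⟨a1, a2⟩ := mem_Icc.1 hd
      have : m / d ≤ J := by
        by_contra hlt
        push Not at hlt
        refine hd2 (mem_Icc.2 ⟨a1, ?_⟩)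
        have := hlt.le
        rw [Nat.le_div_iff_mul_le a1] at this
        rw [Nat.le_div_iff_mul_le hJ]
        linarith
      rw [min_eq_right this, sub_self]
  have h4 := sum_mul_floor_div_le hf (exp_pos w).le (m / J)
  have h5 := hS J (mem_Icc.2 ⟨hJ, le_rfl⟩)
  have h6 : ((m / J : ℕ) : ℝ) ≤ exp w * (1 / J) := by
    refine Nat.cast_div_le.trans ?_
    rw [mul_one_div]
    gcongr
    exact Nat.floor_le (exp_pos w).le
  have h7 : ∑ d ∈ Icc 1 (m / J), f d / d = logSum f (w - log J) := by
    rw [logSum, floor_exp_sub_log hJ]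
  have h8 := abs_logSum_sub_le (by linarith) hμ (map_zero f)
  rw [sub_sub_cancel] at h8
  rw [← hm, h7] at h4
  have h9 : |J * ∑ d ∈ Icc 1 (m / J), f d| ≤ exp w * μ := by
    rw [abs_mul, abs_of_pos hJ0]
    calc _ ≤ J * (exp w * (μ * (1 / J))) := by gcongr
      _ = _ := by field_simp
  have h10 : 0 ≤ exp w * (logSum f (w - log J) + 1 / J + μ + μ * (1 + log J)) := by
    have := abs_le.1 h2
    have := abs_le.1 h9
    linarith
  have h11 := nonneg_of_mul_nonneg_right h10 (exp_pos w)
  have := abs_le.1 h8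
  linarith

/-- Where the logarithmic sum is moderate, the mean value is small. -/
theorem exists_abs_meanValue_le :
    ∃ K : ℝ, 1 ≤ K ∧ ∀ (f : ℕ →*₀ ℝ) (Z w B : ℝ), (∀ n, |f n| ≤ 1) → 2 ≤ Z → 2 * Z ^ 48 ≤ w →
      0 ≤ B → logSum f w ≤ B → |meanValue f w| ≤ K / Z + (B + 4) / Z ^ 12 := by
  obtain ⟨K, hK1, hK⟩ := exists_abs_meanValue_sub_le
  refine ⟨K, hK1, fun f Z w B hf hZ hw hB hL => ?_⟩
  have hZ0 : 0 < Z := by linarith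
  have hT : 0 < Z ^ 12 := by positivity
  have slow : ∀ u v, v ≤ u → Z ^ 48 ≤ v → u - v ≤ Z ^ 12 → |meanValue f u - meanValue f v| ≤ K / Z := by
    intro u v huv hv hd
    have hu : 0 < u := lt_of_lt_of_le (by positivity) (hv.trans huv)
    set Y := u ^ ((1 : ℝ) / 48) with hY
    have hYu : Y ^ 48 = u := by
      rw [hY, ← rpow_natCast, ← rpow_mul hu.le]
      norm_num
    have hZY : Z ≤ Y := by
      refine le_of_pow_le_pow_left₀ (n := 48) (by norm_num) (by positivity) ?_
      rw [hYu]
      exact hv.trans huv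
    have := hK f Y (u - v) hf (hZ.trans hZY) (by linarith) (hd.trans (by gcongr))
    rw [hYu, sub_sub_cancel] at this
    exact this.trans (by gcongr)
  have hZ12 : Z ^ 12 ≤ Z ^ 48 := pow_le_pow_right₀ (by linarith) (by norm_num)
  by_contra hcon
  push Not at hcon
  set κ := (B + 4) / Z ^ 12 with hκ
  have hκT : κ * Z ^ 12 = B + 4 := by rw [hκ]; field_simp
  rcases lt_abs.1 hcon with h | h
  · have h1 := logSum_sub_ge (c := f) (v := w - Z ^ 12) (w := w) (κ := κ) (by linarith) (fun u hu => by
      have := abs_le.1 (slow w u hu.2 (by linarith [hu.1]) (by linarith [hu.1]))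
      linarith [this.2]) (map_zero f)
    have h2 := abs_le.1 (abs_meanValue_le_one hf w)
    have h3 := abs_le.1 (abs_meanValue_le_one hf (w - Z ^ 12))
    have h4 := neg_one_le_logSum hf (w - Z ^ 12)
    rw [sub_sub_cancel, hκT] at h1
    linarith [h2.1, h3.2]
  · have h1 := logSum_sub_le (c := f) (v := w) (w := w + Z ^ 12) (κ := -κ) (by linarith) (fun u hu => by
      have := abs_le.1 (slow u w hu.1 (by linarith [hu.1]) (by linarith [hu.2]))
      linarith [this.2]) (map_zero f)
    have h2 := abs_le.1 (abs_meanValue_le_one hf w)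
    have h3 := abs_le.1 (abs_meanValue_le_one hf (w + Z ^ 12))
    have h4 := neg_one_le_logSum hf (w + Z ^ 12)
    rw [add_sub_cancel_left, neg_mul, hκT] at h1
    linarith [h2.1, h3.2]

end LogarithmicSums

section MultiplicativeFunctions

open Real Finset ArithmeticFunction

/-- The completely multiplicative function agreeing with `f` at the primes. -/
noncomputable def completelyMultiplicativePart (f : ℕ → ℝ) : ℕ →*₀ ℝ where
  toFun n := if n = 0 then 0 else n.factorization.prod fun p k => f p ^ k
  map_zero' := by simp
  map_one' := by simp
  map_mul' m n := by
    rcases eq_or_ne m 0 with rfl | hm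
    · simp
    rcases eq_or_ne n 0 with rfl | hn
    · simp
    rw [if_neg (mul_ne_zero hm hn), if_neg hm, if_neg hn, Nat.factorization_mul hm hn,
      Finsupp.prod_add_index' (fun _ => pow_zero _) fun _ _ _ => pow_add _ _ _]

theorem completelyMultiplicativePart_prime (f : ℕ → ℝ) {p : ℕ} (hp : p.Prime) :
    completelyMultiplicativePart f p = f p := by
  change (if p = 0 then 0 else p.factorization.prod fun p k => f p ^ k) = f p
  rw [if_neg hp.ne_zero, hp.factorization,
    Finsupp.prod_single_index (h := fun p k => f p ^ k) (pow_zero _), pow_one]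

theorem abs_completelyMultiplicativePart_le_one {f : ℕ → ℝ} (hf : ∀ n, |f n| ≤ 1) (n : ℕ) :
    |completelyMultiplicativePart f n| ≤ 1 := by
  change |if n = 0 then 0 else n.factorization.prod fun p k => f p ^ k| ≤ 1
  split_ifs
  · simp
  · rw [Finsupp.prod, abs_prod]
    refine prod_le_one (fun _ _ => abs_nonneg _) fun p _ => ?_
    rw [abs_pow]
    exact pow_le_one₀ (abs_nonneg _) (hf p)

/-- The Dirichlet quotient of `f` by its completely multiplicative part. -/
noncomputable def multiplicativeQuotient (f : ArithmeticFunction ℝ) : ArithmeticFunction ℝ :=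
  (toArithmetic (completelyMultiplicativePart f)).pmul (moebius : ArithmeticFunction ℝ) * f

theorem multiplicativeQuotient_mul (f : ArithmeticFunction ℝ) :
    multiplicativeQuotient f * toArithmetic (completelyMultiplicativePart f) = f := by
  set g := toArithmetic (completelyMultiplicativePart f)
  have h : g.pmul (moebius : ArithmeticFunction ℝ) * g = 1 := by
    have h2 : g.pmul (moebius : ArithmeticFunction ℝ) * g =
        g.pmul ((moebius : ArithmeticFunction ℝ) * (zeta : ArithmeticFunction ℝ)) := by
      ext n
      rw [mul_apply, pmul_apply, mul_apply, mul_sum]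
      refine sum_congr rfl fun a ha => ?_
      obtain ⟨h1, h2⟩ := Nat.mem_divisorsAntidiagonal.1 ha
      have h3 : a.2 ≠ 0 := by
        rintro h3
        rw [h3, mul_zero] at h1
        exact h2 h1.symm
      rw [← h1, pmul_apply, natCoe_apply, zeta_apply_ne h3]
      simp only [g, toArithmetic_apply, map_mul]
      push_cast
      ring
    rw [h2, coe_moebius_mul_coe_zeta]
    ext n
    rcases eq_or_ne n 1 with rfl | hn
    · simp [g, toArithmetic_apply]
    · simp [one_apply_ne hn]
  rw [multiplicativeQuotient, mul_right_comm, h, one_mul]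

theorem isMultiplicative_multiplicativeQuotient {f : ArithmeticFunction ℝ} (hf : f.IsMultiplicative) :
    (multiplicativeQuotient f).IsMultiplicative :=
  ((isMultiplicative_toArithmetic _).pmul isMultiplicative_moebius.intCast).mul hf

theorem multiplicativeQuotient_prime_pow (f : ArithmeticFunction ℝ) {p : ℕ} (hp : p.Prime) (k : ℕ) :
    multiplicativeQuotient f (p ^ (k + 1)) = f (p ^ (k + 1)) - f p * f (p ^ k) := by
  rw [multiplicativeQuotient, mul_apply, Nat.sum_divisorsAntidiagonal
    (fun a b => (toArithmetic (completelyMultiplicativePart f)).pmul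
      (moebius : ArithmeticFunction ℝ) a * f b), Nat.sum_divisors_prime_pow hp, sum_range_succ',
    sum_range_succ', sum_eq_zero]
  · simp only [pmul_apply, toArithmetic_apply, zero_add, pow_one, pow_zero, Nat.div_one,
      completelyMultiplicativePart_prime f hp, intCoe_apply, moebius_apply_prime hp, map_one,
      moebius_apply_one]
    rw [pow_succ, Nat.mul_div_cancel _ hp.pos]
    push_cast
    ring
  · intro i _
    rw [pmul_apply, intCoe_apply, moebius_apply_prime_pow hp (by omega), if_neg (by omega)]
    simp

variable {f : ArithmeticFunction ℝ}

theorem abs_multiplicativeQuotient_prime_pow_le (hf : ∀ n, |f n| ≤ 1) {p : ℕ} (hp : p.Prime) (k : ℕ) :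
    |multiplicativeQuotient f (p ^ (k + 1))| ≤ 2 := by
  rw [multiplicativeQuotient_prime_pow f hp]
  have h1 : |f p * f (p ^ k)| ≤ 1 := by
    rw [abs_mul]
    exact mul_le_one₀ (hf _) (abs_nonneg _) (hf _)
  have := abs_le.1 h1
  have := abs_le.1 (hf (p ^ (k + 1)))
  rw [abs_le]
  constructor <;> linarith

theorem multiplicativeQuotient_prime (hf : f.IsMultiplicative) {p : ℕ} (hp : p.Prime) :
    multiplicativeQuotient f p = 0 := by
  have := multiplicativeQuotient_prime_pow f hp 0
  simpa [hf.map_one] using this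

/-- The weight `|h n| n ^ (-3/4)` of the Dirichlet quotient `h` of `f`. -/
noncomputable def quotientWeight (f : ArithmeticFunction ℝ) (n : ℕ) : ℝ :=
  |multiplicativeQuotient f n| * (n : ℝ) ^ (-(3 / 4) : ℝ)

theorem quotientWeight_nonneg (n : ℕ) : 0 ≤ quotientWeight f n := by
  unfold quotientWeight
  positivity

theorem quotientWeight_one (hf : f.IsMultiplicative) : quotientWeight f 1 = 1 := by
  simp [quotientWeight, (isMultiplicative_multiplicativeQuotient hf).map_one]

theorem quotientWeight_mul (hf : f.IsMultiplicative) {m n : ℕ} (hmn : m.Coprime n) :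
    quotientWeight f (m * n) = quotientWeight f m * quotientWeight f n := by
  rw [quotientWeight, quotientWeight, quotientWeight,
    (isMultiplicative_multiplicativeQuotient hf).map_mul_of_coprime hmn, abs_mul, Nat.cast_mul,
    mul_rpow (Nat.cast_nonneg _) (Nat.cast_nonneg _)]
  ring

theorem quotientWeight_prime_pow_le (hf1 : ∀ n, |f n| ≤ 1) {p : ℕ} (hp : p.Prime) (k : ℕ) :
    quotientWeight f (p ^ (k + 2)) ≤
      2 * (p : ℝ) ^ (-(3 / 2) : ℝ) * ((p : ℝ) ^ (-(3 / 4) : ℝ)) ^ k := by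
  have hp0 : (0 : ℝ) < p := by exact_mod_cast hp.pos
  have e : ((p ^ (k + 2) : ℕ) : ℝ) ^ (-(3 / 4) : ℝ) =
      (p : ℝ) ^ (-(3 / 2) : ℝ) * ((p : ℝ) ^ (-(3 / 4) : ℝ)) ^ k := by
    rw [Nat.cast_pow, ← rpow_natCast, ← rpow_natCast, ← rpow_mul hp0.le, ← rpow_mul hp0.le,
      ← rpow_add hp0]
    congr 1
    push_cast
    ring
  rw [quotientWeight, e, mul_assoc]
  gcongr
  exact abs_multiplicativeQuotient_prime_pow_le hf1 hp (k + 1)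

theorem rpow_neg_three_quarters_le {p : ℕ} (hp : p.Prime) : (p : ℝ) ^ (-(3 / 4) : ℝ) ≤ 4 / 5 := by
  have h1 : (p : ℝ) ^ (-(3 / 4) : ℝ) ≤ (2 : ℝ) ^ (-(3 / 4) : ℝ) :=
    rpow_le_rpow_of_nonpos (by norm_num) (by exact_mod_cast hp.two_le) (by norm_num)
  refine h1.trans ?_
  refine le_of_pow_le_pow_left₀ (n := 4) (by norm_num) (by norm_num) ?_
  rw [← rpow_natCast, ← rpow_mul (by norm_num)]
  norm_num

theorem summable_quotientWeight_prime_pow (hf1 : ∀ n, |f n| ≤ 1) {p : ℕ} (hp : p.Prime) :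
    Summable fun k => quotientWeight f (p ^ k) := by
  rw [← summable_nat_add_iff 2]
  refine Summable.of_nonneg_of_le (fun _ => quotientWeight_nonneg _)
    (fun k => quotientWeight_prime_pow_le hf1 hp k) (Summable.mul_left _ ?_)
  exact summable_geometric_of_lt_one (by positivity) (by linarith [rpow_neg_three_quarters_le hp])

theorem tsum_quotientWeight_prime_pow_le (hf : f.IsMultiplicative) (hf1 : ∀ n, |f n| ≤ 1) {p : ℕ}
    (hp : p.Prime) : ∑' k, quotientWeight f (p ^ k) ≤ 1 + 10 * (p : ℝ) ^ (-(3 / 2) : ℝ) := by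
  have hs := summable_quotientWeight_prime_pow hf1 hp
  have hr := rpow_neg_three_quarters_le hp
  have hg := summable_geometric_of_lt_one (r := (p : ℝ) ^ (-(3 / 4) : ℝ)) (by positivity) (by linarith)
  rw [← hs.sum_add_tsum_nat_add 2, sum_range_succ, sum_range_one, pow_zero, pow_one,
    quotientWeight_one hf, quotientWeight, multiplicativeQuotient_prime hf hp, abs_zero, zero_mul,
    add_zero]
  gcongr
  refine (((summable_nat_add_iff 2).2 hs).tsum_le_tsum
    (fun k => quotientWeight_prime_pow_le hf1 hp k) (hg.mul_left _)).trans ?_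
  rw [tsum_mul_left, tsum_geometric_of_lt_one (by positivity) (by linarith)]
  have h5 : (1 - (p : ℝ) ^ (-(3 / 4) : ℝ))⁻¹ ≤ 5 := by
    rw [inv_le_comm₀ (by linarith) (by norm_num)]
    linarith
  have h0 : 0 ≤ (p : ℝ) ^ (-(3 / 2) : ℝ) := by positivity
  nlinarith

/-- The total weight of the Dirichlet quotient is bounded uniformly in `f`. -/
theorem exists_tsum_quotientWeight_le :
    ∃ C : ℝ, 1 ≤ C ∧ ∀ f : ArithmeticFunction ℝ, f.IsMultiplicative → (∀ n, |f n| ≤ 1) →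
      Summable (quotientWeight f) ∧ ∑' n, quotientWeight f n ≤ C := by
  have hS : Summable fun n : ℕ => (n : ℝ) ^ (-(3 / 2) : ℝ) := summable_nat_rpow.2 (by norm_num)
  set A := ∑' n : ℕ, (n : ℝ) ^ (-(3 / 2) : ℝ)
  have hA : 0 ≤ A := tsum_nonneg fun n => by positivity
  refine ⟨exp (10 * A), one_le_exp (by positivity), fun f hf hf1 => ?_⟩
  have hsum : ∀ {p : ℕ}, p.Prime → Summable fun n : ℕ => ‖quotientWeight f (p ^ n)‖ := fun hp => by
    simpa only [norm_of_nonneg (quotientWeight_nonneg _)] using summable_quotientWeight_prime_pow hf1 hp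
  have hb : ∀ N, ∑ n ∈ range N, quotientWeight f n ≤ exp (10 * A) := fun N => by
    obtain ⟨h1, h2⟩ := EulerProduct.summable_and_hasSum_smoothNumbers_prod_primesBelow_tsum
      (quotientWeight_one hf) (fun h => quotientWeight_mul hf h) hsum N
    have h3 : ∏ p ∈ N.primesBelow, ∑' n : ℕ, quotientWeight f (p ^ n) ≤ exp (10 * A) := by
      calc _ ≤ ∏ p ∈ N.primesBelow, exp (10 * (p : ℝ) ^ (-(3 / 2) : ℝ)) := by
            refine prod_le_prod (fun _ _ => tsum_nonneg fun _ => quotientWeight_nonneg _) fun p hp => ?_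
            refine (tsum_quotientWeight_prime_pow_le hf hf1 (Nat.prime_of_mem_primesBelow hp)).trans ?_
            rw [add_comm]
            exact add_one_le_exp _
        _ = exp (10 * ∑ p ∈ N.primesBelow, (p : ℝ) ^ (-(3 / 2) : ℝ)) := by rw [← exp_sum, mul_sum]
        _ ≤ _ := by
            gcongr
            exact hS.sum_le_tsum _ fun n _ => by positivity
    refine le_trans ?_ h3
    rw [← h2.tsum_eq, tsum_subtype N.smoothNumbers (quotientWeight f)]
    have h4 : Summable (N.smoothNumbers.indicator (quotientWeight f)) :=
      summable_subtype_iff_indicator.1 h2.summable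
    refine le_trans ?_ (h4.sum_le_tsum (range N) fun n _ =>
      Set.indicator_nonneg (fun _ _ => quotientWeight_nonneg _) _)
    refine sum_le_sum fun n hn => ?_
    rcases eq_or_ne n 0 with rfl | hn0
    · rw [quotientWeight]
      simp only [ArithmeticFunction.map_zero, abs_zero, zero_mul]
      exact Set.indicator_nonneg (fun _ _ => quotientWeight_nonneg _) _
    · rw [Set.indicator_of_mem (Nat.mem_smoothNumbers_of_lt (Nat.pos_of_ne_zero hn0) (mem_range.1 hn))]
  exact ⟨summable_of_sum_range_le (fun _ => quotientWeight_nonneg _) hb,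
    Real.tsum_le_of_sum_range_le (fun _ => quotientWeight_nonneg _) hb⟩

theorem abs_multiplicativeQuotient_div_le (n : ℕ) :
    |multiplicativeQuotient f n / n| ≤ quotientWeight f n := by
  rcases eq_or_ne n 0 with rfl | hn
  · simp [quotientWeight]
  have h1 : (1 : ℝ) ≤ n := by exact_mod_cast Nat.one_le_iff_ne_zero.2 hn
  rw [quotientWeight, abs_div, Nat.abs_cast, div_eq_mul_inv, ← rpow_neg_one]
  gcongr
  norm_num

theorem summable_multiplicativeQuotient_div (h : Summable (quotientWeight f)) :
    Summable fun n => multiplicativeQuotient f n / n :=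
  Summable.of_norm_bounded h fun n => abs_multiplicativeQuotient_div_le n

theorem abs_tsum_multiplicativeQuotient_div_le (h : Summable (quotientWeight f)) :
    |∑' n, multiplicativeQuotient f n / n| ≤ ∑' n, quotientWeight f n :=
  tsum_of_norm_bounded (f := fun n : ℕ => multiplicativeQuotient f n / n) h.hasSum fun n =>
    abs_multiplicativeQuotient_div_le n

/-- The normalised defect `∑ (1 + f (2 ^ k)) / 2 ^ k`. -/
noncomputable def twoDefect (f : ℕ → ℝ) : ℝ := ∑' k : ℕ, (1 + f (2 ^ (k + 1))) / 2 ^ (k + 1)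

theorem twoDefect_nonneg {f : ℕ → ℝ} (hf1 : ∀ n, |f n| ≤ 1) : 0 ≤ twoDefect f :=
  tsum_nonneg fun k => div_nonneg (by linarith [(abs_le.1 (hf1 (2 ^ (k + 1)))).1]) (by positivity)

theorem summable_two_pow {f : ℕ → ℝ} (hf1 : ∀ n, |f n| ≤ 1) :
    Summable fun k : ℕ => f (2 ^ k) / 2 ^ k := by
  refine Summable.of_norm_bounded (g := fun k => ((1 : ℝ) / 2) ^ k)
    (summable_geometric_of_lt_one (by norm_num) (by norm_num)) fun k => ?_
  rw [norm_eq_abs, abs_div, abs_of_pos (show (0 : ℝ) < 2 ^ k by positivity), div_pow, one_pow]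
  gcongr
  exact hf1 _

theorem twoDefect_eq (hf : f 1 = 1) (hf1 : ∀ n, |f n| ≤ 1) :
    twoDefect f = ∑' k : ℕ, f (2 ^ k) / 2 ^ k := by
  have hs := summable_two_pow hf1
  have hs2 := (summable_nat_add_iff 1).2 hs
  have hg : HasSum (fun k : ℕ => (1 : ℝ) / 2 ^ (k + 1)) 1 := by
    simpa only [div_div, ← pow_succ'] using hasSum_geometric_two' 1
  rw [hs.tsum_eq_zero_add, pow_zero, pow_zero, hf, div_one, twoDefect]
  simp_rw [add_div]
  rw [hg.summable.tsum_add hs2, hg.tsum_eq]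

theorem tsum_multiplicativeQuotient_two_pow (hf : f.IsMultiplicative) (hf1 : ∀ n, |f n| ≤ 1) :
    ∑' k : ℕ, multiplicativeQuotient f (2 ^ k) / ((2 ^ k : ℕ) : ℝ) =
      (1 - f 2 / 2) * twoDefect f := by
  have hs := summable_two_pow hf1
  have hs2 := (summable_nat_add_iff 1).2 hs
  have e : ∀ k : ℕ, multiplicativeQuotient f (2 ^ (k + 1)) / ((2 ^ (k + 1) : ℕ) : ℝ) =
      f (2 ^ (k + 1)) / 2 ^ (k + 1) - f 2 / 2 * (f (2 ^ k) / 2 ^ k) := fun k => by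
    rw [multiplicativeQuotient_prime_pow f Nat.prime_two]
    push_cast
    rw [pow_succ (2 : ℝ)]
    field_simp
  have hS : Summable fun k : ℕ => multiplicativeQuotient f (2 ^ k) / ((2 ^ k : ℕ) : ℝ) := by
    rw [← summable_nat_add_iff 1]
    simp_rw [e]
    exact hs2.sub (hs.mul_left _)
  rw [hS.tsum_eq_zero_add]
  simp_rw [e]
  rw [hs2.tsum_sub (hs.mul_left _), tsum_mul_left, twoDefect_eq hf.map_one hf1,
    pow_zero, (isMultiplicative_multiplicativeQuotient hf).map_one]
  have := hs.tsum_eq_zero_add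
  rw [pow_zero, pow_zero, hf.map_one] at this
  rw [Nat.cast_one]
  linear_combination -this

theorem le_tsum_multiplicativeQuotient_prime_pow (hf : f.IsMultiplicative) (hf1 : ∀ n, |f n| ≤ 1)
    {p : ℕ} (hp : p.Prime) :
    1 - 2 / ((p : ℝ) * (p - 1)) ≤ ∑' k : ℕ, multiplicativeQuotient f (p ^ k) / ((p ^ k : ℕ) : ℝ) := by
  have hp2 : (2 : ℝ) ≤ p := by exact_mod_cast hp.two_le
  have hS : Summable fun k : ℕ => multiplicativeQuotient f (p ^ k) / ((p ^ k : ℕ) : ℝ) :=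
    Summable.of_norm_bounded (summable_quotientWeight_prime_pow hf1 hp) fun k =>
      abs_multiplicativeQuotient_div_le _
  have hr : (1 : ℝ) / p < 1 := by
    rw [div_lt_one (by linarith)]
    linarith
  have hg := hasSum_geometric_of_lt_one (r := (1 : ℝ) / p) (by positivity) hr
  rw [← hS.sum_add_tsum_nat_add 2, sum_range_succ, sum_range_one, pow_zero, pow_one,
    multiplicativeQuotient_prime hf hp, (isMultiplicative_multiplicativeQuotient hf).map_one]
  have h1 := (hg.mul_left (-(2 / (p : ℝ) ^ 2))).summable.tsum_le_tsum (fun k => ?_)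
    ((summable_nat_add_iff 2).2 hS)
  · rw [(hg.mul_left (-(2 / (p : ℝ) ^ 2))).tsum_eq] at h1
    have e : -(2 / (p : ℝ) ^ 2) * (1 - 1 / (p : ℝ))⁻¹ = -(2 / ((p : ℝ) * (p - 1))) := by
      have h3 : (p : ℝ) - 1 ≠ 0 := by linarith
      have h4 : (p : ℝ) ≠ 0 := by linarith
      rw [one_sub_div h4]
      field_simp
    rw [e] at h1
    simp only [Nat.cast_one, div_one, zero_div, add_zero]
    linarith
  · have := (abs_le.1 (abs_multiplicativeQuotient_prime_pow_le hf1 hp (k + 1))).1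
    have h0 : (0 : ℝ) < ((p ^ (k + 2) : ℕ) : ℝ) := by exact_mod_cast pow_pos hp.pos _
    rw [le_div_iff₀ h0]
    refine le_trans (le_of_eq ?_) this
    push_cast
    have : (p : ℝ) ≠ 0 := by linarith
    rw [div_pow, one_pow]
    field_simp
    ring

theorem twoDefect_div_six_le (hf : f.IsMultiplicative) (hf1 : ∀ n, |f n| ≤ 1)
    (h : Summable (quotientWeight f)) :
    twoDefect f / 6 ≤ ∑' n, multiplicativeQuotient f n / n := by
  set E : ℕ → ℝ := fun p => ∑' k : ℕ, multiplicativeQuotient f (p ^ k) / ((p ^ k : ℕ) : ℝ) with hE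
  have hlim : Filter.Tendsto (fun n : ℕ => ∏ p ∈ n.primesBelow, E p) Filter.atTop
      (nhds (∑' n, multiplicativeQuotient f n / n)) := by
    refine EulerProduct.eulerProduct (f := fun n : ℕ => multiplicativeQuotient f n / n) ?_ ?_ ?_ ?_
    · simp [(isMultiplicative_multiplicativeQuotient hf).map_one]
    · intro m n hmn
      rw [(isMultiplicative_multiplicativeQuotient hf).map_mul_of_coprime hmn, Nat.cast_mul,
        mul_div_mul_comm]
    · exact (summable_multiplicativeQuotient_div h).norm
    · simp
  have hd := twoDefect_nonneg hf1
  have hlow : ∀ N : ℕ, twoDefect f / 6 * ((N + 3 : ℝ) / (N + 1)) ≤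
      ∏ p ∈ (N + 3).primesBelow, E p := fun N => by
    induction N with
    | zero =>
      have : (0 + 3).primesBelow = {2} := by decide
      rw [this, prod_singleton, hE]
      simp only
      rw [tsum_multiplicativeQuotient_two_pow hf hf1]
      have := (abs_le.1 (hf1 2)).2
      push_cast
      nlinarith
    | succ N ih =>
      have hN : (0 : ℝ) ≤ N := Nat.cast_nonneg N
      rw [show N + 1 + 3 = (N + 3) + 1 by ring, Nat.primesBelow_succ]
      split_ifs with hp
      · rw [prod_insert (Nat.notMem_primesBelow _)]
        have h1 : 1 - 2 / (((N + 3 : ℕ) : ℝ) * (((N + 3 : ℕ) : ℝ) - 1)) ≤ E (N + 3) :=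
          le_tsum_multiplicativeQuotient_prime_pow hf hf1 hp
        push_cast at h1 ⊢
        have e : twoDefect f / 6 * (((N : ℝ) + 1 + 3) / (N + 1 + 1)) =
            (1 - 2 / (((N : ℝ) + 3) * (N + 3 - 1))) * (twoDefect f / 6 * ((N + 3) / (N + 1))) := by
          have : (N : ℝ) + 3 - 1 ≠ 0 := by linarith
          field_simp
          ring
        rw [e]
        refine mul_le_mul h1 ih (by positivity) (le_trans ?_ h1)
        · rw [sub_nonneg, div_le_one (by nlinarith)]
          nlinarith
      · refine le_trans ?_ ih
        push_cast
        gcongr ?_ * ?_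
        rw [div_le_div_iff₀ (by linarith) (by linarith)]
        nlinarith
  refine ge_of_tendsto hlim (Filter.eventually_atTop.2 ⟨3, fun N hN => ?_⟩)
  obtain ⟨M, rfl⟩ := Nat.exists_eq_add_of_le' hN
  refine le_trans ?_ (hlow M)
  refine le_mul_of_one_le_right (by positivity) ?_
  rw [one_le_div (by positivity)]
  linarith

end MultiplicativeFunctions

section SmallLogarithmicSums

open Real Finset

variable {f : ArithmeticFunction ℝ}

theorem logSum_sub_log_eq_zero (c : ℕ → ℝ) {L : ℝ} {d : ℕ} (hd : ⌊exp L⌋₊ < d) :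
    logSum c (L - log d) = 0 := by
  rw [logSum, floor_exp_sub_log (by omega), Nat.div_eq_of_lt hd]
  simp

theorem logSum_eq_sum_multiplicativeQuotient (f : ArithmeticFunction ℝ) (L : ℝ) :
    logSum f L = ∑ d ∈ Icc 1 ⌊exp L⌋₊,
      multiplicativeQuotient f d / d * logSum (completelyMultiplicativePart f) (L - log d) := by
  let A : ArithmeticFunction ℝ → ArithmeticFunction ℝ := fun h => ⟨fun n => h n / n, by simp⟩
  have hA : ∀ g h, A (g * h) = A g * A h := fun g h => by
    ext n
    change (g * h) n / n = _
    rw [ArithmeticFunction.mul_apply, ArithmeticFunction.mul_apply, sum_div]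
    refine sum_congr rfl fun a ha => ?_
    rw [← (Nat.mem_divisorsAntidiagonal.1 ha).1, Nat.cast_mul]
    exact mul_div_mul_comm _ _ _ _
  have h1 : logSum f L = ∑ n ∈ Ioc 0 ⌊exp L⌋₊, A f n := rfl
  rw [h1]
  nth_rewrite 1 [← multiplicativeQuotient_mul f]
  rw [hA, ArithmeticFunction.sum_Ioc_mul_eq_sum_sum]
  refine sum_congr rfl fun d hd => ?_
  rw [logSum, floor_exp_sub_log (mem_Ioc.1 hd).1]
  rfl

theorem abs_logSum_sub_le_of_quotient (h : Summable (quotientWeight f)) {L M : ℝ}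
    (hM : ∀ d : ℕ, 0 < d → |logSum (completelyMultiplicativePart f) (L - log d) -
      logSum (completelyMultiplicativePart f) L| ≤ M * (d : ℝ) ^ (1 / 4 : ℝ)) :
    |logSum f L - (∑' n, multiplicativeQuotient f n / n) *
      logSum (completelyMultiplicativePart f) L| ≤ (∑' n, quotientWeight f n) * M := by
  set g := completelyMultiplicativePart f
  have hout : ∀ d ∉ Icc 1 ⌊exp L⌋₊, multiplicativeQuotient f d / d * logSum g (L - log d) = 0 := by
    intro d hd
    rcases Nat.eq_zero_or_pos d with rfl | hd0
    · simp
    · rw [logSum_sub_log_eq_zero, mul_zero]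
      by_contra hlt
      exact hd (mem_Icc.2 ⟨hd0, by omega⟩)
  have hs := summable_multiplicativeQuotient_div h
  rw [logSum_eq_sum_multiplicativeQuotient, ← tsum_eq_sum (L := SummationFilter.unconditional ℕ) hout, ← tsum_mul_right,
    ← Summable.tsum_sub (summable_of_ne_finset_zero hout) (hs.mul_right _), ← tsum_mul_right]
  refine tsum_of_norm_bounded (f := fun d : ℕ => multiplicativeQuotient f d / d *
    logSum g (L - log d) - multiplicativeQuotient f d / d * logSum g L) (h.mul_right M).hasSum fun d => ?_
  rcases Nat.eq_zero_or_pos d with rfl | hd0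
  · simp [quotientWeight]
  have hd : (0 : ℝ) < d := by exact_mod_cast hd0
  rw [← mul_sub, norm_eq_abs, abs_mul, quotientWeight, abs_div, Nat.abs_cast]
  calc _ ≤ |multiplicativeQuotient f d| / d * (M * (d : ℝ) ^ (1 / 4 : ℝ)) := by
        gcongr
        exact hM d hd0
    _ = _ := by
        have : (d : ℝ) ^ (-(3 / 4) : ℝ) = (d : ℝ)⁻¹ * (d : ℝ) ^ (1 / 4 : ℝ) := by
          rw [← rpow_neg_one, ← rpow_add hd]
          norm_num
        rw [this]
        ring

theorem two_add_log_le {d : ℕ} (hd : 0 < d) : 2 + log d ≤ 10 * (d : ℝ) ^ (1 / 8 : ℝ) := by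
  have h1 : (1 : ℝ) ≤ d := by exact_mod_cast hd
  have h2 := log_le_rpow_div (x := d) (by linarith) (show (0 : ℝ) < 1 / 8 by norm_num)
  have h3 := one_le_rpow h1 (show (0 : ℝ) ≤ 1 / 8 by norm_num)
  linarith

/-- A multiplicative function of modulus at most one with a moderate completely multiplicative
logarithmic sum has a logarithmic sum that is not too negative. -/
theorem exists_neg_le_logSum :
    ∃ C : ℝ, 0 < C ∧ ∀ (f : ArithmeticFunction ℝ) (L : ℝ), f.IsMultiplicative → (∀ n, |f n| ≤ 1) →
      exp 1 ≤ L → 16 * log L ≤ L → 4 ≤ L ^ (1 / 48 : ℝ) → 6 * L ^ (-(1 / 20) : ℝ) ≤ twoDefect f →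
      -(C * (log L ^ 2 * L ^ (-(1 / 48) : ℝ))) ≤ logSum f L := by
  obtain ⟨C₀, hC₀1, hC₀⟩ := exists_tsum_quotientWeight_le
  obtain ⟨K, hK1, hK⟩ := exists_abs_meanValue_le
  set C₁ := 2 * K + 4096 * (10 * C₀ + 14) with hC₁
  refine ⟨C₀ * (30 * C₁ + 11), by positivity, fun f L hf hf1 hL1 hL2 hL3 hδ => ?_⟩
  set ℓ := log L with hℓ
  have hL0 : 0 < L := (exp_pos 1).trans_le hL1
  have hLone : 1 ≤ L := (one_le_exp zero_le_one).trans hL1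
  have hℓ1 : 1 ≤ ℓ := (le_log_iff_exp_le hL0).2 hL1
  set g := completelyMultiplicativePart f with hg
  have hg1 : ∀ n, |g n| ≤ 1 := abs_completelyMultiplicativePart_le_one hf1
  obtain ⟨hsum, htot⟩ := hC₀ f hf hf1
  set H := ∑' n, multiplicativeQuotient f n / n with hH
  have hHle : H ≤ C₀ := (le_abs_self _).trans ((abs_tsum_multiplicativeQuotient_div_le hsum).trans htot)
  have hHge : L ^ (-(1 / 20) : ℝ) ≤ H := by
    have := twoDefect_div_six_le hf hf1 hsum
    linarith
  have hp20 : 0 < L ^ (-(1 / 20) : ℝ) := rpow_pos_of_pos hL0 _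
  have hp48 : 0 < L ^ (-(1 / 48) : ℝ) := rpow_pos_of_pos hL0 _
  have hHpos : 0 < H := hp20.trans_le hHge
  by_contra hcon
  push Not at hcon
  have hFneg : logSum f L < 0 := hcon.trans_le (neg_nonpos.2 (by positivity))
  -- an upper bound for the completely multiplicative logarithmic sum
  have hlogd : ∀ d : ℕ, 0 < d → |logSum g (L - log d) - logSum g L| ≤ 2 + log d := fun d hd => by
    have := abs_logSum_sub_le_of_abs_le_one hg1 (map_zero g)
      (show L - log d ≤ L by linarith [log_natCast_nonneg d])
    rwa [abs_sub_comm, sub_sub_cancel] at this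
  have hG : logSum g L ≤ 10 * C₀ * L ^ (1 / 20 : ℝ) := by
    have h1 := abs_logSum_sub_le_of_quotient (M := 10) hsum (L := L) fun d hd => by
      refine (hlogd d hd).trans ((two_add_log_le hd).trans ?_)
      have : (1 : ℝ) ≤ d := by exact_mod_cast hd
      gcongr
      norm_num
    have h2 : H * logSum g L ≤ 10 * C₀ := by
      have := (abs_le.1 h1).1
      linarith
    rcases le_or_gt (logSum g L) 0 with h0 | h0
    · exact h0.trans (by positivity)
    · have h3 : L ^ (-(1 / 20) : ℝ) * logSum g L ≤ 10 * C₀ :=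
        (mul_le_mul_of_nonneg_right hHge h0.le).trans h2
      rw [rpow_neg hL0.le, inv_mul_le_iff₀ (by positivity)] at h3
      linarith
  -- consequently the mean values are small
  set μ := C₁ * (ℓ * L ^ (-(1 / 48) : ℝ)) with hμdef
  have hμ : ∀ u ∈ Set.Icc (L - 8 * ℓ) L, |meanValue g u| ≤ μ := by
    intro u hu
    set Z := L ^ (1 / 48 : ℝ) / 2 with hZ
    set B := 10 * C₀ * L ^ (1 / 20 : ℝ) + 2 + 8 * ℓ with hB
    have hZ48 : Z ^ 48 = L / 2 ^ 48 := by
      rw [hZ, div_pow, ← rpow_natCast, ← rpow_mul hL0.le]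
      norm_num
    have hZ12 : Z ^ 12 = L ^ (1 / 4 : ℝ) / 4096 := by
      rw [hZ, div_pow, ← rpow_natCast, ← rpow_mul hL0.le]
      norm_num
    have hBu : logSum g u ≤ B := by
      have := (abs_le.1 (abs_logSum_sub_le_of_abs_le_one hg1 (map_zero g) hu.2)).1
      linarith [hu.1]
    have h1 := hK g Z u B hg1 (by linarith) (by rw [hZ48]; linarith [hu.1]) (by positivity) hBu
    refine h1.trans ?_
    have e1 : K / Z = 2 * K * L ^ (-(1 / 48) : ℝ) := by
      rw [hZ, rpow_neg hL0.le]
      field_simp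
    have e2 : B + 4 ≤ (10 * C₀ + 14) * (ℓ * L ^ (1 / 20 : ℝ)) := by
      have h2 : 1 ≤ L ^ (1 / 20 : ℝ) := one_le_rpow hLone (by norm_num)
      have h3 : L ^ (1 / 20 : ℝ) ≤ ℓ * L ^ (1 / 20 : ℝ) := le_mul_of_one_le_left (by positivity) hℓ1
      have h4 : ℓ ≤ ℓ * L ^ (1 / 20 : ℝ) := le_mul_of_one_le_right (by positivity) h2
      have h5 := mul_le_mul_of_nonneg_left h3 (show 0 ≤ 10 * C₀ by positivity)
      linarith
    have e3 : L ^ (1 / 20 : ℝ) / L ^ (1 / 4 : ℝ) ≤ L ^ (-(1 / 48) : ℝ) := by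
      rw [← rpow_sub hL0]
      exact rpow_le_rpow_of_exponent_le hLone (by norm_num)
    have e4 : (B + 4) / Z ^ 12 ≤ 4096 * (10 * C₀ + 14) * (ℓ * L ^ (-(1 / 48) : ℝ)) := by
      rw [hZ12]
      calc _ ≤ (10 * C₀ + 14) * (ℓ * L ^ (1 / 20 : ℝ)) / (L ^ (1 / 4 : ℝ) / 4096) := by gcongr
        _ = 4096 * (10 * C₀ + 14) * (ℓ * (L ^ (1 / 20 : ℝ) / L ^ (1 / 4 : ℝ))) := by field_simp
        _ ≤ _ := by gcongr
    have e5 : 2 * K * L ^ (-(1 / 48) : ℝ) ≤ 2 * K * (ℓ * L ^ (-(1 / 48) : ℝ)) := by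
      gcongr
      exact le_mul_of_one_le_left hp48.le hℓ1
    rw [e1, hμdef, hC₁, add_mul]
    exact add_le_add e5 e4
  have hμ0 : 0 ≤ μ := by positivity
  -- choose the range in which slow variation is used
  set J := ⌊L ^ 8⌋₊ with hJ
  have hJle : (J : ℝ) ≤ L ^ 8 := Nat.floor_le (by positivity)
  have hJlt : L ^ 8 < J + 1 := Nat.lt_floor_add_one _
  have hL2' : 2 ≤ L := by linarith [add_one_le_exp 1]
  have hJge : L ≤ J := by
    have : L * 2 ^ 7 ≤ L * L ^ 7 := by gcongr
    have e : L * L ^ 7 = L ^ 8 := by ring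
    linarith
  have hJ0 : 0 < J := by exact_mod_cast hL0.trans_le hJge
  have hlogJ : log J ≤ 8 * ℓ := by
    refine (log_le_log (by exact_mod_cast hJ0) hJle).trans ?_
    rw [log_pow]
    norm_num [hℓ]
  have hGlow : -(1 / L + μ * (4 + 16 * ℓ)) ≤ logSum g L := by
    have h1 := neg_le_logSum hg1 hJ0 (w := L) (μ := μ) fun u hu => hμ u ⟨by linarith [hu.1], hu.2⟩
    refine le_trans (neg_le_neg (add_le_add ?_ ?_)) h1
    · gcongr
    · exact mul_le_mul_of_nonneg_left (by linarith) hμ0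
  have hM := abs_logSum_sub_le_of_quotient (M := μ * (2 + 8 * ℓ) + 10 * (1 / L)) hsum (L := L)
    fun d hd => by
      have hd1 : (1 : ℝ) ≤ d := by exact_mod_cast hd
      have hd4 : 1 ≤ (d : ℝ) ^ (1 / 4 : ℝ) := one_le_rpow hd1 (by norm_num)
      rw [add_mul]
      rcases le_or_gt d J with hdJ | hdJ
      · have hlog : log d ≤ 8 * ℓ :=
          (log_le_log (by linarith) (by exact_mod_cast hdJ)).trans hlogJ
        have h1 := abs_logSum_sub_le (c := g) (μ := μ) (show L - log d ≤ L by
          linarith [log_natCast_nonneg d]) (fun u hu => hμ u ⟨by linarith [hu.1], hu.2⟩) (map_zero g)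
        rw [abs_sub_comm, sub_sub_cancel] at h1
        have h2 : μ * (2 + log d) ≤ μ * (2 + 8 * ℓ) := by gcongr
        have h3 : 0 ≤ 10 * (1 / L) * (d : ℝ) ^ (1 / 4 : ℝ) := by positivity
        have h4 : μ * (2 + 8 * ℓ) ≤ μ * (2 + 8 * ℓ) * (d : ℝ) ^ (1 / 4 : ℝ) :=
          le_mul_of_one_le_right (by positivity) hd4
        linarith
      · have hLd : L ≤ (d : ℝ) ^ (1 / 8 : ℝ) := by
          refine le_of_pow_le_pow_left₀ (n := 8) (by norm_num) (by positivity) ?_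
          rw [← rpow_natCast ((d : ℝ) ^ (1 / 8 : ℝ)), ← rpow_mul (by linarith)]
          norm_num
          have : (J : ℝ) + 1 ≤ d := by exact_mod_cast hdJ
          linarith
        have h1 := (hlogd d hd).trans (two_add_log_le hd)
        have h2 : (d : ℝ) ^ (1 / 8 : ℝ) ≤ 1 / L * (d : ℝ) ^ (1 / 4 : ℝ) := by
          have e : (d : ℝ) ^ (1 / 4 : ℝ) = (d : ℝ) ^ (1 / 8 : ℝ) * (d : ℝ) ^ (1 / 8 : ℝ) := by
            rw [← rpow_add (by linarith)]
            norm_num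
          rw [one_div_mul_eq_div, le_div_iff₀ hL0, e]
          gcongr
        have h3 : 0 ≤ μ * (2 + 8 * ℓ) * (d : ℝ) ^ (1 / 4 : ℝ) := by positivity
        linarith
  have hMle := hM.trans (mul_le_mul_of_nonneg_right htot (by positivity))
  have h1 := (abs_le.1 hMle).1
  have h2 : -(C₀ * (1 / L + μ * (4 + 16 * ℓ))) ≤ H * logSum g L := by
    have hX : 0 ≤ 1 / L + μ * (4 + 16 * ℓ) := by positivity
    have a1 := mul_le_mul_of_nonneg_left hGlow hHpos.le
    have a2 := mul_le_mul_of_nonneg_right hHle hX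
    linarith
  have h3 : 1 / L ≤ ℓ ^ 2 * L ^ (-(1 / 48) : ℝ) := by
    have a1 : 1 / L ≤ L ^ (-(1 / 48) : ℝ) := by
      rw [one_div, ← rpow_neg_one]
      exact rpow_le_rpow_of_exponent_le hLone (by norm_num)
    exact a1.trans (le_mul_of_one_le_left hp48.le (one_le_pow₀ hℓ1))
  have h4 : μ * (6 + 24 * ℓ) ≤ 30 * C₁ * (ℓ ^ 2 * L ^ (-(1 / 48) : ℝ)) := by
    have a1 : μ * (6 + 24 * ℓ) ≤ μ * (30 * ℓ) := by
      gcongr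
      linarith
    have a2 : μ * (30 * ℓ) = 30 * C₁ * (ℓ ^ 2 * L ^ (-(1 / 48) : ℝ)) := by
      rw [hμdef]
      ring
    linarith
  have h5 : C₀ * (11 * (1 / L) + μ * (6 + 24 * ℓ)) ≤
      C₀ * (11 * (ℓ ^ 2 * L ^ (-(1 / 48) : ℝ)) + 30 * C₁ * (ℓ ^ 2 * L ^ (-(1 / 48) : ℝ))) := by
    gcongr
  linarith

theorem exists_twoDefect_le :
    ∃ L₀ : ℝ, ∀ (f : ArithmeticFunction ℝ) (L : ℝ), L₀ ≤ L → f.IsMultiplicative → (∀ n, |f n| ≤ 1) →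
      logSum f L < -1 / log L ^ ((3 : ℝ) / 5) → twoDefect f ≤ 6 * L ^ (-(1 : ℝ) / 20) := by
  obtain ⟨C, hC, hmain⟩ := exists_neg_le_logSum
  have e1 := Filter.eventually_ge_atTop (exp 1)
  have e2 := isLittleO_log_id_atTop.bound (show (0 : ℝ) < 1 / 16 by norm_num)
  have e3 := (tendsto_rpow_atTop (show (0 : ℝ) < 1 / 48 by norm_num)).eventually_ge_atTop 4
  have e4 := (isLittleO_log_rpow_rpow_atTop (s := 1 / 48) 3 (by norm_num)).bound (inv_pos.2 hC)
  obtain ⟨L₀, hL₀⟩ := Filter.eventually_atTop.1 (e1.and (e2.and (e3.and e4)))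
  refine ⟨L₀, fun f L hL hf hf1 hsmall => ?_⟩
  obtain ⟨h1, h2, h3, h4⟩ := hL₀ L hL
  have hL0 : 0 < L := (exp_pos 1).trans_le h1
  have hℓ1 : 1 ≤ log L := (le_log_iff_exp_le hL0).2 h1
  have hℓ0 : 0 < log L := by linarith
  simp only [id, norm_eq_abs] at h2 h4
  rw [abs_of_pos hℓ0, abs_of_pos hL0] at h2
  rw [abs_of_nonneg (by positivity), abs_of_nonneg (by positivity), rpow_ofNat] at h4
  by_contra hcon
  push Not at hcon
  rw [neg_div] at hcon
  have h5 := hmain f L hf hf1 h1 (by linarith) h3 hcon.le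
  have h6 : log L ^ ((3 : ℝ) / 5) ≤ log L := by
    have := rpow_le_rpow_of_exponent_le hℓ1 (show (3 : ℝ) / 5 ≤ 1 by norm_num)
    rwa [rpow_one] at this
  have h7 : C * (log L ^ 2 * L ^ (-(1 / 48) : ℝ)) ≤ 1 / log L ^ ((3 : ℝ) / 5) := by
    refine le_trans ?_ (one_div_le_one_div_of_le (by positivity) h6)
    rw [le_div_iff₀ hℓ0, rpow_neg hL0.le]
    have hp : 0 < L ^ (1 / 48 : ℝ) := by positivity
    have h8 : C * log L ^ 3 ≤ L ^ (1 / 48 : ℝ) := by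
      rwa [← le_inv_mul_iff₀ hC]
    calc _ = C * log L ^ 3 * (L ^ (1 / 48 : ℝ))⁻¹ := by ring
      _ ≤ L ^ (1 / 48 : ℝ) * (L ^ (1 / 48 : ℝ))⁻¹ := by gcongr
      _ = 1 := mul_inv_cancel₀ hp.ne'
  rw [neg_div] at hsmall
  linarith

end SmallLogarithmicSums

/-- Theorem 2, middle part: if a multiplicative `f` with `-1 ≤ f n ≤ 1`
has `∑_{n ≤ x} f n / n < -1/(log log x)^{3/5}`, then
`∑_{k ≥ 1} (1 + f(2^k))/2^k ≤ C (log x)^{-1/20}`. -/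
theorem small_sum_forces_f_two_near_minus_one :
    ∃ C x₀ : ℝ, ∀ x : ℝ, x₀ ≤ x →
      ∀ f : ℕ → ℝ, IsMult f → (∀ n : ℕ, 0 < n → -1 ≤ f n ∧ f n ≤ 1) →
        (∑ n ∈ Finset.Icc 1 ⌊x⌋₊, f n / n
            < -1 / (Real.log (Real.log x)) ^ ((3 : ℝ) / 5)) →
        (∑' k : ℕ, (1 + f (2 ^ (k + 1))) / 2 ^ (k + 1))
          ≤ C * (Real.log x) ^ (-(1 : ℝ) / 20) := by
  obtain ⟨L₀, hL₀⟩ := exists_twoDefect_le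
  refine ⟨6, Real.exp L₀, fun x hx f hf hf1 hsmall => ?_⟩
  have hx0 : 0 < x := (Real.exp_pos _).trans_le hx
  let F : ArithmeticFunction ℝ := ⟨fun n => if n = 0 then 0 else f n, if_pos rfl⟩
  have hF : ∀ n, n ≠ 0 → F n = f n := fun n hn => if_neg hn
  have hFm : F.IsMultiplicative := by
    refine ArithmeticFunction.IsMultiplicative.iff_ne_zero.2 ⟨by rw [hF 1 one_ne_zero, hf.1], ?_⟩
    intro m n hm hn hmn
    rw [hF _ (mul_ne_zero hm hn), hF m hm, hF n hn, hf.2 m n hmn]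
  have hF1 : ∀ n, |F n| ≤ 1 := fun n => by
    rcases Nat.eq_zero_or_pos n with rfl | hn
    · simp
    · rw [hF n hn.ne']
      exact abs_le.2 (hf1 n hn)
  have key := hL₀ F (Real.log x) ((Real.le_log_iff_exp_le hx0).2 hx) hFm hF1 (by
    rw [logSum, Real.exp_log hx0]
    refine lt_of_eq_of_lt (Finset.sum_congr rfl fun n hn => ?_) hsmall
    rw [hF n (by have := (Finset.mem_Icc.1 hn).1; omega)])
  refine le_trans (le_of_eq ?_) key
  exact tsum_congr fun k => by rw [hF _ (by positivity)]
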